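/- arXiv:0808.1616 — 2 statements merged into one kernel-verified Lean document; each statement's English description precedes it below -/
import Mathlib

section
/- There exist constants c > 0 and C > 0 such that for every real B ≥ 16 one has |N₁(B) − 2·∑_{(a,b) ∈ A₁} M_{a,b}(B)| ≤ C·B·(log B)⁴/log log B, where A₁ is the set of ordered pairs (a,b) of positive integers with gcd(a,b) = 1, ab ≠ 1, max{a,b} < √B / Z₁^c, max{a,b} ≤ Z₂²·min{a, b, |a − b|}, and ν₂(a² − b²) ≤ Z₂; here Z₁ = B^{1/ log log B} and Z₂ = log log B. -/
open scoped Classical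

/-- The counting function `N₁(B)`. -/
noncomputable def None (B : ℝ) : ℕ :=
  Set.ncard {x : ℤ × ℤ × ℤ × ℤ × ℤ |
    0 < x.1 ∧ 0 < x.2.1 ∧ 0 < x.2.2.1 ∧ 0 < x.2.2.2.1 ∧ 0 < x.2.2.2.2 ∧
    Int.gcd x.1 (Int.gcd x.2.1 (Int.gcd x.2.2.1 x.2.2.2.1)) = 1 ∧
    (x.1 : ℝ) ≤ B ∧ (x.2.1 : ℝ) ≤ B ∧ (x.2.2.1 : ℝ) ≤ B ∧ (x.2.2.2.1 : ℝ) ≤ B ∧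
    x.1 * x.2.1 = x.2.2.1 * x.2.2.2.1 ∧
    x.1 ^ 2 + x.2.1 ^ 2 + x.2.2.1 ^ 2 - x.2.2.2.1 ^ 2 - 2 * x.2.2.2.2 ^ 2 = 0 ∧
    ({x.1, x.2.1} : Set ℤ) ≠ ({x.2.2.1, x.2.2.2.1} : Set ℤ)}

/-- `M_{a,b}(B)`: the number of positive integer triples `(x,y,z)` with
`(a²−b²)x² + (a²+b²)y² = 2z²`, `gcd(x,y) = 1` and `max{a,b}·max{x,y} ≤ B`. -/
noncomputable def Mcount (a b : ℤ) (B : ℝ) : ℕ :=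
  Set.ncard {p : ℤ × ℤ × ℤ |
    0 < p.1 ∧ 0 < p.2.1 ∧ 0 < p.2.2 ∧
    (a ^ 2 - b ^ 2) * p.1 ^ 2 + (a ^ 2 + b ^ 2) * p.2.1 ^ 2 = 2 * p.2.2 ^ 2 ∧
    Int.gcd p.1 p.2.1 = 1 ∧
    ((max a b : ℤ) : ℝ) * ((max p.1 p.2.1 : ℤ) : ℝ) ≤ B}

theorem mul_dvd_mul_of_gcd_dvd {x y n g : ℤ} (hx : x ∣ n) (hy : y ∣ n)
    (hg : (Int.gcd x y : ℤ) ∣ g) : x * y ∣ g * n := by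
  have h : x * y ∣ (Int.gcd x y : ℤ) * n := by
    rw [Int.gcd_eq_gcd_ab, add_mul]
    refine dvd_add ?_ ?_
    · rw [mul_assoc]
      exact mul_dvd_mul_left x (hy.mul_left _)
    · rw [mul_assoc, mul_comm x y]
      exact mul_dvd_mul_left y (hx.mul_left _)
  exact h.trans (mul_dvd_mul_right hg n)

/-- Two solutions of `n ∣ 2 (z² - a² y²)` with the same value of `gcd (n, 2 (z - a y))` lie in a
common lattice of index comparable with `n`. -/
theorem dvd_four_mul_minor {n a y₁ z₁ y₂ z₂ : ℤ} (ha : IsCoprime a n)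
    (h₁ : n ∣ 2 * (z₁ ^ 2 - a ^ 2 * y₁ ^ 2)) (h₂ : n ∣ 2 * (z₂ ^ 2 - a ^ 2 * y₂ ^ 2))
    (h : Int.gcd n (2 * (z₁ - a * y₁)) = Int.gcd n (2 * (z₂ - a * y₂))) :
    n ∣ 4 * (y₁ * z₂ - y₂ * z₁) := by
  have key : ∀ y z : ℤ, n ∣ 2 * (z ^ 2 - a ^ 2 * y ^ 2) →
      n ∣ (Int.gcd n (2 * (z - a * y)) : ℤ) * (z + a * y) := by
    intro y z hyz
    rw [Int.gcd_eq_gcd_ab, add_mul]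
    refine dvd_add (Dvd.intro _ (mul_assoc _ _ _).symm) ?_
    have : 2 * (z - a * y) * Int.gcdB n (2 * (z - a * y)) * (z + a * y) =
        2 * (z ^ 2 - a ^ 2 * y ^ 2) * Int.gcdB n (2 * (z - a * y)) := by ring
    rw [this]
    exact dvd_mul_of_dvd_left hyz _
  have k₁ : n ∣ (z₁ + a * y₁) * (2 * (z₂ - a * y₂)) := by
    refine (key y₁ z₁ h₁).trans ?_
    rw [h, mul_comm]
    exact mul_dvd_mul_left _ (Int.gcd_dvd_right _ _)
  have k₂ : n ∣ (z₂ + a * y₂) * (2 * (z₁ - a * y₁)) := by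
    refine (key y₂ z₂ h₂).trans ?_
    rw [← h, mul_comm]
    exact mul_dvd_mul_left _ (Int.gcd_dvd_right _ _)
  refine ha.symm.dvd_of_dvd_mul_left ?_
  have := dvd_sub k₁ k₂
  convert this using 1
  ring

theorem exists_sq_add_sq_eq_of_dvd {a b : ℤ} (hab : IsCoprime a b) {d : ℕ}
    (hd : (d : ℤ) ∣ a ^ 2 + b ^ 2) :
    ∃ r s : ℤ, r ^ 2 + s ^ 2 = d ∧ (d : ℤ) ∣ r * a + s * b ∧ (d : ℤ) ∣ r * b - s * a := by
  set z : GaussianInt := ⟨a, b⟩ with hz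
  set g : GaussianInt := EuclideanDomain.gcd (d : GaussianInt) z with hg
  obtain ⟨h, hh⟩ := EuclideanDomain.gcd_dvd_left (d : GaussianInt) z
  obtain ⟨k, hk⟩ := EuclideanDomain.gcd_dvd_right (d : GaussianInt) z
  rw [← hg] at hh hk
  have hzz : z * star z = ((a ^ 2 + b ^ 2 : ℤ) : GaussianInt) := by
    ext
    · simp only [hz, Zsqrtd.re_mul, Zsqrtd.re_star, Zsqrtd.im_star, Zsqrtd.re_intCast]; ring
    · simp only [hz, Zsqrtd.im_mul, Zsqrtd.re_star, Zsqrtd.im_star, Zsqrtd.im_intCast]; ring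
  have hgg : g * star g = ((g.re ^ 2 + g.im ^ 2 : ℤ) : GaussianInt) := by
    ext
    · simp only [Zsqrtd.re_mul, Zsqrtd.re_star, Zsqrtd.im_star, Zsqrtd.re_intCast]; ring
    · simp only [Zsqrtd.im_mul, Zsqrtd.re_star, Zsqrtd.im_star, Zsqrtd.im_intCast]; ring
  have hdg : (d : ℤ) ∣ g.re ^ 2 + g.im ^ 2 := by
    rw [← Zsqrtd.intCast_dvd_intCast (d := -1), ← hgg]
    have hb := EuclideanDomain.gcd_eq_gcd_ab (d : GaussianInt) z
    rw [← hg] at hb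
    obtain ⟨e, he⟩ := hd
    have hsd : star (d : GaussianInt) = d := by simp
    set x := EuclideanDomain.gcdA (d : GaussianInt) z
    set y := EuclideanDomain.gcdB (d : GaussianInt) z
    have : g * star g = (d : GaussianInt) * (x * star (d * x + z * y) + z * y * star x)
        + (z * star z) * (y * star y) := by
      rw [hb]
      simp only [star_add, star_mul, hsd]
      ring
    rw [this, hzz, he]
    push_cast
    refine dvd_add (dvd_mul_right _ _) ?_
    rw [mul_assoc]
    exact dvd_mul_right _ _
  have hgd : g.re ^ 2 + g.im ^ 2 ∣ (d : ℤ) := by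
    have h1 : ((g.re ^ 2 + g.im ^ 2 : ℤ) : GaussianInt) ∣ (d : ℤ) * z := by
      rw [← hgg]
      have hsd : star (d : GaussianInt) = d := by simp
      have : ((d : ℤ) : GaussianInt) = star g * star h := by
        rw [Int.cast_natCast, ← hsd, hh, star_mul, mul_comm]
      rw [this, hk]
      exact ⟨star h * k, by ring⟩
    obtain ⟨ha, hb⟩ := (Zsqrtd.intCast_dvd _ _).1 h1
    have ha' : g.re ^ 2 + g.im ^ 2 ∣ (d : ℤ) * a := by simpa [hz] using ha
    have hb' : g.re ^ 2 + g.im ^ 2 ∣ (d : ℤ) * b := by simpa [hz] using hb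
    obtain ⟨u, v, huv⟩ := hab
    have : (d : ℤ) = u * (d * a) + v * (d * b) := by linear_combination -(d : ℤ) * huv
    rw [this]
    exact dvd_add (dvd_mul_of_dvd_right ha' _) (dvd_mul_of_dvd_right hb' _)
  have heq : g.re ^ 2 + g.im ^ 2 = d :=
    Int.dvd_antisymm (by positivity) (by positivity) hgd hdg
  refine ⟨g.re, g.im, heq, ?_, ?_⟩
  · have h1 : a = g.re * k.re - g.im * k.im := by
      have := congrArg Zsqrtd.re hk
      simp [hz] at this
      linarith
    have h2 : b = g.re * k.im + g.im * k.re := by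
      have := congrArg Zsqrtd.im hk
      simp [hz] at this
      linarith
    rw [h1, h2, ← heq]
    exact ⟨k.re, by ring⟩
  · have h1 : a = g.re * k.re - g.im * k.im := by
      have := congrArg Zsqrtd.re hk
      simp [hz] at this
      linarith
    have h2 : b = g.re * k.im + g.im * k.re := by
      have := congrArg Zsqrtd.im hk
      simp [hz] at this
      linarith
    rw [h1, h2, ← heq]
    exact ⟨k.im, by ring⟩

/-- A divisor of a primitive sum of two squares is the norm of a Gaussian divisor in the first
quadrant. -/
theorem exists_quadrant_of_dvd {a b : ℤ} (hab : IsCoprime a b) {d : ℕ} (hd0 : 0 < d)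
    (hd : (d : ℤ) ∣ a ^ 2 + b ^ 2) :
    ∃ r s : ℕ, 0 < r ∧ r ^ 2 + s ^ 2 = d ∧
      ((r ^ 2 + s ^ 2 : ℕ) : ℤ) ∣ r * a + s * b ∧ ((r ^ 2 + s ^ 2 : ℕ) : ℤ) ∣ r * b - s * a := by
  obtain ⟨r, s, h, h1, h2⟩ := exists_sq_add_sq_eq_of_dvd hab hd
  have main : ∀ r s : ℤ, 0 < r → 0 ≤ s → r ^ 2 + s ^ 2 = d → (d : ℤ) ∣ r * a + s * b →
      (d : ℤ) ∣ r * b - s * a → ∃ r s : ℕ, 0 < r ∧ r ^ 2 + s ^ 2 = d ∧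
      ((r ^ 2 + s ^ 2 : ℕ) : ℤ) ∣ r * a + s * b ∧
      ((r ^ 2 + s ^ 2 : ℕ) : ℤ) ∣ r * b - s * a := by
    intro r s hr hs h h1 h2
    lift r to ℕ using hr.le
    lift s to ℕ using hs
    have h' : r ^ 2 + s ^ 2 = d := by exact_mod_cast h
    exact ⟨r, s, by exact_mod_cast hr, h', h' ▸ h1, h' ▸ h2⟩
  have hne : ¬ (r = 0 ∧ s = 0) := by
    rintro ⟨rfl, rfl⟩
    simp at h
    omega
  rcases lt_trichotomy r 0 with hr | hr | hr
  · rcases le_or_gt s 0 with hs | hs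
    · refine main (-r) (-s) (by omega) (by omega) (by rw [← h]; ring) ?_ ?_
      · exact h1.trans ⟨-1, by ring⟩
      · exact h2.trans ⟨-1, by ring⟩
    · refine main s (-r) hs (by omega) (by rw [← h]; ring) ?_ ?_
      · exact h2.trans ⟨-1, by ring⟩
      · exact h1.trans ⟨1, by ring⟩
  · rcases lt_or_gt_of_ne (show s ≠ 0 from fun hs => hne ⟨hr, hs⟩) with hs | hs
    · refine main (-s) r (by omega) (by omega) (by rw [← h]; ring) ?_ ?_
      · exact h2.trans ⟨1, by ring⟩
      · exact h1.trans ⟨-1, by ring⟩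
    · refine main s (-r) hs (by omega) (by rw [← h]; ring) ?_ ?_
      · exact h2.trans ⟨-1, by ring⟩
      · exact h1.trans ⟨1, by ring⟩
  · rcases le_or_gt 0 s with hs | hs
    · exact main r s hr hs h h1 h2
    · refine main (-s) r (by omega) hr.le (by rw [← h]; ring) ?_ ?_
      · exact h2.trans ⟨1, by ring⟩
      · exact h1.trans ⟨-1, by ring⟩

theorem Nat.card_divisors_le_two_mul (n : ℕ) :
    n.divisors.card ≤ 2 * (n.divisors.filter (fun d => d ^ 2 ≤ n)).card := by
  have h := Finset.card_filter_add_card_filter_not (s := n.divisors) (fun d => d ^ 2 ≤ n)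
  have h2 : (n.divisors.filter (fun d => ¬ d ^ 2 ≤ n)).card ≤
      (n.divisors.filter (fun d => d ^ 2 ≤ n)).card := by
    refine Finset.card_le_card_of_injOn (fun d => n / d) ?_ ?_
    · intro d hd
      simp only [Finset.coe_filter, Set.mem_ofPred_eq, Nat.mem_divisors] at hd ⊢
      obtain ⟨⟨⟨e, he⟩, hn⟩, hlt⟩ := hd
      have hd0 : 0 < d := by
        rcases Nat.eq_zero_or_pos d with h0 | h0
        · simp [h0] at he; omega
        · exact h0
      have : n / d = e := by rw [he]; exact Nat.mul_div_cancel_left e hd0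
      rw [this]
      refine ⟨⟨⟨d, by rw [he, mul_comm]⟩, hn⟩, ?_⟩
      nlinarith
    · intro d hd d' hd' hdd
      simp only [Finset.coe_filter, Set.mem_ofPred_eq, Nat.mem_divisors] at hd hd'
      exact Nat.eq_of_mul_eq_mul_right (Nat.div_pos (Nat.le_of_dvd (by omega) hd.1.1)
        (Nat.pos_of_dvd_of_pos hd.1.1 (by omega))) (by
          rw [Nat.mul_div_cancel' hd.1.1]
          simp only at hdd
          rw [hdd, Nat.mul_div_cancel' hd'.1.1])
  omega

theorem Nat.card_divisors_mul_le (m n : ℕ) :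
    (m * n).divisors.card ≤ m.divisors.card * n.divisors.card := by
  rw [Nat.divisors_mul]
  exact Finset.card_mul_le

theorem eq_of_mul_eq_mul_of_isCoprime {x y x' y' : ℤ} (hx : 0 < x) (hx' : 0 < x')
    (h : IsCoprime x y) (h' : IsCoprime x' y') (e : x * y' = x' * y) : x = x' ∧ y = y' := by
  have hxx : x = x' := by
    refine Int.dvd_antisymm hx.le hx'.le ?_ ?_
    · exact h.dvd_of_dvd_mul_right (Dvd.intro _ e)
    · exact h'.dvd_of_dvd_mul_right (Dvd.intro _ e.symm)
  subst hxx
  exact ⟨rfl, (mul_left_cancel₀ hx.ne' e).symm⟩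

theorem mul_dvd_eight_mul_det {a b x₁ y₁ z₁ x₂ y₂ z₂ x₃ y₃ z₃ : ℤ} (hab : IsCoprime a b)
    (e₁ : (a ^ 2 - b ^ 2) * x₁ ^ 2 + (a ^ 2 + b ^ 2) * y₁ ^ 2 = 2 * z₁ ^ 2)
    (e₂ : (a ^ 2 - b ^ 2) * x₂ ^ 2 + (a ^ 2 + b ^ 2) * y₂ ^ 2 = 2 * z₂ ^ 2)
    (e₃ : (a ^ 2 - b ^ 2) * x₃ ^ 2 + (a ^ 2 + b ^ 2) * y₃ ^ 2 = 2 * z₃ ^ 2)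
    (h₂ : Int.gcd (a ^ 2 - b ^ 2) (2 * (z₁ - a * y₁)) = Int.gcd (a ^ 2 - b ^ 2) (2 * (z₂ - a * y₂)))
    (h₃ : Int.gcd (a ^ 2 - b ^ 2) (2 * (z₁ - a * y₁)) = Int.gcd (a ^ 2 - b ^ 2) (2 * (z₃ - a * y₃)))
    (k₂ : Int.gcd (a ^ 2 + b ^ 2) (2 * (z₁ - a * x₁)) = Int.gcd (a ^ 2 + b ^ 2) (2 * (z₂ - a * x₂)))
    (k₃ : Int.gcd (a ^ 2 + b ^ 2) (2 * (z₁ - a * x₁)) =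
      Int.gcd (a ^ 2 + b ^ 2) (2 * (z₃ - a * x₃))) :
    (a ^ 2 - b ^ 2) * (a ^ 2 + b ^ 2) ∣ 2 * (4 * (x₁ * (y₂ * z₃ - y₃ * z₂) -
      x₂ * (y₁ * z₃ - y₃ * z₁) + x₃ * (y₁ * z₂ - y₂ * z₁))) := by
  have hα : IsCoprime a (a ^ 2 - b ^ 2) := by
    have : a ^ 2 - b ^ 2 = -b ^ 2 + a * a := by ring
    rw [this]
    exact IsCoprime.add_mul_left_right (hab.pow_right.neg_right) a
  have hβ : IsCoprime a (a ^ 2 + b ^ 2) := by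
    have : a ^ 2 + b ^ 2 = b ^ 2 + a * a := by ring
    rw [this]
    exact IsCoprime.add_mul_left_right (hab.pow_right) a
  have dα : ∀ x y z : ℤ, (a ^ 2 - b ^ 2) * x ^ 2 + (a ^ 2 + b ^ 2) * y ^ 2 = 2 * z ^ 2 →
      a ^ 2 - b ^ 2 ∣ 2 * (z ^ 2 - a ^ 2 * y ^ 2) := fun x y z e =>
    ⟨x ^ 2 - y ^ 2, by linear_combination -e⟩
  have dβ : ∀ x y z : ℤ, (a ^ 2 - b ^ 2) * x ^ 2 + (a ^ 2 + b ^ 2) * y ^ 2 = 2 * z ^ 2 →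
      a ^ 2 + b ^ 2 ∣ 2 * (z ^ 2 - a ^ 2 * x ^ 2) := fun x y z e =>
    ⟨y ^ 2 - x ^ 2, by linear_combination -e⟩
  refine mul_dvd_mul_of_gcd_dvd ?_ ?_ ?_
  · have m₁ := dvd_four_mul_minor hα (dα _ _ _ e₂) (dα _ _ _ e₃) (h₂.symm.trans h₃)
    have m₂ := dvd_four_mul_minor hα (dα _ _ _ e₁) (dα _ _ _ e₃) h₃
    have m₃ := dvd_four_mul_minor hα (dα _ _ _ e₁) (dα _ _ _ e₂) h₂
    have := dvd_add (dvd_sub (m₁.mul_left x₁) (m₂.mul_left x₂)) (m₃.mul_left x₃)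
    exact this.trans ⟨1, by ring⟩
  · have m₁ := dvd_four_mul_minor hβ (dβ _ _ _ e₂) (dβ _ _ _ e₃) (k₂.symm.trans k₃)
    have m₂ := dvd_four_mul_minor hβ (dβ _ _ _ e₁) (dβ _ _ _ e₃) k₃
    have m₃ := dvd_four_mul_minor hβ (dβ _ _ _ e₁) (dβ _ _ _ e₂) k₂
    have := dvd_add (dvd_sub (m₁.mul_left y₁) (m₂.mul_left y₂)) (m₃.mul_left y₃)
    exact this.trans ⟨-1, by ring⟩
  · have g₁ := Int.gcd_dvd_left (a ^ 2 - b ^ 2) (a ^ 2 + b ^ 2)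
    have g₂ := Int.gcd_dvd_right (a ^ 2 - b ^ 2) (a ^ 2 + b ^ 2)
    have i₁ := (dvd_add g₁ g₂).trans (⟨1, by ring⟩ : _ ∣ 2 * a ^ 2)
    have i₂ := (dvd_sub g₂ g₁).trans (⟨1, by ring⟩ : _ ∣ 2 * b ^ 2)
    obtain ⟨u, v, huv⟩ := (hab.pow : IsCoprime (a ^ 2) (b ^ 2))
    have := dvd_add (i₁.mul_left u) (i₂.mul_left v)
    exact this.trans ⟨1, by linear_combination (-2 : ℤ) * huv⟩

/-- The conic `X² = ε (Z² - Y²)` is parametrised by `w = X / (Z + Y)`, so that determinants of its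
points become Vandermonde determinants. -/
theorem conic_det_eq {ε X₁ Y₁ Z₁ X₂ Y₂ Z₂ X₃ Y₃ Z₃ s₁ s₂ s₃ w₁ w₂ w₃ : ℝ}
    (hX₁ : X₁ = s₁ * w₁) (hY₁ : Y₁ = s₁ * (1 - ε * w₁ ^ 2) / 2)
    (hZ₁ : Z₁ = s₁ * (1 + ε * w₁ ^ 2) / 2)
    (hX₂ : X₂ = s₂ * w₂) (hY₂ : Y₂ = s₂ * (1 - ε * w₂ ^ 2) / 2)
    (hZ₂ : Z₂ = s₂ * (1 + ε * w₂ ^ 2) / 2)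
    (hX₃ : X₃ = s₃ * w₃) (hY₃ : Y₃ = s₃ * (1 - ε * w₃ ^ 2) / 2)
    (hZ₃ : Z₃ = s₃ * (1 + ε * w₃ ^ 2) / 2) :
    2 * (X₁ * (Y₂ * Z₃ - Y₃ * Z₂) - X₂ * (Y₁ * Z₃ - Y₃ * Z₁) + X₃ * (Y₁ * Z₂ - Y₂ * Z₁)) =
      ε * (s₁ * s₂ * s₃) * ((w₁ - w₂) * (w₁ - w₃) * (w₂ - w₃)) := by
  subst hX₁ hY₁ hZ₁ hX₂ hY₂ hZ₂ hX₃ hY₃ hZ₃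
  ring

/-- The coordinates of a point of the conic in the rational parametrisation. -/
theorem conic_param {ε X Y Z : ℝ} (hε : ε ^ 2 = 1) (hs : 0 < Z + Y)
    (h : X ^ 2 = ε * (Z ^ 2 - Y ^ 2)) :
    X = (Z + Y) * (X / (Z + Y)) ∧ Y = (Z + Y) * (1 - ε * (X / (Z + Y)) ^ 2) / 2 ∧
      Z = (Z + Y) * (1 + ε * (X / (Z + Y)) ^ 2) / 2 := by
  have hne := hs.ne'
  have key : (Z + Y) * (ε * (X / (Z + Y)) ^ 2) = Z - Y := by
    rw [div_pow, h]
    field_simp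
    linear_combination (Z ^ 2 - Y ^ 2) * hε
  refine ⟨by field_simp, ?_, ?_⟩ <;> linarith

set_option maxHeartbeats 1600000 in
theorem card_conic_le {a b : ℤ} (ha : 0 < a) (hb : 0 < b) (hab : IsCoprime a b) (hne : a ≠ b)
    {X : ℝ} (hX : 0 < X) (S : Finset (ℤ × ℤ × ℤ))
    (hS : ∀ p ∈ S, 0 < p.1 ∧ 0 < p.2.1 ∧ 0 < p.2.2 ∧
      (a ^ 2 - b ^ 2) * p.1 ^ 2 + (a ^ 2 + b ^ 2) * p.2.1 ^ 2 = 2 * p.2.2 ^ 2 ∧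
      Int.gcd p.1 p.2.1 = 1 ∧ (p.1 : ℝ) ≤ X ∧ (p.2.1 : ℝ) ≤ X) :
    (S.card : ℝ) ≤ (a ^ 2 - b ^ 2).natAbs.divisors.card * (a ^ 2 + b ^ 2).natAbs.divisors.card *
      (4 + 12 * (X / √((|a - b| * (a + b) : ℤ) : ℝ))) := by
  set α : ℤ := a ^ 2 - b ^ 2 with hα
  set β : ℤ := a ^ 2 + b ^ 2 with hβ
  have hα0 : α ≠ 0 := by
    intro h
    have : (a - b) * (a + b) = 0 := by rw [← h, hα]; ring
    rcases mul_eq_zero.1 this with h | h <;> omega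
  have hβ0 : 0 < β := by positivity
  set A : ℝ := |(α : ℝ)| with hA
  have hA0 : 0 < A := abs_pos.2 (by exact_mod_cast hα0)
  obtain ⟨ε, hε', hαε⟩ : ∃ ε : ℝ, (ε = 1 ∨ ε = -1) ∧ (α : ℝ) = ε * A := by
    rcases le_total 0 (α : ℝ) with h | h
    · exact ⟨1, Or.inl rfl, by rw [hA, abs_of_nonneg h, one_mul]⟩
    · exact ⟨-1, Or.inr rfl, by rw [hA, abs_of_nonpos h]; ring⟩
  have hε : ε ^ 2 = 1 := by rcases hε' with h | h <;> rw [h] <;> norm_num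
  have hβR : (0 : ℝ) < β := by exact_mod_cast hβ0
  set v : ℝ := (a : ℝ) + b with hv
  have haR : (0 : ℝ) < a := by exact_mod_cast ha
  have hbR : (0 : ℝ) < b := by exact_mod_cast hb
  have hv0 : 0 < v := by positivity
  set D : ℝ := ((|a - b| * (a + b) : ℤ) : ℝ) with hD
  have hAD : A = D := by
    have e : (α : ℝ) = ((a : ℝ) - b) * (a + b) := by rw [hα]; push_cast; ring
    rw [hA, hD, e, abs_mul, abs_of_pos hv0]
    push_cast
    ring
  set N : ℕ := ⌊6 * (X / √D)⌋₊ + 1 with hN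
  have hN0 : (0 : ℝ) < N := by positivity
  have hNgt : 6 * (X / √D) < N := by
    rw [hN]; push_cast; exact Nat.lt_floor_add_one _
  have hNle : (N : ℝ) ≤ 6 * (X / √D) + 1 := by
    rw [hN]; push_cast
    gcongr
    exact Nat.floor_le (by positivity)
  set s : ℤ × ℤ × ℤ → ℝ := fun p => √2 * p.2.2 + √(β : ℝ) * p.2.1 with hs
  set w : ℤ × ℤ × ℤ → ℝ := fun p => √A * p.1 / s p with hw
  have h2 : (√2 : ℝ) ^ 2 = 2 := Real.sq_sqrt (by norm_num)
  have hsA : √A ^ 2 = A := Real.sq_sqrt hA0.le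
  have hsβ : √(β : ℝ) ^ 2 = β := Real.sq_sqrt hβR.le
  have h20 : 0 < √(2 : ℝ) := by positivity
  have hsA0 : 0 < √A := Real.sqrt_pos.2 hA0
  have hsβ0 : 0 < √(β : ℝ) := Real.sqrt_pos.2 hβR
  have hs0 : ∀ p ∈ S, 0 < s p := by
    intro p hp
    obtain ⟨h1, h2', h3, -⟩ := hS p hp
    have : (0 : ℝ) < p.2.1 := by exact_mod_cast h2'
    have : (0 : ℝ) < p.2.2 := by exact_mod_cast h3
    positivity
  have heq : ∀ p ∈ S, (√A * p.1) ^ 2 = ε * ((√2 * p.2.2) ^ 2 - (√(β : ℝ) * p.2.1) ^ 2) := by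
    intro p hp
    obtain ⟨-, -, -, e, -⟩ := hS p hp
    have e' : (α : ℝ) * p.1 ^ 2 + β * p.2.1 ^ 2 = 2 * p.2.2 ^ 2 := by exact_mod_cast e
    rw [hαε] at e'
    simp only [mul_pow, hsA, hsβ, h2]
    linear_combination ε * e' - A * (p.1 : ℝ) ^ 2 * hε
  have hpar : ∀ p ∈ S, √A * p.1 = s p * w p ∧ √(β : ℝ) * p.2.1 = s p * (1 - ε * w p ^ 2) / 2 ∧
      √2 * p.2.2 = s p * (1 + ε * w p ^ 2) / 2 := by
    intro p hp
    exact conic_param hε (hs0 p hp) (heq p hp)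
  have hsT : ∀ p ∈ S, s p ≤ 2 * √2 * (v * X) := by
    intro p hp
    obtain ⟨h1, h2', h3, e, -, hx, hy⟩ := hS p hp
    have h1' : (0 : ℝ) < p.1 := by exact_mod_cast h1
    have h2'' : (0 : ℝ) < p.2.1 := by exact_mod_cast h2'
    have h3' : (0 : ℝ) < p.2.2 := by exact_mod_cast h3
    have e' : ((a : ℝ) ^ 2 - b ^ 2) * p.1 ^ 2 + (a ^ 2 + b ^ 2) * p.2.1 ^ 2 = 2 * p.2.2 ^ 2 := by
      exact_mod_cast e
    have hxx : (p.1 : ℝ) ^ 2 ≤ X ^ 2 := by gcongr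
    have hyy : (p.2.1 : ℝ) ^ 2 ≤ X ^ 2 := by gcongr
    have b1 : √(β : ℝ) * p.2.1 ≤ √2 * (v * X) := by
      refine abs_le_of_sq_le_sq' ?_ (by positivity) |>.2
      simp only [mul_pow, hsβ, h2]
      have : (β : ℝ) ≤ v ^ 2 := by rw [hβ, hv]; push_cast; nlinarith only [haR, hbR, mul_pos haR hbR]
      have : (β : ℝ) * p.2.1 ^ 2 ≤ v ^ 2 * X ^ 2 := by gcongr
      nlinarith only [this, sq_nonneg (v * X)]
    have b2 : √2 * p.2.2 ≤ √2 * (v * X) := by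
      refine abs_le_of_sq_le_sq' ?_ (by positivity) |>.2
      simp only [mul_pow, h2]
      rw [← e']
      have i1 : (a : ℝ) ^ 2 * p.1 ^ 2 ≤ a ^ 2 * X ^ 2 := by gcongr
      have i2 : (a : ℝ) ^ 2 * p.2.1 ^ 2 ≤ a ^ 2 * X ^ 2 := by gcongr
      have i3 : (b : ℝ) ^ 2 * p.2.1 ^ 2 ≤ b ^ 2 * X ^ 2 := by gcongr
      have i4 : 0 ≤ (b : ℝ) ^ 2 * p.1 ^ 2 := by positivity
      have i5 : 0 ≤ a * b * X ^ 2 := by positivity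
      have i6 : 0 ≤ (b : ℝ) ^ 2 * X ^ 2 := by positivity
      rw [hv]
      nlinarith only [i1, i2, i3, i4, i5, i6]
    simp only [hs]
    linarith
  have hw0 : ∀ p ∈ S, 0 ≤ w p := by
    intro p hp
    obtain ⟨h1, -⟩ := hS p hp
    have h1' : (0 : ℝ) < p.1 := by exact_mod_cast h1
    exact div_nonneg (by positivity) (hs0 p hp).le
  have hw1 : ∀ p ∈ S, w p ≤ 1 := by
    intro p hp
    obtain ⟨h1, h2', h3, -⟩ := hS p hp
    have h1' : (0 : ℝ) < p.1 := by exact_mod_cast h1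
    have h2'' : (0 : ℝ) < p.2.1 := by exact_mod_cast h2'
    have h3' : (0 : ℝ) < p.2.2 := by exact_mod_cast h3
    rw [hw, div_le_one (hs0 p hp)]
    refine abs_le_of_sq_le_sq' ?_ (hs0 p hp).le |>.2
    rw [heq p hp]
    have hP : 0 < √(β : ℝ) * p.2.1 := by positivity
    have hQ : 0 < √2 * (p.2.2 : ℝ) := by positivity
    simp only [hs]
    generalize √(β : ℝ) * p.2.1 = P at hP ⊢
    generalize √2 * (p.2.2 : ℝ) = Q at hQ ⊢
    have hPQ := mul_pos hP hQ
    rcases hε' with h | h <;> rw [h] <;> nlinarith only [hPQ, sq_nonneg P, sq_nonneg Q]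
  have hwinj : ∀ p ∈ S, ∀ p' ∈ S, w p = w p' → p = p' := by
    intro p hp p' hp' hww
    obtain ⟨a1, a2, a3⟩ := hpar p hp
    obtain ⟨b1, b2, b3⟩ := hpar p' hp'
    obtain ⟨h1, h2', h3, e, hg, -⟩ := hS p hp
    obtain ⟨h1', h2'', h3', e', hg', -⟩ := hS p' hp'
    have hmul : (√A * √(β : ℝ)) * (p.1 * p'.2.1) = (√A * √(β : ℝ)) * (p'.1 * p.2.1) := by
      have : (√A * p.1) * (√(β : ℝ) * p'.2.1) = (√A * p'.1) * (√(β : ℝ) * p.2.1) := by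
        rw [a1, a2, b1, b2, hww]; ring
      linarith
    have hR := mul_left_cancel₀ (by positivity) hmul
    have hZ : p.1 * p'.2.1 = p'.1 * p.2.1 := by exact_mod_cast hR
    obtain ⟨q1, q2⟩ := eq_of_mul_eq_mul_of_isCoprime h1 h1' (Int.isCoprime_iff_gcd_eq_one.2 hg)
      (Int.isCoprime_iff_gcd_eq_one.2 hg') hZ
    have q3 : p.2.2 = p'.2.2 := by
      rw [q1, q2, e'] at e
      have : p.2.2 ^ 2 = p'.2.2 ^ 2 := by linarith
      exact (pow_left_inj₀ h3.le h3'.le (by norm_num)).1 this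
    exact Prod.ext q1 (Prod.ext q2 q3)
  set f : ℤ × ℤ × ℤ → ℕ × ℕ × ℤ := fun p =>
    (Int.gcd α (2 * (p.2.2 - a * p.2.1)), Int.gcd β (2 * (p.2.2 - a * p.1)), ⌊w p * N⌋) with hf
  set T : Finset (ℕ × ℕ × ℤ) := α.natAbs.divisors ×ˢ β.natAbs.divisors ×ˢ Finset.Icc 0 (N : ℤ)
    with hT
  have hmaps : ∀ p ∈ S, f p ∈ T := by
    intro p hp
    simp only [hf, hT, Finset.mem_product, Nat.mem_divisors, Finset.mem_Icc]
    refine ⟨⟨Int.natCast_dvd.1 (Int.gcd_dvd_left _ _), Int.natAbs_ne_zero.2 hα0⟩,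
      ⟨Int.natCast_dvd.1 (Int.gcd_dvd_left _ _), Int.natAbs_ne_zero.2 hβ0.ne'⟩,
      Int.floor_nonneg.2 (mul_nonneg (hw0 p hp) hN0.le), ?_⟩
    have : w p * N ≤ (N : ℤ) := by
      push_cast
      nlinarith only [hw1 p hp, hN0]
    exact_mod_cast (Int.floor_le _).trans this
  have hfib : ∀ t ∈ T, (S.filter (fun p => f p = t)).card ≤ 2 := by
    intro t _
    by_contra hcon
    obtain ⟨p₁, hp₁, p₂, hp₂, p₃, hp₃, h12, h13, h23⟩ := Finset.two_lt_card.1 (not_le.1 hcon)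
    rw [Finset.mem_filter] at hp₁ hp₂ hp₃
    obtain ⟨hp₁, ht₁⟩ := hp₁
    obtain ⟨hp₂, ht₂⟩ := hp₂
    obtain ⟨hp₃, ht₃⟩ := hp₃
    have f12 : f p₁ = f p₂ := ht₁.trans ht₂.symm
    have f13 : f p₁ = f p₃ := ht₁.trans ht₃.symm
    simp only [hf, Prod.mk.injEq] at f12 f13
    obtain ⟨c12, d12, g12⟩ := f12
    obtain ⟨c13, d13, g13⟩ := f13
    obtain ⟨-, -, -, e₁, -⟩ := hS p₁ hp₁
    obtain ⟨-, -, -, e₂, -⟩ := hS p₂ hp₂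
    obtain ⟨-, -, -, e₃, -⟩ := hS p₃ hp₃
    have hdvd := mul_dvd_eight_mul_det hab e₁ e₂ e₃ c12 c13 d12 d13
    set det : ℤ := p₁.1 * (p₂.2.1 * p₃.2.2 - p₃.2.1 * p₂.2.2) -
      p₂.1 * (p₁.2.1 * p₃.2.2 - p₃.2.1 * p₁.2.2) + p₃.1 * (p₁.2.1 * p₂.2.2 - p₂.2.1 * p₁.2.2)
      with hdet
    obtain ⟨a1, a2, a3⟩ := hpar p₁ hp₁
    obtain ⟨b1, b2, b3⟩ := hpar p₂ hp₂
    obtain ⟨c1, c2, c3⟩ := hpar p₃ hp₃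
    have hid := conic_det_eq a1 a2 a3 b1 b2 b3 c1 c2 c3
    have hid' : 2 * (√A * √(β : ℝ) * √2) * (det : ℝ) = ε * (s p₁ * s p₂ * s p₃) *
        ((w p₁ - w p₂) * (w p₁ - w p₃) * (w p₂ - w p₃)) := by
      rw [← hid, hdet]; push_cast; ring
    have hε1 : |ε| = 1 := by
      rcases hε' with h | h <;> simp [h]
    have s1 := hs0 p₁ hp₁
    have s2 := hs0 p₂ hp₂
    have s3 := hs0 p₃ hp₃
    have habs := congrArg abs hid'
    simp only [abs_mul, hε1, one_mul, abs_of_pos s1, abs_of_pos s2, abs_of_pos s3,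
      abs_of_pos hsA0, abs_of_pos hsβ0, abs_of_pos h20, abs_two] at habs
    have dw : ∀ p p', ⌊w p * N⌋ = ⌊w p' * N⌋ → |w p - w p'| * N < 1 := by
      intro p p' h
      have := Int.abs_sub_lt_one_of_floor_eq_floor h
      rwa [← sub_mul, abs_mul, abs_of_pos hN0] at this
    have w12 := dw _ _ g12
    have w13 := dw _ _ g13
    have w23 := dw _ _ (g12.symm.trans g13)
    have n12 : 0 < |w p₁ - w p₂| := abs_pos.2 (sub_ne_zero.2 fun h => h12 (hwinj _ hp₁ _ hp₂ h))
    have n13 : 0 < |w p₁ - w p₃| := abs_pos.2 (sub_ne_zero.2 fun h => h13 (hwinj _ hp₁ _ hp₃ h))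
    have n23 : 0 < |w p₂ - w p₃| := abs_pos.2 (sub_ne_zero.2 fun h => h23 (hwinj _ hp₂ _ hp₃ h))
    have hdet0 : det ≠ 0 := by
      intro h
      rw [h] at habs
      simp only [Int.cast_zero, abs_zero, mul_zero] at habs
      have : 0 < s p₁ * s p₂ * s p₃ * (|w p₁ - w p₂| * |w p₁ - w p₃| * |w p₂ - w p₃|) := by
        positivity
      linarith
    have hlow : A * β ≤ 8 * |(det : ℝ)| := by
      have h1 := Int.le_of_dvd (abs_pos.2 (by simpa using hdet0))
        ((abs_dvd_abs _ _).2 hdvd)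
      have h2 : |(α : ℝ) * β| ≤ |2 * (4 * (det : ℝ))| := by exact_mod_cast h1
      rw [abs_mul, abs_of_pos hβR, abs_mul, abs_mul, abs_of_pos (by norm_num : (0 : ℝ) < 2),
        abs_of_pos (by norm_num : (0 : ℝ) < 4)] at h2
      linarith
    have hV : |w p₁ - w p₂| * |w p₁ - w p₃| * |w p₂ - w p₃| * (N : ℝ) ^ 3 < 1 := by
      have : |w p₁ - w p₂| * |w p₁ - w p₃| * |w p₂ - w p₃| * (N : ℝ) ^ 3 =
          (|w p₁ - w p₂| * N) * (|w p₁ - w p₃| * N) * (|w p₂ - w p₃| * N) := by ring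
      rw [this]
      have k1 : (|w p₁ - w p₂| * N) * (|w p₁ - w p₃| * N) < 1 :=
        mul_lt_one_of_nonneg_of_lt_one_left (by positivity) w12 w13.le
      exact mul_lt_one_of_nonneg_of_lt_one_left (by positivity) k1 w23.le
    have hsss : s p₁ * s p₂ * s p₃ ≤ 16 * √2 * (v * X) ^ 3 := by
      have t1 := hsT p₁ hp₁
      have t2 := hsT p₂ hp₂
      have t3 := hsT p₃ hp₃
      calc s p₁ * s p₂ * s p₃ ≤
            (2 * √2 * (v * X)) * (2 * √2 * (v * X)) * (2 * √2 * (v * X)) := by gcongr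
        _ = 8 * (√2 ^ 2) * √2 * (v * X) ^ 3 := by ring
        _ = 16 * √2 * (v * X) ^ 3 := by rw [h2]; ring
    set R : ℝ := √A * √(β : ℝ) with hR
    have hR0 : 0 < R := by positivity
    have hR2 : R ^ 2 = A * β := by rw [hR, mul_pow, hsA, hsβ]
    have hup : R * |(det : ℝ)| * (N : ℝ) ^ 3 < 8 * (v * X) ^ 3 := by
      have h1 : 2 * (R * √2) * |(det : ℝ)| * (N : ℝ) ^ 3 < 16 * √2 * (v * X) ^ 3 := by
        rw [habs]
        calc s p₁ * s p₂ * s p₃ * (|w p₁ - w p₂| * |w p₁ - w p₃| * |w p₂ - w p₃|) * (N : ℝ) ^ 3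
            = s p₁ * s p₂ * s p₃ *
              (|w p₁ - w p₂| * |w p₁ - w p₃| * |w p₂ - w p₃| * (N : ℝ) ^ 3) := by ring
          _ < s p₁ * s p₂ * s p₃ * 1 := by
              apply mul_lt_mul_of_pos_left hV (by positivity)
          _ ≤ _ := by rw [mul_one]; exact hsss
      have h3 : (2 * √2) * (R * |(det : ℝ)| * (N : ℝ) ^ 3) < (2 * √2) * (8 * (v * X) ^ 3) := by
        linarith
      exact lt_of_mul_lt_mul_left h3 (by positivity)
    have hcube : (R * N) ^ 3 < (4 * (v * X)) ^ 3 := by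
      have : R * (A * β) * (N : ℝ) ^ 3 ≤ R * (8 * |(det : ℝ)|) * (N : ℝ) ^ 3 := by gcongr
      have h5 : (R * N) ^ 3 = R * (A * β) * (N : ℝ) ^ 3 := by rw [← hR2]; ring
      rw [h5]
      have h6 : (4 * (v * X)) ^ 3 = 8 * (8 * (v * X) ^ 3) := by ring
      rw [h6]
      linarith
    have hlt : R * N < 4 * (v * X) := lt_of_pow_lt_pow_left₀ 3 (by positivity) hcube
    have hge : 4 * (v * X) ≤ R * N := by
      have hβv : 2 / 3 * v ≤ √(β : ℝ) := by
        apply Real.le_sqrt_of_sq_le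
        rw [hβ, hv]; push_cast
        nlinarith only [sq_nonneg ((a : ℝ) - b), sq_nonneg (a : ℝ), sq_nonneg (b : ℝ)]
      rw [hR, hAD]
      have hD0 : 0 < √D := by rw [← hAD]; exact hsA0
      calc 4 * (v * X) = √D * (2 / 3 * v) * (6 * (X / √D)) := by field_simp; ring
        _ ≤ √D * √(β : ℝ) * N := by gcongr
    linarith
  have hcard := Finset.card_le_mul_card_image_of_maps_to hmaps 2 hfib
  have hTc : T.card = α.natAbs.divisors.card * (β.natAbs.divisors.card * (N + 1)) := by
    have hN' : (Finset.Icc 0 (N : ℤ)).card = N + 1 := by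
      rw [Int.card_Icc, sub_zero]
      exact Int.toNat_natCast (N + 1)
    rw [hT, Finset.card_product, Finset.card_product, hN']
  rw [hTc] at hcard
  have hcR : (S.card : ℝ) ≤ 2 * (α.natAbs.divisors.card * (β.natAbs.divisors.card * (N + 1))) := by
    exact_mod_cast hcard
  refine hcR.trans ?_
  have : 2 * ((α.natAbs.divisors.card : ℝ) * (β.natAbs.divisors.card * (N + 1))) =
      α.natAbs.divisors.card * β.natAbs.divisors.card * (2 * (N + 1)) := by ring
  rw [this]
  exact mul_le_mul_of_nonneg_left (by linarith) (mul_nonneg (Nat.cast_nonneg _) (Nat.cast_nonneg _))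

theorem card_le_of_spaced {ι : Type*} (S : Finset ι) (t : ι → ℝ) {t₀ l δ : ℝ} (hl : 0 ≤ l)
    (hδ : 0 < δ) (h0 : ∀ x ∈ S, t₀ ≤ t x) (h1 : ∀ x ∈ S, t x ≤ t₀ + l)
    (hsp : ∀ x ∈ S, ∀ y ∈ S, x ≠ y → δ ≤ |t x - t y|) : (S.card : ℝ) ≤ 1 + l / δ := by
  have h : S.card ≤ (Finset.Icc 0 ⌊l / δ⌋₊).card := by
    refine Finset.card_le_card_of_injOn (fun x => ⌊(t x - t₀) / δ⌋₊) ?_ ?_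
    · intro x hx
      simp only [Finset.coe_Icc, Set.mem_Icc, zero_le, true_and]
      apply Nat.floor_le_floor
      gcongr
      linarith [h1 x hx]
    · intro x hx y hy hxy
      by_contra hne
      have hx' : 0 ≤ (t x - t₀) / δ := div_nonneg (by linarith [h0 x hx]) hδ.le
      have hy' : 0 ≤ (t y - t₀) / δ := div_nonneg (by linarith [h0 y hy]) hδ.le
      simp only at hxy
      have e : ⌊(t x - t₀) / δ⌋ = ⌊(t y - t₀) / δ⌋ := by
        rw [← Int.natCast_floor_eq_floor hx', ← Int.natCast_floor_eq_floor hy', hxy]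
      have hlt := Int.abs_sub_lt_one_of_floor_eq_floor e
      rw [← sub_div, sub_sub_sub_cancel_right, abs_div, abs_of_pos hδ, div_lt_one hδ] at hlt
      exact absurd (hsp x hx y hy hne) (not_le.2 hlt)
  have h2 : (S.card : ℝ) ≤ ⌊l / δ⌋₊ + 1 := by
    rw [Nat.card_Icc] at h
    exact_mod_cast h
  linarith [Nat.floor_le (div_nonneg hl hδ.le)]

theorem gcd_dvd_two_of_dvd {a b x y : ℤ} (hab : IsCoprime a b) (h₁ : x ∣ a ^ 2 - b ^ 2)
    (h₂ : y ∣ a ^ 2 + b ^ 2) : (Int.gcd x y : ℤ) ∣ 2 := by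
  have g₁ := (Int.gcd_dvd_left x y).trans h₁
  have g₂ := (Int.gcd_dvd_right x y).trans h₂
  have i₁ := (dvd_add g₁ g₂).trans (⟨1, by ring⟩ : _ ∣ 2 * a ^ 2)
  have i₂ := (dvd_sub g₂ g₁).trans (⟨1, by ring⟩ : _ ∣ 2 * b ^ 2)
  obtain ⟨u, v, huv⟩ := (hab.pow : IsCoprime (a ^ 2) (b ^ 2))
  have := dvd_add (i₁.mul_left u) (i₂.mul_left v)
  exact this.trans ⟨1, by linear_combination (-2 : ℤ) * huv⟩

theorem mul_dvd_sixteen_mul_cross {a₁ b₁ a₂ b₂ x y r s : ℤ} (hr : 0 < r ^ 2 + s ^ 2)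
    (h₁ : IsCoprime a₁ b₁) (x₁ : x ∣ a₁ - b₁) (x₂ : x ∣ a₂ - b₂) (y₁ : y ∣ a₁ + b₁)
    (y₂ : y ∣ a₂ + b₂) (r₁ : r ^ 2 + s ^ 2 ∣ r * a₁ + s * b₁) (s₁ : r ^ 2 + s ^ 2 ∣ r * b₁ - s * a₁)
    (r₂ : r ^ 2 + s ^ 2 ∣ r * a₂ + s * b₂) (s₂ : r ^ 2 + s ^ 2 ∣ r * b₂ - s * a₂) :
    x * y * (r ^ 2 + s ^ 2) ∣ 4 * (4 * (a₁ * b₂ - a₂ * b₁)) := by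
  have hN : r ^ 2 + s ^ 2 ∣ a₁ ^ 2 + b₁ ^ 2 := by
    apply (mul_dvd_mul_iff_left hr.ne').1
    have := dvd_add (mul_dvd_mul r₁ r₁) (mul_dvd_mul s₁ s₁)
    exact this.trans ⟨1, by ring⟩
  have hΔ : r ^ 2 + s ^ 2 ∣ a₁ * b₂ - a₂ * b₁ := by
    apply (mul_dvd_mul_iff_left hr.ne').1
    have := dvd_sub (mul_dvd_mul r₁ s₂) (mul_dvd_mul r₂ s₁)
    exact this.trans ⟨1, by ring⟩
  have hx : x ∣ 2 * (a₁ * b₂ - a₂ * b₁) := by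
    have := dvd_sub (x₁.mul_right (a₂ + b₂)) (x₂.mul_right (a₁ + b₁))
    exact this.trans ⟨1, by ring⟩
  have hy : y ∣ 2 * (a₁ * b₂ - a₂ * b₁) := by
    have := dvd_sub (y₂.mul_right (a₁ - b₁)) (y₁.mul_right (a₂ - b₂))
    exact this.trans ⟨1, by ring⟩
  have hxα : x ∣ a₁ ^ 2 - b₁ ^ 2 := x₁.trans ⟨a₁ + b₁, by ring⟩
  have hyα : y ∣ a₁ ^ 2 - b₁ ^ 2 := y₁.trans ⟨a₁ - b₁, by ring⟩
  have hxy : (Int.gcd x y : ℤ) ∣ 2 := by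
    have g₁ := (Int.gcd_dvd_left x y).trans x₁
    have g₂ := (Int.gcd_dvd_right x y).trans y₁
    have i₁ := (dvd_add g₁ g₂).trans (⟨1, by ring⟩ : _ ∣ 2 * a₁)
    have i₂ := (dvd_sub g₂ g₁).trans (⟨1, by ring⟩ : _ ∣ 2 * b₁)
    obtain ⟨u, v, huv⟩ := h₁
    have := dvd_add (i₁.mul_left u) (i₂.mul_left v)
    exact this.trans ⟨1, by linear_combination (-2 : ℤ) * huv⟩
  have hxy' : x * y ∣ 4 * (a₁ * b₂ - a₂ * b₁) :=
    (mul_dvd_mul_of_gcd_dvd hx hy hxy).trans ⟨1, by ring⟩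
  refine mul_dvd_mul_of_gcd_dvd hxy' (hΔ.mul_left 4) ?_
  have h4 : Int.gcd (x * y) (r ^ 2 + s ^ 2) ∣
      Int.gcd x (r ^ 2 + s ^ 2) * Int.gcd y (r ^ 2 + s ^ 2) := by
    simp only [Int.gcd_def, Int.natAbs_mul]
    rw [Nat.gcd_comm, Nat.gcd_comm x.natAbs, Nat.gcd_comm y.natAbs]
    exact Nat.gcd_mul_right_dvd_mul_gcd _ _ _
  have h5 : ((Int.gcd x (r ^ 2 + s ^ 2) * Int.gcd y (r ^ 2 + s ^ 2) : ℕ) : ℤ) ∣ 4 := by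
    push_cast
    exact (mul_dvd_mul (gcd_dvd_two_of_dvd h₁ hxα hN) (gcd_dvd_two_of_dvd h₁ hyα hN)).trans
      (by norm_num)
  exact (Int.natCast_dvd_natCast.2 h4).trans h5

theorem card_lattice_le {V : ℝ} (hV : 0 < V) {t₀ l : ℝ} (hl : 0 ≤ l) {x y : ℤ} {r s : ℤ}
    (hx : 0 < x) (hy : 0 < y) (hr : 0 < r ^ 2 + s ^ 2) (F : Finset (ℤ × ℤ)) {σ : ℤ}
    (hσ : σ = 1 ∨ σ = -1)
    (hF : ∀ p ∈ F, 0 < p.1 ∧ 0 < p.2 ∧ IsCoprime p.1 p.2 ∧ ((p.1 + p.2 : ℤ) : ℝ) ≤ 2 * V ∧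
      |p.1 - p.2| = σ * (p.1 - p.2) ∧
      t₀ ≤ (|p.1 - p.2| : ℤ) / ((p.1 + p.2 : ℤ) : ℝ) ∧
      (|p.1 - p.2| : ℤ) / ((p.1 + p.2 : ℤ) : ℝ) ≤ t₀ + l ∧
      x ∣ p.1 - p.2 ∧ y ∣ p.1 + p.2 ∧ r ^ 2 + s ^ 2 ∣ r * p.1 + s * p.2 ∧
      r ^ 2 + s ^ 2 ∣ r * p.2 - s * p.1) :
    (F.card : ℝ) ≤ 1 + 32 * l * V ^ 2 / ((x : ℝ) * y * (r ^ 2 + s ^ 2)) := by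
  have hxR : (0 : ℝ) < x := by exact_mod_cast hx
  have hyR : (0 : ℝ) < y := by exact_mod_cast hy
  have hrR : (0 : ℝ) < (r : ℝ) ^ 2 + s ^ 2 := by exact_mod_cast hr
  have key := card_le_of_spaced F (fun p => (|p.1 - p.2| : ℤ) / ((p.1 + p.2 : ℤ) : ℝ))
    (t₀ := t₀) (l := l) (δ := (x : ℝ) * y * (r ^ 2 + s ^ 2) / (32 * V ^ 2)) hl (by positivity)
    (fun p hp => (hF p hp).2.2.2.2.2.1) (fun p hp => (hF p hp).2.2.2.2.2.2.1) ?_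
  · refine key.trans (le_of_eq ?_)
    field_simp
  · intro p hp q hq hpq
    obtain ⟨p1, p2, pc, pV, ps, -, -, px, py, pr, pt⟩ := hF p hp
    obtain ⟨q1, q2, qc, qV, qs, -, -, qx, qy, qr, qt⟩ := hF q hq
    have hd := mul_dvd_sixteen_mul_cross hr pc px qx py qy pr pt qr qt
    have hne : p.1 * q.2 - q.1 * p.2 ≠ 0 := by
      intro h
      obtain ⟨h1, h2⟩ := eq_of_mul_eq_mul_of_isCoprime p1 q1 pc qc (sub_eq_zero.1 h)
      exact hpq (Prod.ext h1 h2)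
    have hle := Int.le_of_dvd (abs_pos.2 (by simpa using hne)) ((dvd_abs _ _).2 hd)
    rw [abs_mul, abs_mul] at hle
    have hleR : (x : ℝ) * y * (r ^ 2 + s ^ 2) ≤ 16 * |(p.1 : ℝ) * q.2 - q.1 * p.2| := by
      have : (x * y * (r ^ 2 + s ^ 2) : ℤ) ≤ 16 * |p.1 * q.2 - q.1 * p.2| := by
        refine hle.trans (le_of_eq ?_)
        norm_num [abs_of_pos]
        ring
      exact_mod_cast this
    have pv : (0 : ℝ) < ((p.1 + p.2 : ℤ) : ℝ) := by exact_mod_cast add_pos p1 p2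
    have qv : (0 : ℝ) < ((q.1 + q.2 : ℤ) : ℝ) := by exact_mod_cast add_pos q1 q2
    have hdiff : (|p.1 - p.2| : ℤ) / ((p.1 + p.2 : ℤ) : ℝ) -
        (|q.1 - q.2| : ℤ) / ((q.1 + q.2 : ℤ) : ℝ) =
        σ * (2 * ((p.1 : ℝ) * q.2 - q.1 * p.2)) /
          (((p.1 + p.2 : ℤ) : ℝ) * ((q.1 + q.2 : ℤ) : ℝ)) := by
      rw [ps, qs, div_sub_div _ _ pv.ne' qv.ne']
      congr 1
      push_cast
      ring
    have hσ1 : |(σ : ℝ)| = 1 := by rcases hσ with h | h <;> simp [h]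
    rw [hdiff, abs_div, abs_mul, hσ1, one_mul, abs_mul, abs_two, abs_of_pos (mul_pos pv qv)]
    rw [div_le_div_iff₀ (by positivity) (by positivity)]
    have hvv : ((p.1 + p.2 : ℤ) : ℝ) * ((q.1 + q.2 : ℤ) : ℝ) ≤ (2 * V) * (2 * V) := by gcongr
    calc (x : ℝ) * y * (r ^ 2 + s ^ 2) * (((p.1 + p.2 : ℤ) : ℝ) * ((q.1 + q.2 : ℤ) : ℝ))
        ≤ (16 * |(p.1 : ℝ) * q.2 - q.1 * p.2|) * ((2 * V) * (2 * V)) := by gcongr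
      _ = 2 * |(p.1 : ℝ) * q.2 - q.1 * p.2| * (32 * V ^ 2) := by ring

theorem sum_Icc_inv_le (n : ℕ) : ∑ d ∈ Finset.Icc 1 n, (1 : ℝ) / d ≤ 1 + Real.log n := by
  have h := harmonic_le_one_add_log n
  rw [harmonic_eq_sum_Icc] at h
  push_cast at h
  simpa using h

theorem sum_quadrant_inv_le (n m : ℕ) :
    ∑ k ∈ Finset.Icc 1 n ×ˢ Finset.range m, (1 : ℝ) / ((k.1 : ℝ) ^ 2 + k.2 ^ 2) ≤
      4 * (1 + Real.log n) := by
  rw [Finset.sum_product]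
  have h : ∀ r ∈ Finset.Icc 1 n, ∑ s ∈ Finset.range m, (1 : ℝ) / ((r : ℝ) ^ 2 + s ^ 2) ≤
      4 * (1 / r) := by
    intro r hr
    have hr1 : (1 : ℝ) ≤ r := by exact_mod_cast (Finset.mem_Icc.1 hr).1
    have hstep : ∀ s ∈ Finset.range m, (1 : ℝ) / ((r : ℝ) ^ 2 + s ^ 2) ≤
        4 * (1 / ((r : ℝ) + s)) - 4 * (1 / ((r : ℝ) + (s + 1 : ℕ))) := by
      intro s _
      have hs : (0 : ℝ) ≤ s := by positivity
      have e : 4 * (1 / ((r : ℝ) + s)) - 4 * (1 / ((r : ℝ) + (s + 1 : ℕ))) =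
          4 / (((r : ℝ) + s) * (r + s + 1)) := by
        push_cast
        field_simp
        ring
      rw [e, div_le_div_iff₀ (by positivity) (by positivity)]
      nlinarith [sq_nonneg ((r : ℝ) - s), mul_nonneg (sub_nonneg.2 hr1) hs]
    refine (Finset.sum_le_sum hstep).trans ?_
    rw [Finset.sum_range_sub' (fun s : ℕ => 4 * (1 / ((r : ℝ) + s)))]
    simp only [Nat.cast_zero, add_zero, sub_le_self_iff]
    positivity
  refine (Finset.sum_le_sum h).trans ?_
  rw [← Finset.mul_sum]
  linarith [sum_Icc_inv_le n]

theorem card_divisors_le_of_two_pow_dvd {z : ℤ} (hz : z ≠ 0) {N i : ℕ} (hzN : |z| ≤ N)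
    (hi : (2 : ℤ) ^ i ∣ z) :
    z.natAbs.divisors.card ≤ (i + 1) *
      (2 * ((Finset.Icc 1 N.sqrt).filter (fun d : ℕ => ((2 ^ i * d : ℕ) : ℤ) ∣ z)).card) := by
  obtain ⟨k, rfl⟩ := hi
  have hk : k ≠ 0 := right_ne_zero_of_mul hz
  have e : ((2 : ℤ) ^ i * k).natAbs = 2 ^ i * k.natAbs := by
    rw [Int.natAbs_mul, Int.natAbs_pow]; rfl
  have hkN : k.natAbs ≤ N := by
    have h1 : 2 ^ i * k.natAbs ≤ N := by
      rw [← e]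
      exact Int.ofNat_le.1 (by rwa [Int.natCast_natAbs])
    exact (Nat.le_mul_of_pos_left _ (by positivity)).trans h1
  rw [e]
  refine (Nat.card_divisors_mul_le _ _).trans ?_
  rw [Nat.divisors_prime_pow Nat.prime_two, Finset.card_map, Finset.card_range]
  refine Nat.mul_le_mul_left _ ((Nat.card_divisors_le_two_mul _).trans ?_)
  refine Nat.mul_le_mul_left _ (Finset.card_le_card ?_)
  intro d hd
  simp only [Finset.mem_filter, Nat.mem_divisors, Finset.mem_Icc] at hd ⊢
  obtain ⟨⟨hd, -⟩, hdk⟩ := hd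
  refine ⟨⟨Nat.pos_of_dvd_of_pos hd (Int.natAbs_pos.2 hk), ?_⟩, ?_⟩
  · rw [Nat.le_sqrt']
    exact hdk.trans hkN
  · push_cast
    exact mul_dvd_mul_left _ (Int.natCast_dvd.2 hd)

theorem card_divisors_sq_add_sq_le {a b : ℤ} (ha : 0 < a) (hb : 0 < b) (hab : IsCoprime a b)
    {N : ℕ} (hN : a + b ≤ N) :
    (a ^ 2 + b ^ 2).natAbs.divisors.card ≤
      2 * ((Finset.Icc 1 N.sqrt ×ˢ Finset.range (N.sqrt + 1)).filter (fun k : ℕ × ℕ =>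
        ((k.1 ^ 2 + k.2 ^ 2 : ℕ) : ℤ) ∣ k.1 * a + k.2 * b ∧
          ((k.1 ^ 2 + k.2 ^ 2 : ℕ) : ℤ) ∣ k.1 * b - k.2 * a)).card := by
  refine (Nat.card_divisors_le_two_mul _).trans (Nat.mul_le_mul_left _ ?_)
  refine (Finset.card_le_card ?_).trans
    (Finset.card_image_le (f := fun k : ℕ × ℕ => k.1 ^ 2 + k.2 ^ 2))
  intro d hd
  simp only [Finset.mem_filter, Nat.mem_divisors] at hd
  obtain ⟨⟨hd, h0⟩, hdk⟩ := hd
  have hd0 : 0 < d := Nat.pos_of_ne_zero fun h => h0 (Nat.eq_zero_of_zero_dvd (h ▸ hd))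
  obtain ⟨r, s, hr, hrs, h1, h2⟩ := exists_quadrant_of_dvd hab hd0 (Int.natCast_dvd.2 hd)
  have hdN : d ≤ N := by
    have h3 : (d : ℤ) ^ 2 ≤ a ^ 2 + b ^ 2 := by
      have : ((d ^ 2 : ℕ) : ℤ) ≤ ((a ^ 2 + b ^ 2).natAbs : ℤ) := by exact_mod_cast hdk
      rw [Int.natAbs_of_nonneg (by positivity)] at this
      exact_mod_cast this
    have h4 : (d : ℤ) ^ 2 ≤ (N : ℤ) ^ 2 := by nlinarith [mul_pos ha hb]
    have := abs_le_of_sq_le_sq' h4 (by positivity)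
    exact_mod_cast this.2
  simp only [Finset.mem_image, Finset.mem_filter, Finset.mem_product, Finset.mem_Icc,
    Finset.mem_range, Nat.lt_succ_iff, Nat.le_sqrt']
  exact ⟨(r, s), ⟨⟨⟨hr, by simp only; nlinarith⟩, by simp only; nlinarith⟩, h1, h2⟩, hrs⟩

/-- Points counted with the divisors of `a - b`, `a + b` and `a ^ 2 + b ^ 2`, in a box. -/
theorem sum_card_divisors_le {V H : ℕ} (hV : 1 ≤ V) (hHV : H ≤ 2 * V) (hH : 1 ≤ H)
    {t₀ l : ℝ} (hl : 0 ≤ l) (i j : ℕ) (G : Finset (ℤ × ℤ))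
    (hG : ∀ p ∈ G, 0 < p.1 ∧ 0 < p.2 ∧ IsCoprime p.1 p.2 ∧ p.1 ≠ p.2 ∧ p.1 + p.2 ≤ 2 * V ∧
      |p.1 - p.2| ≤ H ∧ (2 : ℤ) ^ i ∣ p.1 - p.2 ∧ (2 : ℤ) ^ j ∣ p.1 + p.2 ∧
      t₀ ≤ (|p.1 - p.2| : ℤ) / ((p.1 + p.2 : ℤ) : ℝ) ∧
      (|p.1 - p.2| : ℤ) / ((p.1 + p.2 : ℤ) : ℝ) ≤ t₀ + l) :
    ∑ p ∈ G, (((p.1 - p.2).natAbs.divisors.card * (p.1 + p.2).natAbs.divisors.card *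
      (p.1 ^ 2 + p.2 ^ 2).natAbs.divisors.card : ℕ) : ℝ) ≤
    (i + 1) * (j + 1) * (2048 * (√H * √V * V +
      l * V ^ 2 * (1 + Real.log (2 * V)) ^ 3 / 2 ^ (i + j))) := by
  set Λ := 1 + Real.log (2 * V) with hΛ
  have hVR : (1 : ℝ) ≤ V := by exact_mod_cast hV
  let D := Finset.Icc 1 H.sqrt ×ˢ (Finset.Icc 1 (2 * V).sqrt ×ˢ
    (Finset.Icc 1 (2 * V).sqrt ×ˢ Finset.range ((2 * V).sqrt + 1)))
  let R : ℤ × ℤ → ℕ × ℕ × ℕ × ℕ → Prop := fun p k =>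
    ((2 ^ i * k.1 : ℕ) : ℤ) ∣ p.1 - p.2 ∧ ((2 ^ j * k.2.1 : ℕ) : ℤ) ∣ p.1 + p.2 ∧
      (((k.2.2.1 ^ 2 + k.2.2.2 ^ 2 : ℕ) : ℤ) ∣ k.2.2.1 * p.1 + k.2.2.2 * p.2 ∧
          ((k.2.2.1 ^ 2 + k.2.2.2 ^ 2 : ℕ) : ℤ) ∣ k.2.2.1 * p.2 - k.2.2.2 * p.1)
  have step1 : ∀ p ∈ G, (p.1 - p.2).natAbs.divisors.card * (p.1 + p.2).natAbs.divisors.card *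
      (p.1 ^ 2 + p.2 ^ 2).natAbs.divisors.card ≤
      (i + 1) * (j + 1) * (8 * (D.filter (R p)).card) := by
    intro p hp
    obtain ⟨h1, h2, hc, hne, hv, hu, hi, hj, -, -⟩ := hG p hp
    have e1 := card_divisors_le_of_two_pow_dvd (sub_ne_zero.2 hne) hu hi
    have e2 := card_divisors_le_of_two_pow_dvd (N := 2 * V) (add_pos h1 h2).ne'
      (by rw [abs_of_pos (add_pos h1 h2)]; exact_mod_cast hv) hj
    have e3 := card_divisors_sq_add_sq_le h1 h2 hc (N := 2 * V) (by exact_mod_cast hv)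
    refine (Nat.mul_le_mul (Nat.mul_le_mul e1 e2) e3).trans (le_of_eq ?_)
    have : D.filter (R p) =
        (Finset.Icc 1 H.sqrt).filter (fun d : ℕ => ((2 ^ i * d : ℕ) : ℤ) ∣ p.1 - p.2) ×ˢ
        ((Finset.Icc 1 (2 * V).sqrt).filter (fun d : ℕ => ((2 ^ j * d : ℕ) : ℤ) ∣ p.1 + p.2) ×ˢ
        (Finset.Icc 1 (2 * V).sqrt ×ˢ Finset.range ((2 * V).sqrt + 1)).filter
          (fun k : ℕ × ℕ => ((k.1 ^ 2 + k.2 ^ 2 : ℕ) : ℤ) ∣ k.1 * p.1 + k.2 * p.2 ∧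
            ((k.1 ^ 2 + k.2 ^ 2 : ℕ) : ℤ) ∣ k.1 * p.2 - k.2 * p.1)) := by
      ext k
      simp only [D, R, Finset.mem_filter, Finset.mem_product]
      tauto
    rw [this, Finset.card_product, Finset.card_product]
    ring
  have step2 : ∀ k ∈ D, ((G.filter (fun p => R p k)).card : ℝ) ≤
      2 * (1 + 32 * l * V ^ 2 / 2 ^ (i + j) * ((1 / k.1) * ((1 / k.2.1) *
        (1 / ((k.2.2.1 : ℝ) ^ 2 + k.2.2.2 ^ 2))))) := by
    intro k hk
    simp only [D, Finset.mem_product, Finset.mem_Icc] at hk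
    obtain ⟨⟨hk1, -⟩, ⟨hk2, -⟩, ⟨hk3, -⟩, -⟩ := hk
    have hs : ∀ σ : ℤ, (σ = 1 ∨ σ = -1) →
        ((G.filter (fun p => R p k ∧ |p.1 - p.2| = σ * (p.1 - p.2))).card : ℝ) ≤
        1 + 32 * l * V ^ 2 / 2 ^ (i + j) * ((1 / k.1) * ((1 / k.2.1) *
        (1 / ((k.2.2.1 : ℝ) ^ 2 + k.2.2.2 ^ 2)))) := by
      intro σ hσ
      have := card_lattice_le (V := V) (by linarith) (t₀ := t₀) hl
        (x := ((2 ^ i * k.1 : ℕ) : ℤ)) (y := ((2 ^ j * k.2.1 : ℕ) : ℤ)) (r := k.2.2.1)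
        (s := k.2.2.2) (by positivity) (by positivity) (by positivity)
        (G.filter (fun p => R p k ∧ |p.1 - p.2| = σ * (p.1 - p.2))) hσ ?_
      · refine this.trans (le_of_eq ?_)
        push_cast
        rw [pow_add]
        have : (0 : ℝ) < (k.2.2.1 : ℝ) ^ 2 + (k.2.2.2 : ℝ) ^ 2 := by positivity
        field_simp
      · intro p hp
        simp only [Finset.mem_filter] at hp
        obtain ⟨hp, ⟨r1, r2, r3, r4⟩, hs⟩ := hp
        obtain ⟨h1, h2, hc, hne, hv, hu, -, -, ht, ht'⟩ := hG p hp
        exact ⟨h1, h2, hc, by exact_mod_cast hv, hs, ht, ht', r1, r2,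
          by exact_mod_cast r3, by exact_mod_cast r4⟩
    have hsub : G.filter (fun p => R p k) ⊆
        G.filter (fun p => R p k ∧ |p.1 - p.2| = 1 * (p.1 - p.2)) ∪
        G.filter (fun p => R p k ∧ |p.1 - p.2| = -1 * (p.1 - p.2)) := by
      intro p hp
      simp only [Finset.mem_union, Finset.mem_filter] at hp ⊢
      rcases abs_choice (p.1 - p.2) with h | h
      · exact Or.inl ⟨hp.1, hp.2, by rw [h]; ring⟩
      · exact Or.inr ⟨hp.1, hp.2, by rw [h]; ring⟩
    have hcard : ((G.filter (fun p => R p k)).card : ℝ) ≤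
        ((G.filter (fun p => R p k ∧ |p.1 - p.2| = 1 * (p.1 - p.2))).card : ℝ) +
        ((G.filter (fun p => R p k ∧ |p.1 - p.2| = -1 * (p.1 - p.2))).card : ℝ) := by
      exact_mod_cast (Finset.card_le_card hsub).trans (Finset.card_union_le _ _)
    linarith [hs 1 (Or.inl rfl), hs (-1) (Or.inr rfl)]
  have step3 : ∑ p ∈ G, ((D.filter (R p)).card : ℝ) =
      ∑ k ∈ D, ((G.filter (fun p => R p k)).card : ℝ) := by
    exact_mod_cast Finset.sum_card_bipartiteAbove_eq_sum_card_bipartiteBelow (s := G) (t := D) R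
  have hcardD : (D.card : ℝ) ≤ 8 * (√H * √V * V) := by
    simp only [D, Finset.card_product, Nat.card_Icc, Finset.card_range, Nat.add_sub_cancel]
    push_cast
    have s1 : (H.sqrt : ℝ) ≤ √H := Real.nat_sqrt_le_real_sqrt
    have s2 : ((2 * V).sqrt : ℝ) ≤ √(2 * V) := by
      simpa using Real.nat_sqrt_le_real_sqrt (a := 2 * V)
    have s3 : (1 : ℝ) ≤ √(2 * V) := Real.one_le_sqrt.2 (by linarith)
    have s4 : √(2 * V) ≤ 2 * √V := by
      rw [Real.sqrt_mul (by norm_num)]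
      gcongr
      rw [Real.sqrt_le_left (by norm_num)]; norm_num
    have s5 : √(2 * V) * √(2 * V) = 2 * V := Real.mul_self_sqrt (by positivity)
    calc (H.sqrt : ℝ) * ((2 * V).sqrt * ((2 * V).sqrt * ((2 * V).sqrt + 1)))
        ≤ √H * (2 * √V * (√(2 * V) * (√(2 * V) + √(2 * V)))) := by
          gcongr
          exact s2.trans s4
      _ = √H * (2 * √V * (2 * (√(2 * V) * √(2 * V)))) := by ring
      _ = _ := by rw [s5]; ring
  have hlog : ∀ n : ℕ, n ≤ 2 * V → 1 + Real.log n ≤ Λ := by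
    intro n hn
    rcases Nat.eq_zero_or_pos n with rfl | h0
    · simpa [hΛ] using Real.log_nonneg (by linarith : (1 : ℝ) ≤ 2 * V)
    · rw [hΛ]
      have : (n : ℝ) ≤ 2 * V := by exact_mod_cast hn
      gcongr
  have hΛ0 : 0 ≤ Λ := by
    rw [hΛ]; linarith [Real.log_nonneg (by linarith : (1 : ℝ) ≤ 2 * V)]
  have hsumD : ∑ k ∈ D, ((1 : ℝ) / k.1) * ((1 / k.2.1) *
        (1 / ((k.2.2.1 : ℝ) ^ 2 + k.2.2.2 ^ 2))) ≤ 4 * Λ ^ 3 := by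
    have : ∑ k ∈ D, ((1 : ℝ) / k.1) * ((1 / k.2.1) *
        (1 / ((k.2.2.1 : ℝ) ^ 2 + k.2.2.2 ^ 2))) =
        (∑ d ∈ Finset.Icc 1 H.sqrt, (1 : ℝ) / d) * ((∑ d ∈ Finset.Icc 1 (2 * V).sqrt, (1 : ℝ) / d) *
        ∑ k ∈ Finset.Icc 1 (2 * V).sqrt ×ˢ Finset.range ((2 * V).sqrt + 1),
          (1 : ℝ) / ((k.1 : ℝ) ^ 2 + k.2 ^ 2)) := by
      rw [Finset.sum_mul_sum, Finset.sum_mul_sum]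
      simp only [D]
      rw [Finset.sum_product]
      simp_rw [Finset.mul_sum]
      rw [Finset.sum_congr rfl]
      intro d _
      rw [Finset.sum_product]
    rw [this]
    have hs : (2 * V).sqrt ≤ 2 * V := Nat.sqrt_le_self _
    calc _ ≤ Λ * (Λ * (4 * Λ)) := by
          refine mul_le_mul ((sum_Icc_inv_le _).trans (hlog _ ((Nat.sqrt_le_self _).trans hHV)))
            (mul_le_mul ((sum_Icc_inv_le _).trans (hlog _ hs)) ((sum_quadrant_inv_le _ _).trans
              (by linarith [hlog _ hs])) (Finset.sum_nonneg fun _ _ => by positivity) hΛ0)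
            (mul_nonneg (Finset.sum_nonneg fun _ _ => by positivity)
              (Finset.sum_nonneg fun _ _ => by positivity)) hΛ0
      _ = _ := by ring
  calc ∑ p ∈ G, (((p.1 - p.2).natAbs.divisors.card * (p.1 + p.2).natAbs.divisors.card *
      (p.1 ^ 2 + p.2 ^ 2).natAbs.divisors.card : ℕ) : ℝ)
      ≤ ∑ p ∈ G, ((i : ℝ) + 1) * (j + 1) * (8 * ((D.filter (R p)).card : ℝ)) :=
        Finset.sum_le_sum fun p hp => by exact_mod_cast step1 p hp
    _ = (i + 1) * (j + 1) * (8 * ∑ k ∈ D, ((G.filter (fun p => R p k)).card : ℝ)) := by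
        rw [← step3, Finset.mul_sum, Finset.mul_sum]
    _ ≤ (i + 1) * (j + 1) * (8 * ∑ k ∈ D, (2 * (1 + 32 * l * V ^ 2 / 2 ^ (i + j) *
        ((1 / k.1) * ((1 / k.2.1) * (1 / ((k.2.2.1 : ℝ) ^ 2 + k.2.2.2 ^ 2))))))) := by
        gcongr with k hk
        exact step2 k hk
    _ = (i + 1) * (j + 1) * (8 * (2 * (D.card + 32 * l * V ^ 2 / 2 ^ (i + j) *
        ∑ k ∈ D, ((1 : ℝ) / k.1) * ((1 / k.2.1) *
        (1 / ((k.2.2.1 : ℝ) ^ 2 + k.2.2.2 ^ 2)))))) := by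
        rw [← Finset.mul_sum, Finset.sum_add_distrib, ← Finset.mul_sum]
        simp
    _ ≤ (i + 1) * (j + 1) * (8 * (2 * (8 * (√H * √V * V) + 32 * l * V ^ 2 / 2 ^ (i + j) *
        (4 * Λ ^ 3)))) := by gcongr
    _ ≤ _ := by
        gcongr ?_ * ?_
        have : 0 ≤ √H * √V * V := by positivity
        have e : 32 * l * V ^ 2 / 2 ^ (i + j) * (4 * Λ ^ 3) =
          128 * (l * V ^ 2 * Λ ^ 3 / 2 ^ (i + j)) := by ring
        rw [e]
        linarith

/-- The product of the numbers of divisors of `a - b`, `a + b` and `a ^ 2 + b ^ 2`. -/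
def divisorWeight (x : ℤ × ℤ) : ℕ :=
  (x.1 - x.2).natAbs.divisors.card * (x.1 + x.2).natAbs.divisors.card *
    (x.1 ^ 2 + x.2 ^ 2).natAbs.divisors.card

/-- The upper bound of `card_conic_le`, for the height condition `max x y ≤ Y / max a b`. -/
noncomputable def conicBound (Y : ℝ) (x : ℤ × ℤ) : ℝ :=
  divisorWeight x *
    (4 + 12 * ((Y / ((max x.1 x.2 : ℤ) : ℝ)) / √((|x.1 - x.2| * (x.1 + x.2) : ℤ) : ℝ)))

theorem log_ge_of_sixteen_le {B : ℝ} (hB : 16 ≤ B) : 27 / 10 ≤ Real.log B := by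
  have h : Real.log 16 ≤ Real.log B := Real.log_le_log (by norm_num) hB
  have h2 : Real.log 16 = 4 * Real.log 2 := by
    rw [show (16 : ℝ) = 2 ^ 4 by norm_num, Real.log_pow]; norm_num
  linarith [Real.log_two_gt_d9]

theorem sqrt_two_pow_sq (n : ℕ) : (√2 ^ n) ^ 2 = (2 : ℝ) ^ n := by
  rw [← pow_mul, mul_comm, pow_mul, Real.sq_sqrt (by norm_num)]

theorem sum_conicBound_box_le {Y B : ℝ} (hB : 16 ≤ B) (hY : 0 ≤ Y) {i j p q : ℕ} (hpq : p ≤ q)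
    (hq : (2 : ℝ) ^ q ≤ 2 * √B) {t₀ l : ℝ} (hl : 0 ≤ l) (hlP : l ≤ 2 * 2 ^ p / 2 ^ q)
    (G : Finset (ℤ × ℤ))
    (hG : ∀ x ∈ G, 0 < x.1 ∧ 0 < x.2 ∧ IsCoprime x.1 x.2 ∧ x.1 ≠ x.2 ∧
      2 ^ q ≤ x.1 + x.2 ∧ x.1 + x.2 < 2 ^ (q + 1) ∧ 2 ^ p ≤ |x.1 - x.2| ∧
      |x.1 - x.2| < 2 ^ (p + 1) ∧ (2 : ℤ) ^ i ∣ x.1 - x.2 ∧ (2 : ℤ) ^ j ∣ x.1 + x.2 ∧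
      t₀ ≤ (|x.1 - x.2| : ℤ) / ((x.1 + x.2 : ℤ) : ℝ) ∧
      (|x.1 - x.2| : ℤ) / ((x.1 + x.2 : ℤ) : ℝ) ≤ t₀ + l) :
    ∑ x ∈ G, conicBound Y x ≤ 400000 * ((i + 1) * (j + 1)) *
      (4 ^ q + 2 ^ p * 2 ^ q * Real.log B ^ 3 + Y +
        Y * Real.log B ^ 3 / 2 ^ (i + j) * (l * (√2 ^ q / √2 ^ p))) := by
  set L := Real.log B with hL
  have hL2 : 27 / 10 ≤ L := log_ge_of_sixteen_le hB
  have hB0 : 0 < B := by linarith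
  set P : ℝ := √2 ^ p with hP
  set Q : ℝ := √2 ^ q with hQ
  have hP0 : 0 < P := by positivity
  have hQ0 : 0 < Q := by positivity
  have hP2 : P ^ 2 = 2 ^ p := sqrt_two_pow_sq p
  have hQ2 : Q ^ 2 = 2 ^ q := sqrt_two_pow_sq q
  have hPQ : P ≤ Q := pow_le_pow_right₀ (Real.one_le_sqrt.2 (by norm_num)) hpq
  have hΛ : 1 + Real.log (2 * (2 ^ q : ℕ)) ≤ 2 * L := by
    have h1 : Real.log (2 * (2 ^ q : ℕ)) ≤ Real.log (4 * √B) := by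
      apply Real.log_le_log (by positivity)
      push_cast
      linarith
    have h2 : Real.log (4 * √B) = 2 * Real.log 2 + L / 2 := by
      rw [Real.log_mul (by norm_num) (by positivity), Real.log_sqrt hB0.le,
        show (4 : ℝ) = 2 ^ 2 by norm_num, Real.log_pow]
      norm_num [hL]
    linarith [Real.log_two_lt_d9]
  have hΛ0 : 0 ≤ 1 + Real.log (2 * (2 ^ q : ℕ)) := by
    have : (1 : ℝ) ≤ 2 * (2 ^ q : ℕ) := by
      have : (1 : ℝ) ≤ (2 ^ q : ℕ) := by exact_mod_cast Nat.one_le_two_pow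
      linarith
    linarith [Real.log_nonneg this]
  have hΛ3 : (1 + Real.log (2 * (2 ^ q : ℕ))) ^ 3 ≤ 8 * L ^ 3 := by
    calc _ ≤ (2 * L) ^ 3 := by gcongr
      _ = _ := by ring
  have hweight : ∀ x ∈ G, conicBound Y x ≤ divisorWeight x * (4 + 24 * (Y / (P * Q ^ 3))) := by
    intro x hx
    obtain ⟨h1, h2, hc, hne, hv, hv', hu, hu', -⟩ := hG x hx
    refine mul_le_mul_of_nonneg_left ?_ (Nat.cast_nonneg _)
    have hvR : Q ^ 2 ≤ ((x.1 + x.2 : ℤ) : ℝ) := by rw [hQ2]; exact_mod_cast hv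
    have huR : P ^ 2 ≤ ((|x.1 - x.2| : ℤ) : ℝ) := by rw [hP2]; exact_mod_cast hu
    have hm : Q ^ 2 / 2 ≤ ((max x.1 x.2 : ℤ) : ℝ) := by
      have : x.1 + x.2 ≤ 2 * max x.1 x.2 := by
        linarith [le_max_left x.1 x.2, le_max_right x.1 x.2]
      have : ((x.1 + x.2 : ℤ) : ℝ) ≤ 2 * ((max x.1 x.2 : ℤ) : ℝ) := by exact_mod_cast this
      linarith
    have hs : P * Q ≤ √((|x.1 - x.2| * (x.1 + x.2) : ℤ) : ℝ) := by
      apply Real.le_sqrt_of_sq_le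
      rw [mul_pow, Int.cast_mul]
      gcongr
    have : (Y / ((max x.1 x.2 : ℤ) : ℝ)) / √((|x.1 - x.2| * (x.1 + x.2) : ℤ) : ℝ) ≤
        (Y / (Q ^ 2 / 2)) / (P * Q) := by gcongr
    have e : (Y / (Q ^ 2 / 2)) / (P * Q) = 2 * (Y / (P * Q ^ 3)) := by field_simp
    linarith
  have hbox := sum_card_divisors_le (V := 2 ^ q) (H := 2 ^ (p + 1)) Nat.one_le_two_pow
    (by rw [pow_succ, mul_comm]; gcongr; norm_num) Nat.one_le_two_pow hl (t₀ := t₀) i j G (by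
      intro x hx
      obtain ⟨h1, h2, hc, hne, hv, hv', hu, hu', hi, hj, ht, ht'⟩ := hG x hx
      refine ⟨h1, h2, hc, hne, ?_, ?_, hi, hj, ht, ht'⟩
      · push_cast; rw [pow_succ] at hv'; linarith
      · push_cast; exact hu'.le)
  have hVQ : √((2 ^ q : ℕ) : ℝ) = Q := by
    push_cast; rw [← hQ2, Real.sqrt_sq hQ0.le]
  have hHP : √((2 ^ (p + 1) : ℕ) : ℝ) ≤ 3 / 2 * P := by
    apply Real.sqrt_le_iff.2 ⟨by positivity, ?_⟩
    push_cast
    rw [mul_pow, hP2, pow_succ]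
    have : (0 : ℝ) < 2 ^ p := by positivity
    linarith
  have hVc : ((2 ^ q : ℕ) : ℝ) = Q ^ 2 := by push_cast; rw [hQ2]
  have hl2 : l * Q ^ 4 ≤ 2 * P ^ 2 * Q ^ 2 := by
    rw [← hP2, ← hQ2, le_div_iff₀ (by positivity)] at hlP
    calc l * Q ^ 4 = (l * Q ^ 2) * Q ^ 2 := by ring
      _ ≤ _ := by gcongr
  have hT : ∑ x ∈ G, (divisorWeight x : ℝ) ≤ (i + 1) * (j + 1) *
      (2048 * (3 / 2 * P * Q ^ 3 + l * Q ^ 4 * (8 * L ^ 3) / 2 ^ (i + j))) := by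
    refine hbox.trans ?_
    gcongr ?_ * (_ * (?_ + ?_))
    · rw [hVQ, hVc]
      calc _ ≤ 3 / 2 * P * Q * Q ^ 2 := by gcongr
        _ = _ := by ring
    · rw [hVc] at hΛ3 ⊢
      rw [show (Q ^ 2) ^ 2 = Q ^ 4 by ring]
      gcongr
  have h2ij : (1 : ℝ) ≤ 2 ^ (i + j) := one_le_pow₀ (by norm_num)
  calc ∑ x ∈ G, conicBound Y x
      ≤ ∑ x ∈ G, (divisorWeight x : ℝ) * (4 + 24 * (Y / (P * Q ^ 3))) :=
        Finset.sum_le_sum hweight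
    _ = (∑ x ∈ G, (divisorWeight x : ℝ)) * (4 + 24 * (Y / (P * Q ^ 3))) := by
        rw [Finset.sum_mul]
    _ ≤ (i + 1) * (j + 1) *
      (2048 * (3 / 2 * P * Q ^ 3 + l * Q ^ 4 * (8 * L ^ 3) / 2 ^ (i + j))) *
        (4 + 24 * (Y / (P * Q ^ 3))) := by gcongr
    _ = ((i + 1) * (j + 1)) * (2048 * (6 * (P * Q ^ 3) +
        32 * (l * Q ^ 4 * L ^ 3 / 2 ^ (i + j)) + 36 * Y +
        192 * (Y * L ^ 3 / 2 ^ (i + j) * (l * (Q / P))))) := by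
        field_simp
        ring
    _ ≤ ((i + 1) * (j + 1)) * (2048 * (6 * 4 ^ q +
        32 * (2 * (2 ^ p * 2 ^ q * L ^ 3)) + 36 * Y +
        192 * (Y * L ^ 3 / 2 ^ (i + j) * (l * (Q / P))))) := by
        have e4 : (4 : ℝ) ^ q = Q * Q ^ 3 := by
          rw [show (4 : ℝ) = 2 ^ 2 by norm_num, ← pow_mul, mul_comm, pow_mul, ← hQ2]; ring
        rw [e4, ← hP2, ← hQ2]
        gcongr
        calc l * Q ^ 4 * L ^ 3 / 2 ^ (i + j) ≤ l * Q ^ 4 * L ^ 3 :=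
              div_le_self (by positivity) h2ij
          _ ≤ 2 * P ^ 2 * Q ^ 2 * L ^ 3 := by gcongr
          _ = _ := by ring
    _ = ((i + 1) * (j + 1)) * (2048 * (6 * 4 ^ q +
        64 * (2 ^ p * 2 ^ q * L ^ 3) + 36 * Y +
        192 * (Y * L ^ 3 / 2 ^ (i + j) * (l * (Q / P))))) := by ring
    _ ≤ ((i + 1) * (j + 1)) * (400000 * (4 ^ q + 2 ^ p * 2 ^ q * L ^ 3 + Y +
        Y * L ^ 3 / 2 ^ (i + j) * (l * (Q / P)))) := by
        have : (0 : ℝ) ≤ 4 ^ q := by positivity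
        have : (0 : ℝ) ≤ 2 ^ p * 2 ^ q * L ^ 3 := by positivity
        have : 0 ≤ Y * L ^ 3 / 2 ^ (i + j) * (l * (Q / P)) := by positivity
        gcongr ?_ * ?_
        linarith
    _ = _ := by ring

/-- The dyadic sizes of `a - b` and `a + b`. -/
def dyadicSize (x : ℤ × ℤ) : ℕ × ℕ :=
  (Nat.log 2 (x.1 - x.2).natAbs, Nat.log 2 (x.1 + x.2).natAbs)

theorem two_pow_log_natAbs_le {z : ℤ} (hz : z ≠ 0) :
    (2 : ℤ) ^ Nat.log 2 z.natAbs ≤ |z| ∧ |z| < (2 : ℤ) ^ (Nat.log 2 z.natAbs + 1) := by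
  rw [← Int.natCast_natAbs]
  constructor
  · exact_mod_cast Nat.pow_log_le_self 2 (Int.natAbs_ne_zero.2 hz)
  · exact_mod_cast Nat.lt_pow_succ_log_self one_lt_two z.natAbs

/-- The exponents `q` with `2 ^ q ≤ 2 * √B`. -/
noncomputable def topExponent (B : ℝ) : ℕ := Nat.log 2 ⌊2 * √B⌋₊

theorem le_topExponent_iff {B : ℝ} (hB : 16 ≤ B) {q : ℕ} :
    q ≤ topExponent B ↔ (2 : ℝ) ^ q ≤ 2 * √B := by
  have h1 : (1 : ℝ) ≤ 2 * √B := by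
    have : (1 : ℝ) ≤ √B := Real.one_le_sqrt.2 (by linarith)
    linarith
  rw [topExponent, Nat.le_log_iff_pow_le one_lt_two (by simpa using Nat.floor_pos.2 h1 |>.ne'),
    Nat.le_floor_iff (by positivity)]
  push_cast
  rfl

theorem topExponent_add_one_le {B : ℝ} (hB : 16 ≤ B) :
    (topExponent B : ℝ) + 1 ≤ 2 * Real.log B := by
  have h := (le_topExponent_iff hB).1 le_rfl
  have hlog := Real.log_le_log (by positivity) h
  have h2 : Real.log (2 * √B) = Real.log 2 + Real.log B / 2 := by
    rw [Real.log_mul (by norm_num) (by positivity), Real.log_sqrt (by linarith)]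
  rw [Real.log_pow, h2] at hlog
  nlinarith only [hlog, Real.log_two_gt_d9, Real.log_two_lt_d9, log_ge_of_sixteen_le hB,
    (Nat.cast_nonneg (topExponent B) : (0 : ℝ) ≤ _)]

theorem sum_range_two_pow_le (n : ℕ) : ∑ p ∈ Finset.range (n + 1), (2 : ℝ) ^ p ≤ 2 * 2 ^ n := by
  rw [geom_sum_eq (by norm_num)]
  rw [pow_succ]
  have : (0 : ℝ) < 2 ^ n := by positivity
  norm_num
  linarith

theorem sum_range_four_pow_le (n : ℕ) : ∑ p ∈ Finset.range (n + 1), (4 : ℝ) ^ p ≤ 2 * 4 ^ n := by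
  rw [geom_sum_eq (by norm_num)]
  rw [pow_succ]
  have : (0 : ℝ) < 4 ^ n := by positivity
  norm_num
  linarith

theorem four_pow_topExponent_le {B : ℝ} (hB : 16 ≤ B) : (4 : ℝ) ^ topExponent B ≤ 4 * B := by
  have h := (le_topExponent_iff hB).1 le_rfl
  calc (4 : ℝ) ^ topExponent B = (2 ^ topExponent B) ^ 2 := by
        rw [← pow_mul, mul_comm, pow_mul]; norm_num
    _ ≤ (2 * √B) ^ 2 := by gcongr
    _ = 4 * B := by rw [mul_pow, Real.sq_sqrt (by linarith)]; norm_num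

/-- The pairs of exponents `p ≤ q ≤ topExponent B`. -/
noncomputable def dyadicSizes (B : ℝ) : Finset (ℕ × ℕ) :=
  (Finset.range (topExponent B + 1) ×ˢ Finset.range (topExponent B + 1)).filter
    (fun k => k.1 ≤ k.2)

theorem sum_dyadicSizes_eq (B : ℝ) (f : ℕ × ℕ → ℝ) :
    ∑ k ∈ dyadicSizes B, f k =
      ∑ q ∈ Finset.range (topExponent B + 1), ∑ p ∈ Finset.range (q + 1), f (p, q) := by
  rw [dyadicSizes, Finset.sum_filter, Finset.sum_product_right]
  refine Finset.sum_congr rfl fun q hq => ?_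
  rw [← Finset.sum_filter]
  refine Finset.sum_congr ?_ fun _ _ => rfl
  ext p
  simp only [Finset.mem_filter, Finset.mem_range] at hq ⊢
  omega

theorem sum_dyadicSizes_le {B : ℝ} (hB : 16 ≤ B) {Y : ℝ} (hY : 0 ≤ Y) (hYB : Y ≤ B) :
    ∑ k ∈ dyadicSizes B, ((4 : ℝ) ^ k.2 + 2 ^ k.1 * 2 ^ k.2 * Real.log B ^ 3 + Y) ≤
      36 * B * Real.log B ^ 3 := by
  set L := Real.log B with hL
  have hL2 : 27 / 10 ≤ L := log_ge_of_sixteen_le hB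
  have hN : (topExponent B : ℝ) + 1 ≤ 2 * L := topExponent_add_one_le hB
  set N := topExponent B with hN'
  have h4 : ∑ q ∈ Finset.range (N + 1), (4 : ℝ) ^ q ≤ 8 * B := by
    linarith [sum_range_four_pow_le N, four_pow_topExponent_le hB]
  rw [sum_dyadicSizes_eq]
  calc ∑ q ∈ Finset.range (N + 1), ∑ p ∈ Finset.range (q + 1),
        ((4 : ℝ) ^ q + 2 ^ p * 2 ^ q * L ^ 3 + Y)
      ≤ ∑ q ∈ Finset.range (N + 1), (2 * L * 4 ^ q + 2 * 4 ^ q * L ^ 3 + 2 * L * B) := by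
        refine Finset.sum_le_sum fun q hq => ?_
        have hq : (q : ℝ) + 1 ≤ 2 * L := by
          have : (q : ℝ) + 1 ≤ N + 1 := by exact_mod_cast Finset.mem_range.1 hq
          linarith
        rw [Finset.sum_add_distrib, Finset.sum_add_distrib, ← Finset.sum_mul, ← Finset.sum_mul]
        simp only [Finset.sum_const, Finset.card_range, nsmul_eq_mul]
        push_cast
        have e : (4 : ℝ) ^ q = 2 ^ q * 2 ^ q := by rw [← mul_pow]; norm_num
        refine add_le_add (add_le_add (by gcongr) ?_) (by gcongr)
        refine mul_le_mul_of_nonneg_right ?_ (by positivity)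
        rw [e, ← mul_assoc]
        exact mul_le_mul_of_nonneg_right (sum_range_two_pow_le q) (by positivity)
    _ = (2 * L + 2 * L ^ 3) * ∑ q ∈ Finset.range (N + 1), (4 : ℝ) ^ q +
        ((N : ℝ) + 1) * (2 * L * B) := by
        rw [Finset.sum_add_distrib, Finset.sum_add_distrib, ← Finset.mul_sum, ← Finset.sum_mul,
          ← Finset.mul_sum]
        simp only [Finset.sum_const, Finset.card_range, nsmul_eq_mul]
        push_cast
        ring
    _ ≤ (2 * L + 2 * L ^ 3) * (8 * B) + (2 * L) * (2 * L * B) := by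
        have : 0 ≤ 2 * L * B := by positivity
        gcongr
    _ = B * (16 * L + 16 * L ^ 3 + 4 * L ^ 2) := by ring
    _ ≤ B * (36 * L ^ 3) := by
        have h1 : L ≤ L ^ 3 := le_self_pow₀ (by linarith) (by norm_num)
        have h2 : L ^ 2 ≤ L ^ 3 := pow_le_pow_right₀ (by linarith) (by norm_num)
        gcongr
        linarith
    _ = _ := by ring

/-- Sum of `conicBound` over pairs with prescribed dyadic sizes, ratios and divisibility. -/
theorem sum_conicBound_le {Y B : ℝ} (hB : 16 ≤ B) (hY : 0 ≤ Y) (hYB : Y ≤ B) (i j : ℕ)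
    (K : Finset (ℕ × ℕ)) {t₀ l : ℕ × ℕ → ℝ}
    (hK : ∀ k ∈ K, 0 ≤ l k ∧ l k ≤ 2 * 2 ^ k.1 / 2 ^ k.2) (X : Finset (ℤ × ℤ))
    (hX : ∀ x ∈ X, 0 < x.1 ∧ 0 < x.2 ∧ IsCoprime x.1 x.2 ∧ x.1 ≠ x.2 ∧
      ((max x.1 x.2 : ℤ) : ℝ) ≤ √B ∧ (2 : ℤ) ^ i ∣ x.1 - x.2 ∧ (2 : ℤ) ^ j ∣ x.1 + x.2 ∧
      dyadicSize x ∈ K ∧ t₀ (dyadicSize x) ≤ (|x.1 - x.2| : ℤ) / ((x.1 + x.2 : ℤ) : ℝ) ∧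
      (|x.1 - x.2| : ℤ) / ((x.1 + x.2 : ℤ) : ℝ) ≤ t₀ (dyadicSize x) + l (dyadicSize x)) :
    ∑ x ∈ X, conicBound Y x ≤ 400000 * ((i + 1) * (j + 1)) *
      (36 * B * Real.log B ^ 3 + Y * Real.log B ^ 3 / 2 ^ (i + j) *
        ∑ k ∈ K.filter (fun k => k ∈ dyadicSizes B), l k * (√2 ^ k.2 / √2 ^ k.1)) := by
  have hL2 : 27 / 10 ≤ Real.log B := log_ge_of_sixteen_le hB
  have hmap : ∀ x ∈ X, dyadicSize x ∈ K.filter (fun k => k ∈ dyadicSizes B) := by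
    intro x hx
    obtain ⟨h1, h2, hc, hne, hm, -, -, hk, -⟩ := hX x hx
    refine Finset.mem_filter.2 ⟨hk, ?_⟩
    have hq : (dyadicSize x).2 ≤ topExponent B := by
      rw [le_topExponent_iff hB]
      have h3 := (two_pow_log_natAbs_le (add_pos h1 h2).ne').1
      rw [abs_of_pos (add_pos h1 h2)] at h3
      have h4 : x.1 + x.2 ≤ 2 * max x.1 x.2 := by
        linarith [le_max_left x.1 x.2, le_max_right x.1 x.2]
      have h5 : ((2 : ℤ) ^ (dyadicSize x).2 : ℤ) ≤ 2 * max x.1 x.2 := h3.trans h4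
      have h6 : ((2 : ℝ) ^ (dyadicSize x).2) ≤ 2 * ((max x.1 x.2 : ℤ) : ℝ) := by exact_mod_cast h5
      linarith
    have hpq : (dyadicSize x).1 ≤ (dyadicSize x).2 := by
      simp only [dyadicSize]
      refine Nat.log_mono_right ?_
      omega
    simp only [dyadicSizes, Finset.mem_filter, Finset.mem_product, Finset.mem_range]
    omega
  rw [← Finset.sum_fiberwise_of_maps_to hmap]
  calc ∑ k ∈ K.filter (fun k => k ∈ dyadicSizes B), ∑ x ∈ X with dyadicSize x = k, conicBound Y x
      ≤ ∑ k ∈ K.filter (fun k => k ∈ dyadicSizes B), 400000 * (((i : ℝ) + 1) * (j + 1)) *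
      (4 ^ k.2 + 2 ^ k.1 * 2 ^ k.2 * Real.log B ^ 3 + Y +
        Y * Real.log B ^ 3 / 2 ^ (i + j) * (l k * (√2 ^ k.2 / √2 ^ k.1))) := by
        refine Finset.sum_le_sum fun k hk => ?_
        obtain ⟨hk, hkB⟩ := Finset.mem_filter.1 hk
        simp only [dyadicSizes, Finset.mem_filter, Finset.mem_product, Finset.mem_range] at hkB
        refine sum_conicBound_box_le hB hY hkB.2
          ((le_topExponent_iff hB).1 (Nat.lt_succ_iff.1 hkB.1.2)) (hK k hk).1 (hK k hk).2
          (t₀ := t₀ k) _ ?_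
        intro x hx
        obtain ⟨hxX, rfl⟩ := Finset.mem_filter.1 hx
        obtain ⟨h1, h2, hc, hne, hm, hi, hj, hk, ht, ht'⟩ := hX x hxX
        have hv := two_pow_log_natAbs_le (add_pos h1 h2).ne'
        have hu := two_pow_log_natAbs_le (sub_ne_zero.2 hne)
        rw [abs_of_pos (add_pos h1 h2)] at hv
        exact ⟨h1, h2, hc, hne, hv.1, hv.2, hu.1, hu.2, hi, hj, ht, ht'⟩
    _ = 400000 * (((i : ℝ) + 1) * (j + 1)) *
        (∑ k ∈ K.filter (fun k => k ∈ dyadicSizes B),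
          ((4 : ℝ) ^ k.2 + 2 ^ k.1 * 2 ^ k.2 * Real.log B ^ 3 + Y) +
          Y * Real.log B ^ 3 / 2 ^ (i + j) *
        ∑ k ∈ K.filter (fun k => k ∈ dyadicSizes B), l k * (√2 ^ k.2 / √2 ^ k.1)) := by
        rw [← Finset.mul_sum, Finset.sum_add_distrib, ← Finset.mul_sum]
    _ ≤ _ := by
        gcongr
        refine (Finset.sum_le_sum_of_subset_of_nonneg ?_ fun k _ _ => ?_).trans
          (sum_dyadicSizes_le hB hY hYB)
        · intro k hk
          exact (Finset.mem_filter.1 hk).2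
        · have : 0 ≤ Real.log B := by linarith
          positivity

theorem one_le_log_log {B : ℝ} (hB : 16 ≤ B) : 1 ≤ Real.log (Real.log B) := by
  have h : Real.log 16 ≤ Real.log B := Real.log_le_log (by norm_num) hB
  have h2 : Real.log 16 = 4 * Real.log 2 := by
    rw [show (16 : ℝ) = 2 ^ 4 by norm_num, Real.log_pow]; norm_num
  rw [Real.le_log_iff_exp_le (by linarith [Real.log_two_gt_d9])]
  linarith [Real.log_two_gt_d9, Real.exp_one_lt_d9]

theorem log_log_sq_le {B : ℝ} (hB : 16 ≤ B) : Real.log (Real.log B) ^ 2 ≤ 2 * Real.log B := by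
  have h := Real.quadratic_le_exp_of_nonneg (zero_le_one.trans (one_le_log_log hB))
  rw [Real.exp_log (by linarith [log_ge_of_sixteen_le hB])] at h
  linarith [one_le_log_log hB]

theorem log_log_le_log {B : ℝ} (hB : 16 ≤ B) : Real.log (Real.log B) ≤ Real.log B := by
  linarith [Real.log_le_sub_one_of_pos
    (show 0 < Real.log B by linarith [log_ge_of_sixteen_le hB])]

theorem mul_log_pow_three_le {B : ℝ} (hB : 16 ≤ B) :
    B * Real.log B ^ 3 ≤ B * Real.log B ^ 4 / Real.log (Real.log B) := by
  have hZ := one_le_log_log hB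
  have hL := log_ge_of_sixteen_le hB
  have hLZ := log_log_le_log hB
  rw [le_div_iff₀ (by linarith)]
  calc B * Real.log B ^ 3 * Real.log (Real.log B) ≤ B * Real.log B ^ 3 * Real.log B := by gcongr
    _ = _ := by ring

theorem sum_range_sqrt_two_pow_le (n : ℕ) : ∑ p ∈ Finset.range (n + 1), √2 ^ p ≤ 4 * √2 ^ n := by
  induction n with
  | zero => simp
  | succ n ih =>
    rw [Finset.sum_range_succ]
    have h : 4 / 3 ≤ √2 := Real.le_sqrt_of_sq_le (by norm_num)
    have h0 : 0 < √2 ^ n := by positivity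
    rw [pow_succ]
    nlinarith

theorem sum_sqrt_two_pow_le {s : Finset ℕ} {y : ℝ} (hy : 0 ≤ y) (hs : ∀ p ∈ s, √2 ^ p ≤ y) :
    ∑ p ∈ s, √2 ^ p ≤ 4 * y := by
  rcases s.eq_empty_or_nonempty with rfl | hne
  · simpa using hy
  · calc ∑ p ∈ s, √2 ^ p ≤ ∑ p ∈ Finset.range (s.max' hne + 1), √2 ^ p := by
          refine Finset.sum_le_sum_of_subset_of_nonneg ?_ fun _ _ _ => by positivity
          intro p hp
          exact Finset.mem_range.2 (Nat.lt_succ_iff.2 (s.le_max' p hp))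
      _ ≤ 4 * √2 ^ s.max' hne := sum_range_sqrt_two_pow_le _
      _ ≤ 4 * y := by
          gcongr
          exact hs _ (s.max'_mem hne)

theorem sum_dyadicSizes_ratio_le {B y : ℝ} (hy : 0 ≤ y) (P : ℕ → Prop) (K : Finset (ℕ × ℕ))
    (hK : ∀ k ∈ K, P k.2 ∧ √2 ^ k.1 ≤ y * √2 ^ k.2) :
    ∑ k ∈ K.filter (fun k => k ∈ dyadicSizes B), √2 ^ k.1 / √2 ^ k.2 ≤
      4 * y * ((Finset.range (topExponent B + 1)).filter P).card := by
  calc ∑ k ∈ K.filter (fun k => k ∈ dyadicSizes B), √2 ^ k.1 / √2 ^ k.2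
      ≤ ∑ k ∈ (dyadicSizes B).filter (fun k => P k.2 ∧ √2 ^ k.1 ≤ y * √2 ^ k.2),
          √2 ^ k.1 / √2 ^ k.2 := by
        refine Finset.sum_le_sum_of_subset_of_nonneg ?_ fun _ _ _ => by positivity
        intro k hk
        obtain ⟨hk, hkB⟩ := Finset.mem_filter.1 hk
        exact Finset.mem_filter.2 ⟨hkB, hK k hk⟩
    _ = ∑ q ∈ Finset.range (topExponent B + 1), ∑ p ∈ Finset.range (q + 1),
          if P q ∧ √2 ^ p ≤ y * √2 ^ q then √2 ^ p / √2 ^ q else 0 := by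
        rw [Finset.sum_filter, sum_dyadicSizes_eq]
    _ ≤ ∑ q ∈ Finset.range (topExponent B + 1), if P q then 4 * y else 0 := by
        refine Finset.sum_le_sum fun q _ => ?_
        by_cases hq : P q
        · simp only [hq, true_and, if_true]
          rw [← Finset.sum_filter, ← Finset.sum_div, div_le_iff₀ (by positivity), mul_assoc]
          exact sum_sqrt_two_pow_le (by positivity) fun p hp => (Finset.mem_filter.1 hp).2
        · simp [hq]
    _ = _ := by
        rw [← Finset.sum_filter, Finset.sum_const, nsmul_eq_mul, mul_comm]

/-- The pairs `(a, b)` to be summed over. -/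
def IsAdmissible (B : ℝ) (x : ℤ × ℤ) : Prop :=
  0 < x.1 ∧ 0 < x.2 ∧ IsCoprime x.1 x.2 ∧ x.1 ≠ x.2 ∧ ((max x.1 x.2 : ℤ) : ℝ) ≤ √B

theorem IsAdmissible.size_bounds {B : ℝ} {x : ℤ × ℤ} (hx : IsAdmissible B x) :
    (2 : ℝ) ^ (dyadicSize x).1 ≤ ((|x.1 - x.2| : ℤ) : ℝ) ∧
    ((|x.1 - x.2| : ℤ) : ℝ) < 2 ^ ((dyadicSize x).1 + 1) ∧
    (2 : ℝ) ^ (dyadicSize x).2 ≤ ((x.1 + x.2 : ℤ) : ℝ) ∧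
    ((x.1 + x.2 : ℤ) : ℝ) < 2 ^ ((dyadicSize x).2 + 1) ∧
    (dyadicSize x).1 ≤ (dyadicSize x).2 := by
  obtain ⟨h1, h2, -, hne, -⟩ := hx
  have hv := two_pow_log_natAbs_le (add_pos h1 h2).ne'
  have hu := two_pow_log_natAbs_le (sub_ne_zero.2 hne)
  rw [abs_of_pos (add_pos h1 h2)] at hv
  refine ⟨by exact_mod_cast hu.1, by exact_mod_cast hu.2, by exact_mod_cast hv.1,
    by exact_mod_cast hv.2, ?_⟩
  simp only [dyadicSize]
  refine Nat.log_mono_right ?_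
  omega

/-- `sum_conicBound_le` without a restriction on the ratio `|a - b| / (a + b)`. -/
theorem sum_conicBound_le_of_ratio {Y B y : ℝ} (hB : 16 ≤ B) (hY : 0 ≤ Y) (hYB : Y ≤ B) (i j : ℕ)
    (hy : 0 ≤ y) (P : ℕ → Prop) (X : Finset (ℤ × ℤ))
    (hX : ∀ x ∈ X, IsAdmissible B x ∧ (2 : ℤ) ^ i ∣ x.1 - x.2 ∧ (2 : ℤ) ^ j ∣ x.1 + x.2 ∧
      P (dyadicSize x).2 ∧ √2 ^ (dyadicSize x).1 ≤ y * √2 ^ (dyadicSize x).2) :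
    ∑ x ∈ X, conicBound Y x ≤ 400000 * ((i + 1) * (j + 1)) *
      (36 * B * Real.log B ^ 3 + Y * Real.log B ^ 3 / 2 ^ (i + j) *
        (8 * y * ((Finset.range (topExponent B + 1)).filter P).card)) := by
  have hL2 : 27 / 10 ≤ Real.log B := log_ge_of_sixteen_le hB
  have h := sum_conicBound_le hB hY hYB i j (X.image dyadicSize) (t₀ := fun _ => 0)
    (l := fun k => 2 * 2 ^ k.1 / 2 ^ k.2) (fun k _ => ⟨by positivity, le_rfl⟩) X (by
      intro x hx
      obtain ⟨hA, hi, hj, -, -⟩ := hX x hx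
      obtain ⟨b1, b2, b3, b4, b5⟩ := hA.size_bounds
      obtain ⟨h1, h2, hc, hne, hm⟩ := hA
      have hv : (0 : ℝ) < ((x.1 + x.2 : ℤ) : ℝ) := by exact_mod_cast add_pos h1 h2
      refine ⟨h1, h2, hc, hne, hm, hi, hj, Finset.mem_image_of_mem _ hx, ?_, ?_⟩
      · exact div_nonneg (by exact_mod_cast abs_nonneg _) hv.le
      · rw [zero_add]
        rw [pow_succ, mul_comm] at b2
        gcongr)
  refine h.trans ?_
  gcongr
  have e : ∀ k : ℕ × ℕ, 2 * (2 : ℝ) ^ k.1 / 2 ^ k.2 * (√2 ^ k.2 / √2 ^ k.1) =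
      2 * (√2 ^ k.1 / √2 ^ k.2) := by
    intro k
    rw [← sqrt_two_pow_sq, ← sqrt_two_pow_sq]
    field_simp
  refine (Finset.sum_congr rfl fun k _ => e k).trans_le ?_
  rw [← Finset.mul_sum]
  have := sum_dyadicSizes_ratio_le (B := B) hy P (X.image dyadicSize) (by
    intro k hk
    obtain ⟨x, hx, rfl⟩ := Finset.mem_image.1 hk
    exact (hX x hx).2.2.2)
  linarith

theorem sum_conicBound_le_of_dvd {Y B : ℝ} (hB : 16 ≤ B) (hY : 0 ≤ Y) (hYB : Y ≤ B) (i j : ℕ)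
    (X : Finset (ℤ × ℤ)) (hX : ∀ x ∈ X, IsAdmissible B x ∧ (2 : ℤ) ^ i ∣ x.1 - x.2 ∧
      (2 : ℤ) ^ j ∣ x.1 + x.2) :
    ∑ x ∈ X, conicBound Y x ≤ 400000 * ((i + 1) * (j + 1)) *
      (36 * B * Real.log B ^ 3 + Y * Real.log B ^ 3 / 2 ^ (i + j) * (16 * Real.log B)) := by
  have hL2 : 27 / 10 ≤ Real.log B := log_ge_of_sixteen_le hB
  refine (sum_conicBound_le_of_ratio hB hY hYB i j zero_le_one (fun _ => True) X
    fun x hx => ?_).trans ?_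
  · obtain ⟨hA, hi, hj⟩ := hX x hx
    refine ⟨hA, hi, hj, trivial, ?_⟩
    rw [one_mul]
    exact pow_le_pow_right₀ (Real.one_le_sqrt.2 (by norm_num)) hA.size_bounds.2.2.2.2
  · gcongr _ * (_ + _ * ?_)
    have := topExponent_add_one_le hB
    rw [Finset.filter_true, Finset.card_range]
    push_cast
    linarith

theorem card_filter_topExponent_le {B : ℝ} (hB : 16 ≤ B) :
    (((Finset.range (topExponent B + 1)).filter (fun q : ℕ =>
      √B / B ^ (1 / Real.log (Real.log B)) ≤ 2 ^ (q + 1))).card : ℝ) ≤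
      5 * (Real.log B / Real.log (Real.log B)) := by
  have hZ := one_le_log_log hB
  have hL := log_ge_of_sixteen_le hB
  have hLZ : 1 ≤ Real.log B / Real.log (Real.log B) :=
    (one_le_div (by linarith)).2 (log_log_le_log hB)
  set s := (Finset.range (topExponent B + 1)).filter (fun q : ℕ =>
      √B / B ^ (1 / Real.log (Real.log B)) ≤ 2 ^ (q + 1)) with hs
  rcases s.eq_empty_or_nonempty with h | hne
  · rw [h]
    simp only [Finset.card_empty, Nat.cast_zero]
    linarith
  have hB0 : 0 < B := by linarith
  have hq := (Finset.mem_filter.1 (s.min'_mem hne))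
  set q := s.min' hne with hqdef
  have hcard : s.card ≤ (Finset.Icc q (topExponent B)).card := by
    apply Finset.card_le_card
    intro r hr
    exact Finset.mem_Icc.2 ⟨s.min'_le r hr,
      Nat.lt_succ_iff.1 (Finset.mem_range.1 (Finset.mem_filter.1 hr).1)⟩
  rw [Nat.card_Icc] at hcard
  have hqN : q ≤ topExponent B + 1 := (Finset.mem_range.1 hq.1).le
  have hcard' : (s.card : ℝ) ≤ topExponent B + 1 - q := by
    have : (s.card : ℝ) ≤ ((topExponent B + 1 - q : ℕ) : ℝ) := by exact_mod_cast hcard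
    rw [Nat.cast_sub hqN] at this
    push_cast at this
    exact this
  have h1 := Real.log_le_log (by positivity) hq.2
  rw [Real.log_div (by positivity) (by positivity), Real.log_sqrt hB0.le, Real.log_rpow hB0,
    Real.log_pow] at h1
  have h2 := Real.log_le_log (by positivity) ((le_topExponent_iff hB).1 le_rfl)
  rw [Real.log_mul (by norm_num) (by positivity), Real.log_sqrt hB0.le, Real.log_pow] at h2
  have e : 1 / Real.log (Real.log B) * Real.log B = Real.log B / Real.log (Real.log B) := by ring
  rw [e] at h1
  push_cast at h1
  have h3 : ((topExponent B : ℝ) + 1 - q) * Real.log 2 ≤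
      3 * Real.log 2 + Real.log B / Real.log (Real.log B) := by linarith
  nlinarith only [h3, hcard', hLZ, Real.log_two_gt_d9]

theorem two_pow_dvd_sub_or_add {a b : ℤ} (hab : IsCoprime a b) {i : ℕ}
    (h : (2 : ℤ) ^ (i + 1) ∣ a ^ 2 - b ^ 2) : (2 : ℤ) ^ i ∣ a - b ∨ (2 : ℤ) ^ i ∣ a + b := by
  have h2 : (2 : ℤ) ∣ (a - b) * (a + b) := by
    have := (Dvd.intro_left ((2 : ℤ) ^ i) (pow_succ (2 : ℤ) i).symm).trans h
    exact this.trans ⟨1, by ring⟩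
  have hsub : (2 : ℤ) ∣ a - b := by
    rcases Int.prime_two.dvd_or_dvd h2 with h | h
    · exact h
    · omega
  obtain ⟨s, hs⟩ := hsub
  obtain ⟨t, ht⟩ : (2 : ℤ) ∣ a + b := ⟨s + b, by linarith⟩
  have hodd : ¬ ((2 : ℤ) ∣ s ∧ (2 : ℤ) ∣ t) := by
    rintro ⟨h3, h4⟩
    have ha : (2 : ℤ) ∣ a := by omega
    have hb : (2 : ℤ) ∣ b := by omega
    exact Int.prime_two.not_isUnit (hab.isUnit_of_dvd' ha hb)
  have h5 : (2 : ℤ) ^ i ∣ 2 * s * t := by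
    have : (2 : ℤ) ^ (i + 1) ∣ 2 * (2 * s * t) := by
      refine h.trans ⟨1, ?_⟩
      linear_combination (-(a + b)) * hs - 2 * s * ht
    rw [pow_succ, mul_comm] at this
    exact (mul_dvd_mul_iff_left two_ne_zero).1 this
  have hcop : ∀ z : ℤ, ¬ (2 : ℤ) ∣ z → IsCoprime ((2 : ℤ) ^ i) z := fun z hz =>
    IsCoprime.pow_left ((Prime.coprime_iff_not_dvd Int.prime_two).2 hz)
  by_cases hsd : (2 : ℤ) ∣ t
  · right
    rw [ht]
    have : ¬ (2 : ℤ) ∣ s := fun h => hodd ⟨h, hsd⟩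
    exact (hcop s this).dvd_of_dvd_mul_right (h5.trans ⟨1, by ring⟩)
  · left
    rw [hs]
    exact (hcop t hsd).dvd_of_dvd_mul_right h5

theorem succ_sq_le_four_mul_two_pow (i : ℕ) : ((i : ℝ) + 1) ^ 2 ≤ 4 * 2 ^ i := by
  have : (i + 1) ^ 2 ≤ 4 * 2 ^ i := by
    induction i with
    | zero => norm_num
    | succ n ih =>
      rcases Nat.lt_or_ge n 2 with h | h
      · interval_cases n <;> norm_num
      · rw [pow_succ 2 n]
        nlinarith
  exact_mod_cast this

theorem IsAdmissible.max_bounds {B : ℝ} {x : ℤ × ℤ} (hx : IsAdmissible B x) :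
    (1 : ℝ) ≤ ((max x.1 x.2 : ℤ) : ℝ) ∧ ((max x.1 x.2 : ℤ) : ℝ) ≤ ((x.1 + x.2 : ℤ) : ℝ) := by
  obtain ⟨h1, h2, -⟩ := hx
  constructor
  · exact_mod_cast (show (1 : ℤ) ≤ max x.1 x.2 from h1.trans_le (le_max_left _ _))
  · exact_mod_cast max_le (by linarith) (by linarith)

theorem sum_conicBound_large_le {B : ℝ} (hB : 16 ≤ B) (X : Finset (ℤ × ℤ))
    (hX : ∀ x ∈ X, IsAdmissible B x ∧
      √B / B ^ (1 / Real.log (Real.log B)) ≤ ((max x.1 x.2 : ℤ) : ℝ)) :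
    ∑ x ∈ X, conicBound B x ≤
      32000000 * (B * Real.log B ^ 4 / Real.log (Real.log B)) := by
  have hL := log_ge_of_sixteen_le hB
  have h := sum_conicBound_le_of_ratio hB (by linarith) le_rfl 0 0 zero_le_one (fun q : ℕ =>
      √B / B ^ (1 / Real.log (Real.log B)) ≤ 2 ^ (q + 1)) X (by
    intro x hx
    obtain ⟨hA, hm⟩ := hX x hx
    obtain ⟨-, -, -, b4, b5⟩ := hA.size_bounds
    refine ⟨hA, by simp, by simp, by linarith [hA.max_bounds.2], ?_⟩
    rw [one_mul]
    exact pow_le_pow_right₀ (Real.one_le_sqrt.2 (by norm_num)) b5)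
  refine h.trans ?_
  have h3 := mul_log_pow_three_le hB
  calc _ ≤ 400000 * (((0 : ℕ) + 1 : ℝ) * ((0 : ℕ) + 1)) * (36 * B * Real.log B ^ 3 +
        B * Real.log B ^ 3 / 2 ^ (0 + 0) *
        (8 * 1 * (5 * (Real.log B / Real.log (Real.log B))))) := by
        gcongr
        exact card_filter_topExponent_le hB
    _ = 14400000 * (B * Real.log B ^ 3) +
        16000000 * (B * Real.log B ^ 4 / Real.log (Real.log B)) := by
        norm_num
        ring
    _ ≤ _ := by
      have : 0 ≤ B * Real.log B ^ 3 := by positivity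
      linarith

theorem sum_conicBound_close_le {B : ℝ} (hB : 16 ≤ B) (X : Finset (ℤ × ℤ))
    (hX : ∀ x ∈ X, IsAdmissible B x ∧
      Real.log (Real.log B) ^ 2 * ((|x.1 - x.2| : ℤ) : ℝ) ≤ 4 * ((max x.1 x.2 : ℤ) : ℝ)) :
    ∑ x ∈ X, conicBound B x ≤
      34000000 * (B * Real.log B ^ 4 / Real.log (Real.log B)) := by
  have hL := log_ge_of_sixteen_le hB
  have hZ := one_le_log_log hB
  have h := sum_conicBound_le_of_ratio hB (by linarith) le_rfl 0 0
      (y := 3 / Real.log (Real.log B)) (by positivity) (fun _ => True) X (by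
    intro x hx
    obtain ⟨hA, hm⟩ := hX x hx
    obtain ⟨b1, b2, b3, b4, b5⟩ := hA.size_bounds
    refine ⟨hA, by simp, by simp, trivial, ?_⟩
    rw [div_mul_eq_mul_div, le_div_iff₀ (by positivity)]
    apply le_of_sq_le_sq _ (by positivity)
    rw [mul_pow, mul_pow, sqrt_two_pow_sq, sqrt_two_pow_sq]
    rw [pow_succ] at b4
    have hmax := hA.max_bounds.2
    calc (2 : ℝ) ^ (dyadicSize x).1 * Real.log (Real.log B) ^ 2
        ≤ ((|x.1 - x.2| : ℤ) : ℝ) * Real.log (Real.log B) ^ 2 := by gcongr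
      _ ≤ 4 * (2 ^ (dyadicSize x).2 * 2) := by linarith
      _ ≤ _ := by
        have : (0 : ℝ) < 2 ^ (dyadicSize x).2 := by positivity
        linarith)
  refine h.trans ?_
  have h3 := mul_log_pow_three_le hB
  calc _ ≤ 400000 * (((0 : ℕ) + 1 : ℝ) * ((0 : ℕ) + 1)) * (36 * B * Real.log B ^ 3 +
        B * Real.log B ^ 3 / 2 ^ (0 + 0) *
        (8 * (3 / Real.log (Real.log B)) * (2 * Real.log B))) := by
        gcongr
        have := topExponent_add_one_le hB
        rw [Finset.filter_true, Finset.card_range]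
        push_cast
        linarith
    _ = 14400000 * (B * Real.log B ^ 3) +
        19200000 * (B * Real.log B ^ 4 / Real.log (Real.log B)) := by
        norm_num
        ring
    _ ≤ _ := by
      have : 0 ≤ B * Real.log B ^ 3 := by positivity
      linarith

theorem sum_conicBound_unbalanced_le {B : ℝ} (hB : 16 ≤ B) (X : Finset (ℤ × ℤ))
    (hX : ∀ x ∈ X, IsAdmissible B x ∧
      4 * ((max x.1 x.2 : ℤ) : ℝ) < Real.log (Real.log B) ^ 2 * ((|x.1 - x.2| : ℤ) : ℝ) ∧
      Real.log (Real.log B) ^ 2 * ((min x.1 x.2 : ℤ) : ℝ) < ((max x.1 x.2 : ℤ) : ℝ)) :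
    ∑ x ∈ X, conicBound B x ≤
      34000000 * (B * Real.log B ^ 4 / Real.log (Real.log B)) := by
  have hL := log_ge_of_sixteen_le hB
  have hZ := one_le_log_log hB
  set Z := Real.log (Real.log B) with hZdef
  have key : ∀ x ∈ X, 4 < Z ^ 2 ∧ (2 : ℝ) ^ (dyadicSize x).2 ≤ 2 * 2 ^ (dyadicSize x).1 ∧
      1 - 2 / Z ^ 2 ≤ (|x.1 - x.2| : ℤ) / ((x.1 + x.2 : ℤ) : ℝ) ∧
      (|x.1 - x.2| : ℤ) / ((x.1 + x.2 : ℤ) : ℝ) ≤ 1 := by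
    intro x hx
    obtain ⟨hA, h4, hmin⟩ := hX x hx
    obtain ⟨b1, b2, b3, b4, b5⟩ := hA.size_bounds
    obtain ⟨m1, m2⟩ := hA.max_bounds
    have hmin0 : (1 : ℝ) ≤ ((min x.1 x.2 : ℤ) : ℝ) := by
      exact_mod_cast (show (1 : ℤ) ≤ min x.1 x.2 from le_min hA.1 hA.2.1)
    have hu : ((|x.1 - x.2| : ℤ) : ℝ) = ((max x.1 x.2 : ℤ) : ℝ) - ((min x.1 x.2 : ℤ) : ℝ) := by
      rw [← Int.cast_sub, max_sub_min_eq_abs']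
    have hv : ((x.1 + x.2 : ℤ) : ℝ) = ((max x.1 x.2 : ℤ) : ℝ) + ((min x.1 x.2 : ℤ) : ℝ) := by
      rw [← Int.cast_add, max_add_min]
    rw [hu] at h4 b2
    rw [hv] at m2 b3
    rw [hu, hv]
    set m := ((max x.1 x.2 : ℤ) : ℝ)
    set n := ((min x.1 x.2 : ℤ) : ℝ)
    have hZ4 : 4 < Z ^ 2 := by
      by_contra hcon
      push Not at hcon
      have : Z ^ 2 * (m - n) ≤ 4 * (m - n) := by
        apply mul_le_mul_of_nonneg_right hcon
        have : 0 ≤ Z ^ 2 * (m - n) := by linarith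
        exact nonneg_of_mul_nonneg_right this (by positivity)
      linarith
    have hn4 : 4 * n < m := by
      have : 4 * n ≤ Z ^ 2 * n := by gcongr
      linarith
    refine ⟨hZ4, ?_, ?_, ?_⟩
    · rw [pow_succ] at b2
      have h2 : (2 : ℝ) ^ (dyadicSize x).2 < 4 * 2 ^ (dyadicSize x).1 := by linarith
      have h3 : (2 : ℝ) ^ (dyadicSize x).2 < 2 ^ ((dyadicSize x).1 + 2) := by
        rw [pow_add]; linarith
      have h4 := (pow_lt_pow_iff_right₀ (by norm_num : (1 : ℝ) < 2)).1 h3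
      calc (2 : ℝ) ^ (dyadicSize x).2 ≤ 2 ^ ((dyadicSize x).1 + 1) :=
            pow_le_pow_right₀ (by norm_num) (by omega)
        _ = _ := by rw [pow_succ]; ring
    · rw [le_div_iff₀ (by linarith)]
      have : 2 * n ≤ 2 / Z ^ 2 * (m + n) := by
        rw [div_mul_eq_mul_div, le_div_iff₀ (by positivity)]
        linarith
      linarith
    · rw [div_le_one (by linarith)]
      linarith
  have hk : ∀ k ∈ X.image dyadicSize, 4 < Z ^ 2 ∧ (2 : ℝ) ^ k.2 ≤ 2 * 2 ^ k.1 ∧ k.1 ≤ k.2 := by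
    intro k hk
    obtain ⟨x, hx, rfl⟩ := Finset.mem_image.1 hk
    exact ⟨(key x hx).1, (key x hx).2.1, (hX x hx).1.size_bounds.2.2.2.2⟩
  have h := sum_conicBound_le hB (by linarith) le_rfl 0 0 (X.image dyadicSize)
    (t₀ := fun _ => 1 - 2 / Z ^ 2) (l := fun _ => 2 / Z ^ 2) (by
      intro k hkX
      obtain ⟨h4, h2, -⟩ := hk k hkX
      refine ⟨by positivity, ?_⟩
      rw [div_le_div_iff₀ (by positivity) (by positivity)]
      have : (0 : ℝ) < 2 ^ k.1 := by positivity
      nlinarith) X (by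
      intro x hx
      obtain ⟨-, -, k3, k4⟩ := key x hx
      obtain ⟨⟨h1, h2, hc, hne, hm⟩, -, -⟩ := hX x hx
      exact ⟨h1, h2, hc, hne, hm, by simp, by simp, Finset.mem_image_of_mem _ hx, k3,
        by linarith⟩)
  refine h.trans ?_
  have h3 := mul_log_pow_three_le hB
  have hsum : ∑ k ∈ (X.image dyadicSize).filter (fun k => k ∈ dyadicSizes B),
      2 / Z ^ 2 * (√2 ^ k.2 / √2 ^ k.1) ≤ 32 * (Real.log B / Z) := by
    have hr := sum_dyadicSizes_ratio_le (B := B) zero_le_one (fun _ => True) (X.image dyadicSize) (by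
      intro k hkX
      rw [one_mul]
      exact ⟨trivial, pow_le_pow_right₀ (Real.one_le_sqrt.2 (by norm_num)) (hk k hkX).2.2⟩)
    calc _ ≤ ∑ k ∈ (X.image dyadicSize).filter (fun k => k ∈ dyadicSizes B),
          2 / Z * (2 * (√2 ^ k.1 / √2 ^ k.2)) := by
          refine Finset.sum_le_sum fun k hkX => ?_
          have h2 := (hk k (Finset.mem_filter.1 hkX).1).2.1
          rw [← sqrt_two_pow_sq, ← sqrt_two_pow_sq] at h2
          have hZZ : 2 / Z ^ 2 ≤ 2 / Z := by
            have : Z ≤ Z ^ 2 := le_self_pow₀ hZ (by norm_num)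
            gcongr
          have : √2 ^ k.2 / √2 ^ k.1 ≤ 2 * (√2 ^ k.1 / √2 ^ k.2) := by
            rw [mul_div_assoc', div_le_div_iff₀ (by positivity) (by positivity)]
            linarith
          gcongr
      _ = 4 / Z * ∑ k ∈ (X.image dyadicSize).filter (fun k => k ∈ dyadicSizes B),
          √2 ^ k.1 / √2 ^ k.2 := by
          rw [Finset.mul_sum]
          exact Finset.sum_congr rfl fun k _ => by ring
      _ ≤ 4 / Z * (4 * 1 * (2 * Real.log B)) := by
          refine mul_le_mul_of_nonneg_left (hr.trans ?_) (by positivity)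
          have := topExponent_add_one_le hB
          rw [Finset.filter_true, Finset.card_range]
          push_cast
          linarith
      _ = _ := by ring
  calc _ ≤ 400000 * (((0 : ℕ) + 1 : ℝ) * ((0 : ℕ) + 1)) * (36 * B * Real.log B ^ 3 +
        B * Real.log B ^ 3 / 2 ^ (0 + 0) * (32 * (Real.log B / Z))) := by
        gcongr
    _ = 14400000 * (B * Real.log B ^ 3) + 12800000 * (B * Real.log B ^ 4 / Z) := by
        norm_num
        ring
    _ ≤ _ := by
      have : 0 ≤ B * Real.log B ^ 3 := by positivity
      linarith

theorem sum_conicBound_two_adic_le {B : ℝ} (hB : 16 ≤ B) (X : Finset (ℤ × ℤ))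
    (hX : ∀ x ∈ X, IsAdmissible B x ∧
      Real.log (Real.log B) < (padicValInt 2 (x.1 ^ 2 - x.2 ^ 2) : ℝ)) :
    ∑ x ∈ X, conicBound B x ≤
      170000000 * (B * Real.log B ^ 4 / Real.log (Real.log B)) := by
  have hL := log_ge_of_sixteen_le hB
  have hZ := one_le_log_log hB
  have hZ2 := log_log_sq_le hB
  set Z := Real.log (Real.log B) with hZdef
  obtain ⟨i, hi⟩ : ∃ i : ℕ, i + 1 = ⌈Z⌉₊ :=
    ⟨⌈Z⌉₊ - 1, Nat.sub_add_cancel (Nat.ceil_pos.2 (by linarith))⟩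
  have hi1 : Z ≤ (i : ℝ) + 1 := by
    have := Nat.le_ceil Z
    rw [← hi] at this
    exact_mod_cast this
  have hi2 : (i : ℝ) + 1 ≤ 2 * Z := by
    have := Nat.ceil_lt_add_one (zero_le_one.trans hZ)
    rw [← hi] at this
    push_cast at this
    linarith
  have hcov : X ⊆ X.filter (fun x => (2 : ℤ) ^ i ∣ x.1 - x.2) ∪
      X.filter (fun x => (2 : ℤ) ^ i ∣ x.1 + x.2) := by
    intro x hx
    obtain ⟨hA, hν⟩ := hX x hx
    have h1 : i + 1 ≤ padicValInt 2 (x.1 ^ 2 - x.2 ^ 2) := by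
      rw [hi]
      exact Nat.ceil_le.2 hν.le
    have h2 : (2 : ℤ) ^ padicValInt 2 (x.1 ^ 2 - x.2 ^ 2) ∣ x.1 ^ 2 - x.2 ^ 2 :=
      padicValInt_dvd (p := 2) _
    replace h2 := (pow_dvd_pow 2 h1).trans h2
    rcases two_pow_dvd_sub_or_add hA.2.2.1 h2 with h | h
    · exact Finset.mem_union_left _ (Finset.mem_filter.2 ⟨hx, h⟩)
    · exact Finset.mem_union_right _ (Finset.mem_filter.2 ⟨hx, h⟩)
  have hpos : ∀ x ∈ X, 0 ≤ conicBound B x := by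
    intro x hx
    obtain ⟨m1, m2⟩ := (hX x hx).1.max_bounds
    have : 0 ≤ B := by linarith
    unfold conicBound
    refine mul_nonneg (Nat.cast_nonneg _) ?_
    positivity
  have e1 := sum_conicBound_le_of_dvd hB (by linarith) le_rfl i 0
    (X.filter (fun x => (2 : ℤ) ^ i ∣ x.1 - x.2)) (by
      intro x hx
      obtain ⟨hx, h⟩ := Finset.mem_filter.1 hx
      exact ⟨(hX x hx).1, h, by simp⟩)
  have e2 := sum_conicBound_le_of_dvd hB (by linarith) le_rfl 0 i
    (X.filter (fun x => (2 : ℤ) ^ i ∣ x.1 + x.2)) (by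
      intro x hx
      obtain ⟨hx, h⟩ := Finset.mem_filter.1 hx
      exact ⟨(hX x hx).1, by simp, h⟩)
  have hsum : ∑ x ∈ X, conicBound B x ≤
      ∑ x ∈ X.filter (fun x => (2 : ℤ) ^ i ∣ x.1 - x.2), conicBound B x +
      ∑ x ∈ X.filter (fun x => (2 : ℤ) ^ i ∣ x.1 + x.2), conicBound B x := by
    rw [← Finset.sum_union_inter]
    refine (Finset.sum_le_sum_of_subset_of_nonneg hcov fun x hx _ => ?_).trans
      (le_add_of_nonneg_right (Finset.sum_nonneg fun x hx => ?_))
    · rcases Finset.mem_union.1 hx with h | h <;> exact hpos x (Finset.mem_filter.1 h).1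
    · exact hpos x (Finset.mem_filter.1 (Finset.mem_inter.1 hx).1).1
  have f1 : ((i : ℝ) + 1) * Real.log B ^ 3 ≤ 4 * (Real.log B ^ 4 / Z) := by
    rw [mul_div_assoc', le_div_iff₀ (by linarith)]
    calc ((i : ℝ) + 1) * Real.log B ^ 3 * Z ≤ 2 * Z * Real.log B ^ 3 * Z := by gcongr
      _ = 2 * Real.log B ^ 3 * Z ^ 2 := by ring
      _ ≤ 2 * Real.log B ^ 3 * (2 * Real.log B) := by gcongr
      _ = _ := by ring
  have f2 : ((i : ℝ) + 1) / 2 ^ i ≤ 4 / Z := by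
    rw [div_le_div_iff₀ (by positivity) (by linarith)]
    have := succ_sq_le_four_mul_two_pow i
    nlinarith
  have f3 : ((i : ℝ) + 1) * (36 * B * Real.log B ^ 3 + B * Real.log B ^ 3 / 2 ^ i *
      (16 * Real.log B)) ≤ 208 * (B * Real.log B ^ 4 / Z) := by
    calc _ = 36 * (B * (((i : ℝ) + 1) * Real.log B ^ 3)) +
          16 * (B * (((i : ℝ) + 1) / 2 ^ i * Real.log B ^ 4)) := by ring
      _ ≤ 36 * (B * (4 * (Real.log B ^ 4 / Z))) + 16 * (B * (4 / Z * Real.log B ^ 4)) := by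
          gcongr
      _ = _ := by ring
  have f4 : 0 ≤ B * Real.log B ^ 4 / Z := by positivity
  norm_num [mul_assoc] at e1 e2 f3
  linarith

theorem card_conic_le_conicBound {B : ℝ} {x : ℤ × ℤ} (hx : IsAdmissible B x) {X Y : ℝ}
    (hX : 0 < X) (hXY : X * ((max x.1 x.2 : ℤ) : ℝ) ≤ Y) (S : Finset (ℤ × ℤ × ℤ))
    (hS : ∀ p ∈ S, 0 < p.1 ∧ 0 < p.2.1 ∧ 0 < p.2.2 ∧
      (x.1 ^ 2 - x.2 ^ 2) * p.1 ^ 2 + (x.1 ^ 2 + x.2 ^ 2) * p.2.1 ^ 2 = 2 * p.2.2 ^ 2 ∧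
      Int.gcd p.1 p.2.1 = 1 ∧ (p.1 : ℝ) ≤ X ∧ (p.2.1 : ℝ) ≤ X) :
    (S.card : ℝ) ≤ conicBound Y x := by
  obtain ⟨m1, m2⟩ := hx.max_bounds
  obtain ⟨h1, h2, hc, hne, -⟩ := hx
  refine (card_conic_le h1 h2 hc hne hX S hS).trans ?_
  unfold conicBound divisorWeight
  have hα : (x.1 ^ 2 - x.2 ^ 2).natAbs.divisors.card ≤
      (x.1 - x.2).natAbs.divisors.card * (x.1 + x.2).natAbs.divisors.card := by
    rw [show x.1 ^ 2 - x.2 ^ 2 = (x.1 - x.2) * (x.1 + x.2) by ring, Int.natAbs_mul]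
    exact Nat.card_divisors_mul_le _ _
  have hXY' : X ≤ Y / ((max x.1 x.2 : ℤ) : ℝ) := (le_div_iff₀ (by linarith)).2 hXY
  rw [Nat.cast_mul, Nat.cast_mul]
  gcongr
  exact_mod_cast hα

theorem Mcount_le_conicBound {B : ℝ} (hB : 16 ≤ B) {x : ℤ × ℤ} (hx : IsAdmissible B x) :
    (Mcount x.1 x.2 B : ℝ) ≤ conicBound B x := by
  obtain ⟨m1, m2⟩ := hx.max_bounds
  have hB0 : 0 < B := by linarith
  rw [Mcount]
  set s := {p : ℤ × ℤ × ℤ | 0 < p.1 ∧ 0 < p.2.1 ∧ 0 < p.2.2 ∧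
    (x.1 ^ 2 - x.2 ^ 2) * p.1 ^ 2 + (x.1 ^ 2 + x.2 ^ 2) * p.2.1 ^ 2 = 2 * p.2.2 ^ 2 ∧
    Int.gcd p.1 p.2.1 = 1 ∧
    ((max x.1 x.2 : ℤ) : ℝ) * ((max p.1 p.2.1 : ℤ) : ℝ) ≤ B} with hs
  by_cases hfin : s.Finite
  · rw [Set.ncard_eq_toFinset_card s hfin]
    have hm0 : (0 : ℝ) < ((max x.1 x.2 : ℤ) : ℝ) := by linarith
    refine card_conic_le_conicBound hx (X := B / ((max x.1 x.2 : ℤ) : ℝ)) (by positivity)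
      (div_mul_cancel₀ _ hm0.ne').le _ fun p hp => ?_
    obtain ⟨p1, p2, p3, p4, p5, p6⟩ := (Set.Finite.mem_toFinset hfin).1 hp
    have h : ((max p.1 p.2.1 : ℤ) : ℝ) ≤ B / ((max x.1 x.2 : ℤ) : ℝ) := by
      rw [le_div_iff₀ hm0]; linarith
    exact ⟨p1, p2, p3, p4, p5, le_trans (by exact_mod_cast le_max_left _ _) h,
      le_trans (by exact_mod_cast le_max_right _ _) h⟩
  · rw [Set.Infinite.ncard hfin]
    unfold conicBound
    refine le_trans (le_of_eq Nat.cast_zero) (mul_nonneg (Nat.cast_nonneg _) ?_)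
    positivity

/-- The coprime pairs of positive integers up to `√B` other than `(1, 1)`. -/
noncomputable def coprimePairs (B : ℝ) : Finset (ℤ × ℤ) :=
  (Finset.Icc 1 ⌊√B⌋ ×ˢ Finset.Icc 1 ⌊√B⌋).filter (fun q => Int.gcd q.1 q.2 = 1 ∧ q.1 * q.2 ≠ 1)

/-- The size, balance and `2`-adic conditions cutting out the main range of pairs. -/
def IsTypical (B : ℝ) (q : ℤ × ℤ) : Prop :=
  ((max q.1 q.2 : ℤ) : ℝ) < √B / B ^ (1 / Real.log (Real.log B)) ∧
  ((max q.1 q.2 : ℤ) : ℝ) ≤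
    Real.log (Real.log B) ^ 2 * ((min q.1 (min q.2 |q.1 - q.2|) : ℤ) : ℝ) ∧
  (padicValInt 2 (q.1 ^ 2 - q.2 ^ 2) : ℝ) ≤ Real.log (Real.log B)

theorem isAdmissible_of_mem_coprimePairs {B : ℝ} {q : ℤ × ℤ} (hq : q ∈ coprimePairs B) :
    IsAdmissible B q := by
  simp only [coprimePairs, Finset.mem_filter, Finset.mem_product, Finset.mem_Icc] at hq
  obtain ⟨⟨⟨h1, h2⟩, h3, h4⟩, h5, h6⟩ := hq
  refine ⟨h1, h3, Int.isCoprime_iff_gcd_eq_one.2 h5, fun h => h6 ?_, Int.le_floor.1 (max_le h2 h4)⟩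
  rw [h, Int.gcd_self] at h5
  have : q.2 = 1 := by omega
  rw [h, this, one_mul]

theorem card_coprimePairs_le {B : ℝ} (hB : 0 ≤ B) : ((coprimePairs B).card : ℝ) ≤ B := by
  have h := Finset.card_filter_le (Finset.Icc 1 ⌊√B⌋ ×ˢ Finset.Icc 1 ⌊√B⌋)
    (fun q : ℤ × ℤ => Int.gcd q.1 q.2 = 1 ∧ q.1 * q.2 ≠ 1)
  rw [Finset.card_product, Int.card_Icc, add_sub_cancel_right] at h
  have h2 : ((⌊√B⌋.toNat : ℕ) : ℝ) ≤ √B := by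
    rw [Int.floor_toNat]
    exact Nat.floor_le (Real.sqrt_nonneg B)
  calc ((coprimePairs B).card : ℝ) ≤ ((⌊√B⌋.toNat * ⌊√B⌋.toNat : ℕ) : ℝ) := by exact_mod_cast h
    _ = (⌊√B⌋.toNat : ℝ) * (⌊√B⌋.toNat : ℝ) := Nat.cast_mul _ _
    _ ≤ √B * √B := by gcongr
    _ = B := Real.mul_self_sqrt hB

theorem sum_Mcount_not_isTypical_le {B : ℝ} (hB : 16 ≤ B) :
    ∑ q ∈ (coprimePairs B).filter (fun q => ¬ IsTypical B q), (Mcount q.1 q.2 B : ℝ) ≤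
      270000000 * (B * Real.log B ^ 4 / Real.log (Real.log B)) := by
  set P := coprimePairs B with hP
  set X₁ := P.filter fun x => √B / B ^ (1 / Real.log (Real.log B)) ≤ ((max x.1 x.2 : ℤ) : ℝ)
  set X₂ := P.filter fun x =>
    Real.log (Real.log B) ^ 2 * ((|x.1 - x.2| : ℤ) : ℝ) ≤ 4 * ((max x.1 x.2 : ℤ) : ℝ)
  set X₃ := P.filter fun x =>
    4 * ((max x.1 x.2 : ℤ) : ℝ) < Real.log (Real.log B) ^ 2 * ((|x.1 - x.2| : ℤ) : ℝ) ∧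
      Real.log (Real.log B) ^ 2 * ((min x.1 x.2 : ℤ) : ℝ) < ((max x.1 x.2 : ℤ) : ℝ)
  set X₄ := P.filter fun x =>
    Real.log (Real.log B) < (padicValInt 2 (x.1 ^ 2 - x.2 ^ 2) : ℝ)
  have hadm : ∀ q ∈ P, IsAdmissible B q := fun q => isAdmissible_of_mem_coprimePairs
  have hsub : P.filter (fun q => ¬ IsTypical B q) ⊆ ((X₁ ∪ X₂) ∪ X₃) ∪ X₄ := by
    intro q hq
    obtain ⟨hq, hT⟩ := Finset.mem_filter.1 hq
    simp only [Finset.mem_union, X₁, X₂, X₃, X₄, Finset.mem_filter, hq, true_and]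
    by_contra! hcon
    obtain ⟨⟨⟨h1, h2⟩, h3⟩, h4⟩ := hcon
    refine hT ⟨h1, ?_, h4⟩
    have m1 := (hadm q hq).max_bounds.1
    rcases min_choice q.1 (min q.2 |q.1 - q.2|) with h | h
    · rw [h]
      refine (h3 h2).trans (mul_le_mul_of_nonneg_left ?_ (sq_nonneg _))
      exact_mod_cast min_le_left q.1 q.2
    · rw [h]
      rcases min_choice q.2 |q.1 - q.2| with h | h
      · rw [h]
        refine (h3 h2).trans (mul_le_mul_of_nonneg_left ?_ (sq_nonneg _))
        exact_mod_cast min_le_right q.1 q.2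
      · rw [h]
        linarith
  have hle : ∀ q ∈ P, (Mcount q.1 q.2 B : ℝ) ≤ conicBound B q :=
    fun q hq => Mcount_le_conicBound hB (hadm q hq)
  have hpart : ∀ X ⊆ P, ∑ q ∈ X, (Mcount q.1 q.2 B : ℝ) ≤ ∑ q ∈ X, conicBound B q :=
    fun X hX => Finset.sum_le_sum fun q hq => hle q (hX hq)
  have hunion : ∀ X Y : Finset (ℤ × ℤ), ∑ q ∈ X ∪ Y, (Mcount q.1 q.2 B : ℝ) ≤
      ∑ q ∈ X, (Mcount q.1 q.2 B : ℝ) + ∑ q ∈ Y, (Mcount q.1 q.2 B : ℝ) := by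
    intro X Y
    rw [← Finset.sum_union_inter]
    exact le_add_of_nonneg_right (Finset.sum_nonneg fun q _ => Nat.cast_nonneg _)
  have e0 := Finset.sum_le_sum_of_subset_of_nonneg (f := fun q => (Mcount q.1 q.2 B : ℝ)) hsub
    fun q _ _ => Nat.cast_nonneg _
  have e1 := hunion ((X₁ ∪ X₂) ∪ X₃) X₄
  have e2 := hunion (X₁ ∪ X₂) X₃
  have e3 := hunion X₁ X₂
  have b1 := (hpart X₁ (Finset.filter_subset _ _)).trans (sum_conicBound_large_le hB X₁
    fun x hx => ⟨hadm x (Finset.mem_filter.1 hx).1, (Finset.mem_filter.1 hx).2⟩)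
  have b2 := (hpart X₂ (Finset.filter_subset _ _)).trans (sum_conicBound_close_le hB X₂
    fun x hx => ⟨hadm x (Finset.mem_filter.1 hx).1, (Finset.mem_filter.1 hx).2⟩)
  have b3 := (hpart X₃ (Finset.filter_subset _ _)).trans (sum_conicBound_unbalanced_le hB X₃
    fun x hx => ⟨hadm x (Finset.mem_filter.1 hx).1, (Finset.mem_filter.1 hx).2⟩)
  have b4 := (hpart X₄ (Finset.filter_subset _ _)).trans (sum_conicBound_two_adic_le hB X₄
    fun x hx => ⟨hadm x (Finset.mem_filter.1 hx).1, (Finset.mem_filter.1 hx).2⟩)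
  linarith

theorem rpow_one_div_log_log_eq_exp {B : ℝ} (hB : 16 ≤ B) :
    B ^ (1 / Real.log (Real.log B)) = Real.exp (Real.log B / Real.log (Real.log B)) := by
  rw [Real.rpow_def_of_pos (by linarith), mul_one_div]

theorem log_log_le_two_mul_rpow {B : ℝ} (hB : 16 ≤ B) :
    Real.log (Real.log B) ≤ 2 * B ^ (1 / Real.log (Real.log B)) := by
  have hZ := one_le_log_log hB
  have h1 := Real.add_one_le_exp (Real.log B / Real.log (Real.log B))
  have h2 : Real.log (Real.log B) / 2 ≤ Real.log B / Real.log (Real.log B) := by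
    rw [div_le_div_iff₀ (by norm_num) (by linarith)]
    linarith [log_log_sq_le hB]
  rw [rpow_one_div_log_log_eq_exp hB]
  linarith

theorem sum_conicBound_coprimePairs_le {B : ℝ} (hB : 16 ≤ B) (X : Finset (ℤ × ℤ))
    (hX : X ⊆ coprimePairs B) :
    ∑ q ∈ X, conicBound (B / B ^ (1 / Real.log (Real.log B))) q ≤
      28000000 * (B * Real.log B ^ 4 / Real.log (Real.log B)) := by
  have hL := log_ge_of_sixteen_le hB
  have hZ := one_le_log_log hB
  have hZ₁ : 1 ≤ B ^ (1 / Real.log (Real.log B)) :=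
    Real.one_le_rpow (by linarith) (by positivity)
  have h := sum_conicBound_le_of_dvd hB (Y := B / B ^ (1 / Real.log (Real.log B)))
    (by positivity) (div_le_self (by linarith) hZ₁) 0 0 X
    fun x hx => ⟨isAdmissible_of_mem_coprimePairs (hX hx), by simp, by simp⟩
  have h3 := mul_log_pow_three_le hB
  have hY : B / B ^ (1 / Real.log (Real.log B)) ≤ 2 * B / Real.log (Real.log B) := by
    rw [div_le_div_iff₀ (by linarith) (by linarith)]
    nlinarith [log_log_le_two_mul_rpow hB]
  refine h.trans ?_
  calc _ ≤ 400000 * (((0 : ℕ) + 1 : ℝ) * ((0 : ℕ) + 1)) * (36 * B * Real.log B ^ 3 +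
        2 * B / Real.log (Real.log B) * Real.log B ^ 3 / 2 ^ (0 + 0) * (16 * Real.log B)) := by
        gcongr
    _ = 14400000 * (B * Real.log B ^ 3) +
        12800000 * (B * Real.log B ^ 4 / Real.log (Real.log B)) := by
        norm_num
        ring
    _ ≤ _ := by
      have : 0 ≤ B * Real.log B ^ 3 := by positivity
      linarith

theorem le_mul_log_pow_four_div {B : ℝ} (hB : 16 ≤ B) :
    B ≤ B * Real.log B ^ 4 / Real.log (Real.log B) := by
  have hL := log_ge_of_sixteen_le hB
  refine (le_mul_of_one_le_right (by linarith) ?_).trans (mul_log_pow_three_le hB)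
  exact one_le_pow₀ (by linarith)

/-- The relation defining the conic attached to `(a, b)`, in primitive coordinates `(x, y, z)` of
height at most `N`. -/
def IsConicPoint (N a b x y z : ℤ) : Prop :=
  0 < x ∧ 0 < y ∧ 0 < z ∧ (a ^ 2 - b ^ 2) * x ^ 2 + (a ^ 2 + b ^ 2) * y ^ 2 = 2 * z ^ 2 ∧
    Int.gcd x y = 1 ∧ max a b * max x y ≤ N

theorem IsConicPoint.bounds {N a b x y z : ℤ} (ha : 0 < a) (hb : 0 < b)
    (h : IsConicPoint N a b x y z) :
    a ≤ N ∧ b ≤ N ∧ x ≤ N ∧ y ≤ N ∧ z ≤ 2 * N := by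
  obtain ⟨hx, hy, hz, he, -, hN⟩ := h
  have ha' := le_max_left a b
  have hb' := le_max_right a b
  have hx' := le_max_left x y
  have hy' := le_max_right x y
  set m := max a b
  set n := max x y
  have hmN : m ≤ N := by nlinarith
  have hnN : n ≤ N := by nlinarith
  refine ⟨by linarith, by linarith, by linarith, by linarith, ?_⟩
  have h1 : a * x ≤ N := (mul_le_mul ha' hx' hx.le (by linarith)).trans hN
  have h2 : b * y ≤ N := (mul_le_mul hb' hy' hy.le (by linarith)).trans hN
  have h3 : a * y ≤ N := (mul_le_mul ha' hy' hy.le (by linarith)).trans hN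
  have q1 : (a * x) ^ 2 ≤ N ^ 2 := pow_le_pow_left₀ (by positivity) h1 2
  have q2 : (b * y) ^ 2 ≤ N ^ 2 := pow_le_pow_left₀ (by positivity) h2 2
  have q3 : (a * y) ^ 2 ≤ N ^ 2 := pow_le_pow_left₀ (by positivity) h3 2
  have q4 : 0 ≤ (b * x) ^ 2 := sq_nonneg _
  refine le_of_sq_le_sq ?_ (by linarith)
  nlinarith

/-- The points of height at most `N` on the conic attached to `(a, b)`. -/
noncomputable def conicPoints (N a b : ℤ) : Finset (ℤ × ℤ × ℤ) :=
  (Finset.Icc 1 N ×ˢ Finset.Icc 1 N ×ˢ Finset.Icc 1 (2 * N)).filter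
    (fun p => IsConicPoint N a b p.1 p.2.1 p.2.2)

theorem mem_conicPoints {N a b : ℤ} (ha : 0 < a) (hb : 0 < b) {p : ℤ × ℤ × ℤ} :
    p ∈ conicPoints N a b ↔ IsConicPoint N a b p.1 p.2.1 p.2.2 := by
  simp only [conicPoints, Finset.mem_filter, Finset.mem_product, Finset.mem_Icc,
    and_iff_right_iff_imp]
  intro h
  obtain ⟨-, -, h1, h2, h3⟩ := h.bounds ha hb
  exact ⟨⟨h.1, h1⟩, ⟨h.2.1, h2⟩, h.2.2.1, h3⟩

theorem Mcount_eq_card_conicPoints {a b : ℤ} (ha : 0 < a) (hb : 0 < b) (B : ℝ) :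
    Mcount a b B = (conicPoints ⌊B⌋ a b).card := by
  rw [Mcount, ← Set.ncard_coe_finset]
  congr 1
  ext p
  rw [Finset.mem_coe, mem_conicPoints ha hb, Set.mem_ofPred_eq, IsConicPoint, Int.le_floor,
    Int.cast_mul]

/-- Quintuples `(a, b, x, y, z)` with `(x, y, z)` a point of height at most `N` on the conic
attached to the coprime pair `(a, b)`, away from the lines `a = b` and `x = y`. -/
noncomputable def conicQuintuples (N : ℤ) : Finset (ℤ × ℤ × ℤ × ℤ × ℤ) :=
  (Finset.Icc 1 N ×ˢ Finset.Icc 1 N ×ˢ Finset.Icc 1 N ×ˢ Finset.Icc 1 N ×ˢ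
    Finset.Icc 1 (2 * N)).filter
    (fun t => Int.gcd t.1 t.2.1 = 1 ∧ t.1 ≠ t.2.1 ∧ t.2.2.1 ≠ t.2.2.2.1 ∧
      IsConicPoint N t.1 t.2.1 t.2.2.1 t.2.2.2.1 t.2.2.2.2)

theorem mem_conicQuintuples {N : ℤ} {t : ℤ × ℤ × ℤ × ℤ × ℤ} :
    t ∈ conicQuintuples N ↔ 0 < t.1 ∧ 0 < t.2.1 ∧ Int.gcd t.1 t.2.1 = 1 ∧ t.1 ≠ t.2.1 ∧
      t.2.2.1 ≠ t.2.2.2.1 ∧ IsConicPoint N t.1 t.2.1 t.2.2.1 t.2.2.2.1 t.2.2.2.2 := by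
  simp only [conicQuintuples, Finset.mem_filter, Finset.mem_product, Finset.mem_Icc]
  constructor
  · rintro ⟨⟨⟨h1, -⟩, ⟨h2, -⟩, -⟩, h3⟩
    exact ⟨h1, h2, h3⟩
  · rintro ⟨h1, h2, h3, h4, h5, h6⟩
    obtain ⟨g1, g2, g3, g4, g5⟩ := h6.bounds h1 h2
    exact ⟨⟨⟨h1, g1⟩, ⟨h2, g2⟩, ⟨h6.1, g3⟩, ⟨h6.2.1, g4⟩, h6.2.2.1, g5⟩, h3, h4, h5, h6⟩

/-- The Segre parametrization of the quadric `x₀x₁ = x₂x₃`. -/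
def segre (t : ℤ × ℤ × ℤ × ℤ × ℤ) : ℤ × ℤ × ℤ × ℤ × ℤ :=
  (t.1 * t.2.2.1, t.2.1 * t.2.2.2.1, t.1 * t.2.2.2.1, t.2.1 * t.2.2.1, t.2.2.2.2)

theorem eq_of_mul_eq_mul_of_gcd_eq_one {a b c d : ℤ} (ha : 0 < a) (hc : 0 < c)
    (hab : Int.gcd a b = 1) (hcd : Int.gcd c d = 1) (h : a * d = c * b) : a = c := by
  rw [← Int.isCoprime_iff_gcd_eq_one] at hab hcd
  exact Int.dvd_antisymm ha.le hc.le (hab.dvd_of_dvd_mul_right ⟨d, h.symm⟩)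
    (hcd.dvd_of_dvd_mul_right ⟨b, h⟩)

theorem segre_injOn (N : ℤ) : Set.InjOn segre (conicQuintuples N) := by
  rintro ⟨a, b, x, y, z⟩ h ⟨a', b', x', y', z'⟩ h' he
  rw [Finset.mem_coe, mem_conicQuintuples] at h h'
  obtain ⟨ha, hb, hab, -, -, hx, hy, -⟩ := h
  obtain ⟨ha', hb', hab', -, -, hx', hy', -⟩ := h'
  simp only [segre, Prod.mk.injEq] at he ha hb hab hx hy ha' hb' hab' hx' hy'
  obtain ⟨e0, e1, e2, e3, rfl⟩ := he
  obtain rfl : a = a' := by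
    refine eq_of_mul_eq_mul_of_gcd_eq_one ha ha' hab hab' ?_
    have : (x * x') * (a * b') = (x * x') * (a' * b) := by
      linear_combination b' * x' * e0 - a' * x' * e3
    exact mul_left_cancel₀ (by positivity) this
  obtain rfl := mul_left_cancel₀ ha.ne' e0
  obtain rfl := mul_left_cancel₀ ha.ne' e2
  obtain rfl := mul_right_cancel₀ hx.ne' e3
  rfl

theorem gcd_segre (a b x y : ℤ) :
    Int.gcd (a * x) (Int.gcd (b * y) (Int.gcd (a * y) (b * x))) = Int.gcd a b * Int.gcd x y := by
  have h : ∀ d : ℕ, d ∣ Int.gcd (a * x) (Int.gcd (b * y) (Int.gcd (a * y) (b * x))) ↔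
      d ∣ Int.gcd a b * Int.gcd x y := by
    intro d
    have e : Int.gcd a b * Int.gcd x y = Int.gcd (Int.gcd (a * x) (b * x))
        (Int.gcd (a * y) (b * y)) := by
      rw [Int.gcd_mul_right, Int.gcd_mul_right, Nat.cast_mul, Nat.cast_mul, Int.gcd_mul_left]
      simp [Int.gcd_def, Int.natAbs_abs]
    rw [e]
    simp only [Int.dvd_gcd_iff, Int.dvd_coe_gcd_iff]
    tauto
  exact Nat.dvd_antisymm ((h _).1 dvd_rfl) ((h _).2 dvd_rfl)

theorem mul_max_mul_max_le_iff {a b x y N : ℤ} (ha : 0 < a) (hb : 0 < b) (hx : 0 < x) :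
    max a b * max x y ≤ N ↔ a * x ≤ N ∧ b * y ≤ N ∧ a * y ≤ N ∧ b * x ≤ N := by
  rw [max_mul_of_nonneg _ _ (hx.le.trans (le_max_left x y)), mul_max_of_nonneg _ _ ha.le,
    mul_max_of_nonneg _ _ hb.le]
  simp only [max_le_iff]
  tauto

theorem exists_segre_eq {x₀ x₁ x₂ x₃ : ℤ} (h₀ : 0 < x₀) (h₁ : 0 < x₁) (h₂ : 0 < x₂)
    (h : x₀ * x₁ = x₂ * x₃) : ∃ a b x y : ℤ, 0 < a ∧ 0 < b ∧ 0 < x ∧ 0 < y ∧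
      Int.gcd x y = 1 ∧ x₀ = a * x ∧ x₁ = b * y ∧ x₂ = a * y ∧ x₃ = b * x := by
  have hg : 0 < (Int.gcd x₀ x₂ : ℤ) := by
    exact_mod_cast Int.gcd_pos_of_ne_zero_left _ h₀.ne'
  obtain ⟨x, hx⟩ := Int.gcd_dvd_left x₀ x₂
  obtain ⟨y, hy⟩ := Int.gcd_dvd_right x₀ x₂
  have hxy : Int.gcd x y = 1 := by
    have := Int.gcd_mul_left (Int.gcd x₀ x₂ : ℤ) x y
    rw [← hx, ← hy, Int.natAbs_natCast] at this
    exact Nat.eq_of_mul_eq_mul_left (by exact_mod_cast hg) (by rw [← this, mul_one])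
  generalize (Int.gcd x₀ x₂ : ℤ) = a at *
  subst hx hy
  have hx0 := pos_of_mul_pos_right h₀ hg.le
  have hy0 := pos_of_mul_pos_right h₂ hg.le
  have h' : x * x₁ = y * x₃ := mul_left_cancel₀ hg.ne' (by linear_combination h)
  obtain ⟨b, rfl⟩ := (Int.isCoprime_iff_gcd_eq_one.2 hxy).dvd_of_dvd_mul_left ⟨x₁, h'.symm⟩
  have h1 : x₁ = b * y := mul_left_cancel₀ hx0.ne' (by linear_combination h')
  refine ⟨a, b, x, y, hg, ?_, hx0, hy0, hxy, rfl, h1, rfl, mul_comm _ _⟩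
  rw [h1] at h₁
  exact pos_of_mul_pos_left h₁ hy0.le

theorem None_eq_card_conicQuintuples (B : ℝ) : None B = (conicQuintuples ⌊B⌋).card := by
  rw [← Set.ncard_coe_finset, ← (segre_injOn ⌊B⌋).ncard_image, None]
  congr 1
  ext ⟨x₀, x₁, x₂, x₃, z⟩
  simp only [Set.mem_ofPred_eq, Set.mem_image, Finset.mem_coe, mem_conicQuintuples, segre,
    ← Int.le_floor]
  constructor
  · rintro ⟨h₀, h₁, h₂, h₃, hz, hg, b₀, b₁, b₂, b₃, hs, he, hne⟩
    obtain ⟨a, b, x, y, ha, hb, hx, hy, hxy, rfl, rfl, rfl, rfl⟩ := exists_segre_eq h₀ h₁ h₂ hs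
    rw [gcd_segre, hxy, mul_one] at hg
    refine ⟨(a, b, x, y, z), ⟨ha, hb, hg, ?_, ?_, hx, hy, hz, by linear_combination he, hxy,
      (mul_max_mul_max_le_iff ha hb hx).2 ⟨b₀, b₁, b₂, b₃⟩⟩, rfl⟩
    · rintro (rfl : a = b)
      exact hne (Set.pair_comm _ _)
    · rintro (rfl : x = y)
      exact hne rfl
  · rintro ⟨⟨a, b, x, y, z'⟩, ⟨ha, hb, hg, hab, hxy, hx, hy, hz, he, hg', hN⟩, h⟩
    simp only [Prod.mk.injEq] at h ha hb hg hab hxy hx hy hz he hg' hN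
    obtain ⟨rfl, rfl, rfl, rfl, rfl⟩ := h
    obtain ⟨b₀, b₁, b₂, b₃⟩ := (mul_max_mul_max_le_iff ha hb hx).1 hN
    refine ⟨by positivity, by positivity, by positivity, by positivity, hz, ?_, b₀, b₁, b₂, b₃,
      by ring, by linear_combination he, fun hpair => ?_⟩
    · rw [gcd_segre, hg, hg']
    · have : a * x ∈ ({a * y, b * x} : Set ℤ) := hpair ▸ Set.mem_insert _ _
      rcases this with h | h
      · exact hxy (mul_left_cancel₀ ha.ne' h)
      · exact hab (mul_right_cancel₀ hx.ne' h)

/-- The involution exchanging the two rulings of the quadric `x₀x₁ = x₂x₃`. -/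
def swapRulings (t : ℤ × ℤ × ℤ × ℤ × ℤ) : ℤ × ℤ × ℤ × ℤ × ℤ :=
  (t.2.2.2.1, t.2.2.1, t.2.1, t.1, t.2.2.2.2)

theorem swapRulings_mem_conicQuintuples {N : ℤ} {t : ℤ × ℤ × ℤ × ℤ × ℤ}
    (ht : t ∈ conicQuintuples N) : swapRulings t ∈ conicQuintuples N := by
  rw [mem_conicQuintuples] at ht ⊢
  obtain ⟨ha, hb, hg, hab, hxy, hx, hy, hz, he, hg', hN⟩ := ht
  refine ⟨hy, hx, ?_, hxy.symm, hab.symm, hb, ha, hz, ?_, ?_, ?_⟩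
  · rwa [Int.gcd_comm] at hg'
  · simp only [swapRulings]
    linear_combination he
  · rwa [Int.gcd_comm] at hg
  · simp only [swapRulings]
    rwa [max_comm t.2.2.2.1, max_comm t.2.1, mul_comm]

theorem le_floor_sqrt_or_le_floor_sqrt {B : ℝ} (hB : 0 ≤ B) {m n : ℤ} (h : m * n ≤ ⌊B⌋) :
    m ≤ ⌊√B⌋ ∨ n ≤ ⌊√B⌋ := by
  by_contra! hcon
  obtain ⟨h1, h2⟩ := hcon
  rw [Int.floor_lt] at h1 h2
  rw [Int.le_floor, Int.cast_mul] at h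
  have := mul_lt_mul'' h1 h2 (Real.sqrt_nonneg B) (Real.sqrt_nonneg B)
  rw [Real.mul_self_sqrt hB] at this
  linarith

theorem card_conicQuintuples_add {B : ℝ} (hB : 0 ≤ B) :
    (conicQuintuples ⌊B⌋).card + ((conicQuintuples ⌊B⌋).filter (fun t =>
        max t.1 t.2.1 ≤ ⌊√B⌋ ∧ max t.2.2.1 t.2.2.2.1 ≤ ⌊√B⌋)).card =
      2 * ((conicQuintuples ⌊B⌋).filter (fun t => max t.1 t.2.1 ≤ ⌊√B⌋)).card := by
  set T := conicQuintuples ⌊B⌋ with hT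
  have h1 : T = T.filter (fun t => max t.1 t.2.1 ≤ ⌊√B⌋) ∪
      T.filter (fun t => max t.2.2.1 t.2.2.2.1 ≤ ⌊√B⌋) := by
    rw [← Finset.filter_or, Finset.filter_true_of_mem]
    intro t ht
    rw [hT, mem_conicQuintuples] at ht
    obtain ⟨-, -, -, -, -, -, -, -, -, -, hN⟩ := ht
    exact le_floor_sqrt_or_le_floor_sqrt hB hN
  have h2 : (T.filter (fun t => max t.2.2.1 t.2.2.2.1 ≤ ⌊√B⌋)).card =
      (T.filter (fun t => max t.1 t.2.1 ≤ ⌊√B⌋)).card := by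
    refine Finset.card_nbij' swapRulings swapRulings ?_ ?_ (fun _ _ => rfl) (fun _ _ => rfl)
    · intro t ht
      obtain ⟨ht, hm⟩ := Finset.mem_filter.1 ht
      exact Finset.mem_filter.2 ⟨swapRulings_mem_conicQuintuples ht, by
        rwa [max_comm] at hm⟩
    · intro t ht
      obtain ⟨ht, hm⟩ := Finset.mem_filter.1 ht
      exact Finset.mem_filter.2 ⟨swapRulings_mem_conicQuintuples ht, by
        rwa [max_comm] at hm⟩
  have h3 := Finset.card_union_add_card_inter (T.filter (fun t => max t.1 t.2.1 ≤ ⌊√B⌋))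
    (T.filter (fun t => max t.2.2.1 t.2.2.2.1 ≤ ⌊√B⌋))
  rw [← h1, h2, ← Finset.filter_and] at h3
  rw [h3, two_mul]

theorem mem_coprimePairs_of_mem_conicQuintuples {B : ℝ} {t : ℤ × ℤ × ℤ × ℤ × ℤ}
    (ht : t ∈ conicQuintuples ⌊B⌋) (hm : max t.1 t.2.1 ≤ ⌊√B⌋) :
    (t.1, t.2.1) ∈ coprimePairs B := by
  rw [mem_conicQuintuples] at ht
  obtain ⟨ha, hb, hg, hab, -⟩ := ht
  simp only [coprimePairs, Finset.mem_filter, Finset.mem_product, Finset.mem_Icc]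
  refine ⟨⟨⟨ha, (le_max_left _ _).trans hm⟩, hb, (le_max_right _ _).trans hm⟩, hg, fun h => hab ?_⟩
  have h1 : t.1 = 1 := Int.eq_one_of_mul_eq_one_right ha.le h
  rw [h1, one_mul] at h
  rw [h1, h]

theorem card_filter_conicQuintuples_eq_sum {B : ℝ} (p : ℤ × ℤ × ℤ × ℤ × ℤ → Prop)
    [DecidablePred p] (hp : ∀ t, p t → max t.1 t.2.1 ≤ ⌊√B⌋) :
    ((conicQuintuples ⌊B⌋).filter p).card = ∑ q ∈ coprimePairs B,
      ((conicPoints ⌊B⌋ q.1 q.2).filter (fun s => s.1 ≠ s.2.1 ∧ p (q.1, q.2, s))).card := by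
  rw [Finset.card_eq_sum_card_fiberwise (f := fun t => (t.1, t.2.1)) (t := coprimePairs B)]
  · refine Finset.sum_congr rfl fun q hq => ?_
    obtain ⟨h1, h2, hc, hne, hm⟩ := isAdmissible_of_mem_coprimePairs hq
    refine Finset.card_nbij' (fun t => t.2.2) (fun s => (q.1, q.2, s)) ?_ ?_ ?_ ?_
    · rintro t ht
      obtain ⟨htp, rfl⟩ := Finset.mem_filter.1 ht
      obtain ⟨htT, hpt⟩ := Finset.mem_filter.1 htp
      obtain ⟨-, -, -, -, hxy, hC⟩ := mem_conicQuintuples.1 htT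
      exact Finset.mem_filter.2 ⟨(mem_conicPoints h1 h2).2 hC, hxy, hpt⟩
    · intro s hs
      obtain ⟨hs, hxy, hps⟩ := Finset.mem_filter.1 hs
      refine Finset.mem_filter.2 ⟨Finset.mem_filter.2 ⟨mem_conicQuintuples.2 ⟨h1, h2,
        Int.isCoprime_iff_gcd_eq_one.1 hc, hne, hxy, (mem_conicPoints h1 h2).1 hs⟩, hps⟩, rfl⟩
    · rintro t ht
      obtain ⟨ht, rfl⟩ := Finset.mem_filter.1 ht
      rfl
    · exact fun _ _ => rfl
  · intro t ht
    obtain ⟨ht, hpt⟩ := Finset.mem_filter.1 ht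
    exact mem_coprimePairs_of_mem_conicQuintuples ht (hp t hpt)

theorem card_conicPoints_le_card_filter_add_one {N a b : ℤ} (ha : 0 < a) (hb : 0 < b) :
    (conicPoints N a b).card ≤ ((conicPoints N a b).filter (fun s => s.1 ≠ s.2.1)).card + 1 := by
  rw [← Finset.card_filter_add_card_filter_not (s := conicPoints N a b) (fun s => s.1 ≠ s.2.1)]
  gcongr
  refine Finset.card_le_one.2 ?_
  have h : ∀ s ∈ (conicPoints N a b).filter (fun s => ¬ s.1 ≠ s.2.1), s = (1, 1, a) := by
    rintro ⟨x, y, z⟩ hs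
    obtain ⟨hs, hxy⟩ := Finset.mem_filter.1 hs
    obtain ⟨hx, hy, hz, he, hg, -⟩ := (mem_conicPoints ha hb).1 hs
    simp only [ne_eq, not_not] at hx hy hz he hg hxy
    subst hxy
    rw [Int.gcd_self] at hg
    obtain rfl : x = 1 := by omega
    have : z = a := by
      refine (pow_left_inj₀ hz.le ha.le two_ne_zero).1 ?_
      linarith
    rw [this]
  intro s hs s' hs'
  rw [h s hs, h s' hs']

theorem card_filter_max_le_eq_sum (B : ℝ) :
    ((conicQuintuples ⌊B⌋).filter (fun t => max t.1 t.2.1 ≤ ⌊√B⌋)).card =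
      ∑ q ∈ coprimePairs B, ((conicPoints ⌊B⌋ q.1 q.2).filter (fun s => s.1 ≠ s.2.1)).card := by
  rw [card_filter_conicQuintuples_eq_sum _ fun _ h => h]
  refine Finset.sum_congr rfl fun q hq => ?_
  congr 1
  refine Finset.filter_congr fun s _ => and_iff_left ?_
  exact Int.le_floor.2 (isAdmissible_of_mem_coprimePairs hq).2.2.2.2

theorem card_filter_max_le_le {B : ℝ} :
    (((conicQuintuples ⌊B⌋).filter (fun t => max t.1 t.2.1 ≤ ⌊√B⌋)).card : ℝ) ≤
      ∑ q ∈ coprimePairs B, (Mcount q.1 q.2 B : ℝ) := by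
  rw [card_filter_max_le_eq_sum, Nat.cast_sum]
  refine Finset.sum_le_sum fun q hq => Nat.cast_le.2 ?_
  obtain ⟨h1, h2, -⟩ := isAdmissible_of_mem_coprimePairs hq
  rw [Mcount_eq_card_conicPoints h1 h2]
  exact Finset.card_filter_le _ _

theorem sum_Mcount_le_card_filter_max_le {B : ℝ} (hB : 0 ≤ B) :
    ∑ q ∈ coprimePairs B, (Mcount q.1 q.2 B : ℝ) ≤
      (((conicQuintuples ⌊B⌋).filter (fun t => max t.1 t.2.1 ≤ ⌊√B⌋)).card : ℝ) + B := by
  rw [card_filter_max_le_eq_sum, Nat.cast_sum]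
  have h : ∑ q ∈ coprimePairs B, (Mcount q.1 q.2 B : ℝ) ≤ ∑ q ∈ coprimePairs B,
      ((((conicPoints ⌊B⌋ q.1 q.2).filter (fun s => s.1 ≠ s.2.1)).card : ℝ) + 1) := by
    refine Finset.sum_le_sum fun q hq => ?_
    obtain ⟨h1, h2, -⟩ := isAdmissible_of_mem_coprimePairs hq
    rw [Mcount_eq_card_conicPoints h1 h2]
    exact_mod_cast card_conicPoints_le_card_filter_add_one h1 h2
  rw [Finset.sum_add_distrib, Finset.sum_const, nsmul_one] at h
  linarith [card_coprimePairs_le hB]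

theorem card_filter_max_le_max_le_le {B : ℝ} (hB : 16 ≤ B) :
    (((conicQuintuples ⌊B⌋).filter (fun t =>
        max t.1 t.2.1 ≤ ⌊√B⌋ ∧ max t.2.2.1 t.2.2.2.1 ≤ ⌊√B⌋)).card : ℝ) ≤
      298000000 * (B * Real.log B ^ 4 / Real.log (Real.log B)) := by
  rw [card_filter_conicQuintuples_eq_sum _ fun _ h => h.1, Nat.cast_sum,
    ← Finset.sum_filter_add_sum_filter_not _ (IsTypical B)]
  refine (add_le_add ((Finset.sum_le_sum fun q hq => ?_).trans
    (sum_conicBound_coprimePairs_le hB _ (Finset.filter_subset (IsTypical B) _)))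
    ((Finset.sum_le_sum fun q hq => ?_).trans (sum_Mcount_not_isTypical_le hB))).trans
    (le_of_eq (by ring))
  · obtain ⟨hq, hT, -⟩ := Finset.mem_filter.1 hq
    have hA := isAdmissible_of_mem_coprimePairs hq
    refine card_conic_le_conicBound hA (X := √B) (Real.sqrt_pos.2 (by linarith)) ?_ _ fun s hs => ?_
    · refine (mul_le_mul_of_nonneg_left hT.le (Real.sqrt_nonneg B)).trans (le_of_eq ?_)
      rw [mul_div_assoc', Real.mul_self_sqrt (by linarith)]
    · obtain ⟨hs, -, -, hm⟩ := Finset.mem_filter.1 hs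
      obtain ⟨g1, g2, g3, g4, g5, -⟩ := (mem_conicPoints hA.1 hA.2.1).1 hs
      exact ⟨g1, g2, g3, g4, g5, Int.le_floor.1 ((le_max_left _ _).trans hm),
        Int.le_floor.1 ((le_max_right _ _).trans hm)⟩
  · obtain ⟨h1, h2, -⟩ := isAdmissible_of_mem_coprimePairs (Finset.mem_filter.1 hq).1
    rw [Mcount_eq_card_conicPoints h1 h2]
    exact Nat.cast_le.2 (Finset.card_filter_le _ _)

theorem None_eq_twice_sum_Mcount_over_A₁ :
    ∃ c C : ℝ, 0 < c ∧ 0 < C ∧ ∀ B : ℝ, 16 ≤ B →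
      |(None B : ℝ) -
          2 * ∑ q ∈ (Finset.Icc (1 : ℤ) ⌊Real.sqrt B⌋ ×ˢ
              Finset.Icc (1 : ℤ) ⌊Real.sqrt B⌋).filter
              (fun q => Int.gcd q.1 q.2 = 1 ∧ q.1 * q.2 ≠ 1 ∧
                ((max q.1 q.2 : ℤ) : ℝ) <
                  Real.sqrt B / (B ^ (1 / Real.log (Real.log B))) ^ c ∧
                ((max q.1 q.2 : ℤ) : ℝ) ≤
                  Real.log (Real.log B) ^ 2 *
                    ((min q.1 (min q.2 |q.1 - q.2|) : ℤ) : ℝ) ∧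
                (padicValInt 2 (q.1 ^ 2 - q.2 ^ 2) : ℝ) ≤ Real.log (Real.log B)),
            (Mcount q.1 q.2 B : ℝ)| ≤
        C * B * Real.log B ^ 4 / Real.log (Real.log B) := by
  refine ⟨1, 840000000, one_pos, by norm_num, fun B hB => ?_⟩
  have hB0 : 0 ≤ B := by linarith
  have hA : (Finset.Icc (1 : ℤ) ⌊Real.sqrt B⌋ ×ˢ Finset.Icc (1 : ℤ) ⌊Real.sqrt B⌋).filter
      (fun q => Int.gcd q.1 q.2 = 1 ∧ q.1 * q.2 ≠ 1 ∧
        ((max q.1 q.2 : ℤ) : ℝ) <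
          Real.sqrt B / (B ^ (1 / Real.log (Real.log B))) ^ (1 : ℝ) ∧
        ((max q.1 q.2 : ℤ) : ℝ) ≤
          Real.log (Real.log B) ^ 2 * ((min q.1 (min q.2 |q.1 - q.2|) : ℤ) : ℝ) ∧
        (padicValInt 2 (q.1 ^ 2 - q.2 ^ 2) : ℝ) ≤ Real.log (Real.log B)) =
      (coprimePairs B).filter (IsTypical B) := by
    ext q
    simp only [coprimePairs, IsTypical, Finset.mem_filter, Real.rpow_one, and_assoc]
  rw [hA]
  have hsplit := Finset.sum_filter_add_sum_filter_not (coprimePairs B) (IsTypical B)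
    (fun q => (Mcount q.1 q.2 B : ℝ))
  have hbad := sum_Mcount_not_isTypical_le hB
  have hboth := card_filter_max_le_max_le_le hB
  have hle := card_filter_max_le_le (B := B)
  have hge := sum_Mcount_le_card_filter_max_le hB0
  have hadd := card_conicQuintuples_add hB0
  rw [← None_eq_card_conicQuintuples, ← @Nat.cast_inj ℝ, Nat.cast_add, Nat.cast_mul,
    Nat.cast_two] at hadd
  have hBE := le_mul_log_pow_four_div hB
  have hbad0 : 0 ≤ ∑ q ∈ (coprimePairs B).filter (fun q => ¬ IsTypical B q),
      (Mcount q.1 q.2 B : ℝ) := Finset.sum_nonneg fun q _ => Nat.cast_nonneg _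
  rw [mul_assoc, mul_div_assoc, abs_le]
  constructor <;> linarith
end

section
/- Let c, d be odd integers. (i) If c + d ≡ 0 (mod 8) or c + d ≡ 2 (mod 8), then lim_{n → ∞} 2^{−2n}·#{(x, y, z) ∈ (ℤ/2^nℤ)³ : x and y not both even, c·x² + d·y² ≡ 2z² (mod 2^n)} = 1. (ii) If μ ≥ 3 is an integer with 2^{μ−1}·c + d ≡ 1 (mod 8), then lim_{n → ∞} 2^{−2n}·#{(x, y, z) ∈ (ℤ/2^nℤ)³ : x and y not both even, 2^μ·c·x² + 2·d·y² ≡ 2z² (mod 2^n)} = μ. -/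
/-- The sum of `f` over the representatives `0, …, 2 ^ k - 1` of the residues modulo `2 ^ k`. -/
def dyadicSum (k : ℕ) (f : ℤ → ℕ) : ℕ := ∑ i ∈ Finset.range (2 ^ k), f i

namespace dyadicSum

theorem add (k : ℕ) (f g : ℤ → ℕ) :
    dyadicSum k (fun i => f i + g i) = dyadicSum k f + dyadicSum k g :=
  Finset.sum_add_distrib

theorem mul_left (k a : ℕ) (f : ℤ → ℕ) :
    dyadicSum k (fun i => a * f i) = a * dyadicSum k f :=
  (Finset.mul_sum _ _ _).symm

theorem const (k a : ℕ) : dyadicSum k (fun _ => a) = 2 ^ k * a := by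
  simp [dyadicSum]

theorem comm (k l : ℕ) (f : ℤ → ℤ → ℕ) :
    dyadicSum k (fun i => dyadicSum l (f i)) = dyadicSum l (fun j => dyadicSum k (f · j)) :=
  Finset.sum_comm

theorem succ_eq_even_add_odd (k : ℕ) (f : ℤ → ℕ) :
    dyadicSum (k + 1) f =
      dyadicSum k (fun i => f (2 * i)) + dyadicSum k (fun i => f (2 * i + 1)) := by
  have key : ∀ N : ℕ, ∑ i ∈ Finset.range (2 * N), f i =
      ∑ i ∈ Finset.range N, f (2 * i) + ∑ i ∈ Finset.range N, f (2 * i + 1) := by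
    intro N
    induction N with
    | zero => simp
    | succ N ih =>
      rw [show 2 * (N + 1) = 2 * N + 1 + 1 by ring, Finset.sum_range_succ, Finset.sum_range_succ,
        Finset.sum_range_succ, Finset.sum_range_succ, ih]
      push_cast
      ring
  rw [dyadicSum, pow_succ', key]
  rfl

theorem add_of_periodic {j : ℕ} {f : ℤ → ℕ} (hf : ∀ i t, f (i + 2 ^ j * t) = f i) (k : ℕ) :
    dyadicSum (j + k) f = 2 ^ k * dyadicSum j f := by
  induction k with
  | zero => simp
  | succ k ih =>
    have : dyadicSum (j + (k + 1)) f = dyadicSum (j + k) f + dyadicSum (j + k) f := by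
      simp only [dyadicSum]
      rw [← add_assoc, pow_succ (n := j + k), mul_two, Finset.sum_range_add]
      congr 1
      refine Finset.sum_congr rfl fun i _ => ?_
      rw [← hf i (2 ^ k)]
      congr 1
      push_cast
      ring
    rw [this, ih]
    ring

theorem shift_of_periodic {k : ℕ} {f : ℤ → ℕ} (hf : ∀ i t, f (i + 2 ^ k * t) = f i) (a : ℕ) :
    dyadicSum k (fun i => f (i + a)) = dyadicSum k f := by
  induction a with
  | zero => simp
  | succ a ih =>
    rw [← ih]
    have h1 := Finset.sum_range_succ (fun i : ℕ => f (i + a)) (2 ^ k)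
    rw [Finset.sum_range_succ'] at h1
    have h2 := hf a 1
    simp only [dyadicSum]
    push_cast at h1 ⊢
    rw [show (2 : ℤ) ^ k + a = a + 2 ^ k * 1 by ring, h2] at h1
    simp only [zero_add, add_left_inj] at h1
    rw [← h1]
    refine Finset.sum_congr rfl fun i _ => ?_
    congr 1
    ring

theorem odd_indicator (k a : ℕ) :
    dyadicSum (k + 1) (fun i => if 2 ∣ i then 0 else a) = 2 ^ k * a := by
  rw [succ_eq_even_add_odd]
  have h : ∀ i : ℤ, ¬ 2 ∣ 2 * i + 1 := fun i => by omega
  simp [h, const]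

theorem even_indicator (k a : ℕ) :
    dyadicSum (k + 1) (fun i => if 2 ∣ i then a else 0) = 2 ^ k * a := by
  rw [succ_eq_even_add_odd]
  have h : ∀ i : ℤ, ¬ 2 ∣ 2 * i + 1 := fun i => by omega
  simp [h, const]

end dyadicSum

theorem Nat.two_pow_mul_two_pow_self (k : ℕ) : 2 ^ k * 2 ^ k = 4 ^ k :=
  (mul_pow 2 2 k).symm

theorem ite_one_zero_congr {p q : Prop} [Decidable p] [Decidable q] (h : p ↔ q) :
    (if p then 1 else 0 : ℕ) = if q then 1 else 0 := by
  simp only [h]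

/-- If `c` is odd, the congruence `c * z ^ 2 ≡ a` modulo `2 ^ (k + 3)` has four odd solutions
when `a ≡ c` modulo `8` and none otherwise. -/
theorem dyadicSum_odd_sq {c : ℤ} (hc : ¬ 2 ∣ c) (k : ℕ) (a : ℤ) :
    dyadicSum (k + 3) (fun z => if ¬ 2 ∣ z ∧ 2 ^ (k + 3) ∣ c * z ^ 2 - a then 1 else 0) =
      if 8 ∣ a - c then 4 else 0 := by
  induction k with
  | zero =>
    simp only [dyadicSum, zero_add, show 2 ^ 3 = 8 by rfl, Finset.sum_range_succ,
      Finset.sum_range_zero]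
    norm_num
    split_ifs <;> omega
  | succ k ih =>
    have per : ∀ (j : ℕ) (i t : ℤ), (if ¬ 2 ∣ i + 2 ^ (j + 1) * t ∧
        2 ^ (j + 1) ∣ c * (i + 2 ^ (j + 1) * t) ^ 2 - a then 1 else 0 : ℕ) =
        if ¬ 2 ∣ i ∧ 2 ^ (j + 1) ∣ c * i ^ 2 - a then 1 else 0 := by
      intro j i t
      refine ite_one_zero_congr (and_congr (not_congr ?_) ?_)
      · exact dvd_add_left ⟨2 ^ j * t, by ring⟩
      · rw [show c * (i + 2 ^ (j + 1) * t) ^ 2 - a = (c * i ^ 2 - a) +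
          2 ^ (j + 1) * (c * (2 * i * t + 2 ^ (j + 1) * t ^ 2)) by ring]
        exact dvd_add_left (dvd_mul_right _ _)
    have lift := dyadicSum.add_of_periodic (j := k + 3)
      (f := fun z => if ¬ 2 ∣ z ∧ 2 ^ (k + 3) ∣ c * z ^ 2 - a then 1 else 0) (per (k + 2)) 1
    have shift := dyadicSum.shift_of_periodic (k := k + 1 + 3)
      (f := fun z => if ¬ 2 ∣ z ∧ 2 ^ (k + 1 + 3) ∣ c * z ^ 2 - a then 1 else 0)
      (per (k + 1 + 2)) (2 ^ (k + 2))
    have split := dyadicSum.add (k + 1 + 3)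
      (fun z => if ¬ 2 ∣ z ∧ 2 ^ (k + 1 + 3) ∣ c * z ^ 2 - a then 1 else 0)
      (fun z => if ¬ 2 ∣ z + (2 ^ (k + 2) : ℕ) ∧
        2 ^ (k + 1 + 3) ∣ c * (z + (2 ^ (k + 2) : ℕ)) ^ 2 - a then 1 else 0)
    have merge : ∀ z : ℤ, (if ¬ 2 ∣ z ∧ 2 ^ (k + 1 + 3) ∣ c * z ^ 2 - a then 1 else 0) +
        (if ¬ 2 ∣ z + (2 ^ (k + 2) : ℕ) ∧
          2 ^ (k + 1 + 3) ∣ c * (z + (2 ^ (k + 2) : ℕ)) ^ 2 - a then 1 else 0) =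
        if ¬ 2 ∣ z ∧ 2 ^ (k + 3) ∣ c * z ^ 2 - a then 1 else 0 := by
      intro z
      have e1 : (2 ∣ z + (2 ^ (k + 2) : ℕ)) ↔ 2 ∣ z :=
        dvd_add_left ⟨2 ^ (k + 1), by push_cast; ring⟩
      by_cases hz : 2 ∣ z
      · simp only [e1, hz, not_true_eq_false, false_and, if_false]
      obtain ⟨u, hu⟩ : Odd (c * z) := by
        rw [← Int.not_even_iff_odd, even_iff_two_dvd, Int.prime_two.dvd_mul]
        tauto
      have e2 : c * (z + (2 ^ (k + 2) : ℕ)) ^ 2 - a =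
          c * z ^ 2 - a + 2 ^ (k + 3) + 2 ^ (k + 1 + 3) * (u + c * 2 ^ k) := by
        push_cast
        linear_combination 2 ^ (k + 3) * hu
      have e3 : (2 ^ (k + 1 + 3) ∣ c * (z + (2 ^ (k + 2) : ℕ)) ^ 2 - a) ↔
          2 ^ (k + 1 + 3) ∣ c * z ^ 2 - a + 2 ^ (k + 3) := by
        rw [e2]
        exact dvd_add_left (dvd_mul_right _ _)
      simp only [e1, e3, hz, not_false_eq_true, true_and]
      have e4 : (2 : ℤ) ^ (k + 1 + 3) = 2 ^ (k + 3) * 2 := by ring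
      have e5 : (2 : ℤ) ^ (k + 3) ≠ 0 := by positivity
      by_cases h : (2 : ℤ) ^ (k + 3) ∣ c * z ^ 2 - a
      · obtain ⟨w, hw⟩ := h
        rw [hw, e4, ← mul_add_one]
        simp only [mul_dvd_mul_iff_left e5, dvd_mul_right, if_true]
        split_ifs <;> omega
      · have h1 : ¬ (2 : ℤ) ^ (k + 1 + 3) ∣ c * z ^ 2 - a := fun h' =>
          h ((Dvd.intro _ e4.symm).trans h')
        have h2 : ¬ (2 : ℤ) ^ (k + 1 + 3) ∣ c * z ^ 2 - a + 2 ^ (k + 3) := fun h' =>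
          h ((dvd_add_left (dvd_refl _)).1 ((Dvd.intro _ e4.symm).trans h'))
        simp [h, h1, h2]
    simp only [merge] at split
    rw [shift, show k + 1 + 3 = k + 3 + 1 by ring, lift, ih] at split
    rw [show k + 1 + 3 = k + 3 + 1 by ring]
    omega

/-- A triple sum over residues counts the corresponding subset of `ZMod (2 ^ n)` cubed. -/
theorem ncard_zmod_two_pow (n : ℕ) (P : ZMod (2 ^ n) × ZMod (2 ^ n) × ZMod (2 ^ n) → Prop)
    (Q : ℤ → ℤ → ℤ → Prop) [∀ x y z, Decidable (Q x y z)]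
    (h : ∀ x y z : ℕ, x < 2 ^ n → y < 2 ^ n → z < 2 ^ n → (P (x, y, z) ↔ Q x y z)) :
    Set.ncard {t | P t} = dyadicSum n fun x => dyadicSum n fun y => dyadicSum n fun z =>
      if Q x y z then 1 else 0 := by
  classical
  have key : ∀ f : ZMod (2 ^ n) → ℕ, ∑ x, f x = ∑ i ∈ Finset.range (2 ^ n), f i := by
    intro f
    refine Finset.sum_nbij' ZMod.val (fun i => (i : ZMod (2 ^ n))) ?_ ?_ ?_ ?_ ?_
    · intro a _
      simpa using ZMod.val_lt a
    · simp
    · simp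
    · intro i hi
      exact ZMod.val_cast_of_lt (Finset.mem_range.1 hi)
    · simp
  rw [Set.ncard_eq_toFinset_card', Set.toFinset_ofPred, Finset.card_filter]
  simp only [Fintype.sum_prod_type, key, dyadicSum]
  refine Finset.sum_congr rfl fun x hx => Finset.sum_congr rfl fun y hy =>
    Finset.sum_congr rfl fun z hz => ite_one_zero_congr ?_
  exact h x y z (Finset.mem_range.1 hx) (Finset.mem_range.1 hy) (Finset.mem_range.1 hz)

theorem Int.exists_sq_eq_eight_mul_add_one {x : ℤ} (hx : ¬ 2 ∣ x) : ∃ u, x ^ 2 = 8 * u + 1 := by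
  obtain ⟨v, rfl⟩ : Odd x := by rwa [← Int.not_even_iff_odd, even_iff_two_dvd]
  obtain ⟨w, hw⟩ := Int.even_mul_succ_self v
  exact ⟨w, by linear_combination 4 * hw⟩

theorem Int.exists_sq_eq_four_mul {x : ℤ} (hx : 2 ∣ x) : ∃ u, x ^ 2 = 4 * u := by
  obtain ⟨v, rfl⟩ := hx
  exact ⟨v ^ 2, by ring⟩

theorem Int.dvd_mul_sq_shift (N A B i t : ℤ) :
    N ∣ A * (i + N * t) ^ 2 + B ↔ N ∣ A * i ^ 2 + B := by
  rw [show A * (i + N * t) ^ 2 + B = A * i ^ 2 + B + N * (A * (2 * i * t + N * t ^ 2)) by ring]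
  exact dvd_add_left (dvd_mul_right _ _)

theorem Int.eight_dvd_of_two_pow_dvd {k : ℕ} {a : ℤ} (h : 2 ^ (k + 3) ∣ a) : 8 ∣ a :=
  (show (8 : ℤ) ∣ 2 ^ (k + 3) from ⟨2 ^ k, by ring⟩).trans h

/-- The number of square roots modulo `2 ^ (k + 3)` of an odd integer. -/
theorem dyadicSum_sqrt_odd (k : ℕ) {a : ℤ} (ha : ¬ 2 ∣ a) :
    dyadicSum (k + 3) (fun z => if 2 ^ (k + 3) ∣ a - z ^ 2 then 1 else 0) =
      if 8 ∣ a - 1 then 4 else 0 := by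
  rw [← dyadicSum_odd_sq (c := 1) (by norm_num) k a]
  congr 1
  funext z
  refine ite_one_zero_congr ?_
  rw [one_mul, dvd_sub_comm]
  refine ⟨fun h => ⟨fun hz => ?_, h⟩, fun h => h.2⟩
  obtain ⟨u, hu⟩ := Int.exists_sq_eq_four_mul hz
  have := Int.eight_dvd_of_two_pow_dvd h
  omega

/-- The number of solutions of `2 ^ m * c * x ^ 2 + d * y ^ 2 ≡ z ^ 2` modulo `2 ^ k` with `x`
odd. -/
def oddSolutions (k m : ℕ) (c d : ℤ) : ℕ :=
  dyadicSum k fun x => dyadicSum k fun y => dyadicSum k fun z =>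
    if ¬ 2 ∣ x ∧ 2 ^ k ∣ 2 ^ m * c * x ^ 2 + d * y ^ 2 - z ^ 2 then 1 else 0

theorem oddSolutions_zero {c d : ℤ} (hc : ¬ 2 ∣ c) (hd : 4 ∣ d - 1) (k : ℕ) :
    2 * oddSolutions (k + 3) 0 c d = 4 ^ (k + 3) := by
  have inner : ∀ y z : ℤ, dyadicSum (k + 3) (fun x =>
      if ¬ 2 ∣ x ∧ 2 ^ (k + 3) ∣ 2 ^ 0 * c * x ^ 2 + d * y ^ 2 - z ^ 2 then 1 else 0) =
      if 8 ∣ z ^ 2 - d * y ^ 2 - c then 4 else 0 := by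
    intro y z
    rw [← dyadicSum_odd_sq hc k]
    congr 1
    funext x
    rw [show 2 ^ 0 * c * x ^ 2 + d * y ^ 2 - z ^ 2 = c * x ^ 2 - (z ^ 2 - d * y ^ 2) by ring]
  have perz : ∀ y i t : ℤ, (if 8 ∣ (i + 2 ^ 3 * t) ^ 2 - d * y ^ 2 - c then 4 else 0 : ℕ) =
      if 8 ∣ i ^ 2 - d * y ^ 2 - c then 4 else 0 := by
    intro y i t
    have := Int.dvd_mul_sq_shift 8 1 (- d * y ^ 2 - c) i t
    simp only [show (2 : ℤ) ^ 3 = 8 by norm_num]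
    rw [show (i + 8 * t) ^ 2 - d * y ^ 2 - c = 1 * (i + 8 * t) ^ 2 + (- d * y ^ 2 - c) by ring,
      show i ^ 2 - d * y ^ 2 - c = 1 * i ^ 2 + (- d * y ^ 2 - c) by ring]
    simp only [this]
  have pery : ∀ z i t : ℤ, (if 8 ∣ z ^ 2 - d * (i + 2 ^ 3 * t) ^ 2 - c then 4 else 0 : ℕ) =
      if 8 ∣ z ^ 2 - d * i ^ 2 - c then 4 else 0 := by
    intro z i t
    have := Int.dvd_mul_sq_shift 8 (-d) (z ^ 2 - c) i t
    simp only [show (2 : ℤ) ^ 3 = 8 by norm_num]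
    rw [show z ^ 2 - d * (i + 8 * t) ^ 2 - c = -d * (i + 8 * t) ^ 2 + (z ^ 2 - c) by ring,
      show z ^ 2 - d * i ^ 2 - c = -d * i ^ 2 + (z ^ 2 - c) by ring]
    simp only [this]
  have sumz : ∀ y : ℤ, dyadicSum (3 + k) (fun z => if 8 ∣ z ^ 2 - d * y ^ 2 - c then 4 else 0) =
      2 ^ k * dyadicSum 3 (fun z => if 8 ∣ z ^ 2 - d * y ^ 2 - c then 4 else 0) := fun y =>
    dyadicSum.add_of_periodic
      (f := fun z => if 8 ∣ z ^ 2 - d * y ^ 2 - c then 4 else 0) (perz y) k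
  have sumy : dyadicSum (3 + k) (fun y => dyadicSum 3 (fun z =>
      if 8 ∣ z ^ 2 - d * y ^ 2 - c then 4 else 0)) =
      2 ^ k * dyadicSum 3 (fun y => dyadicSum 3 (fun z =>
      if 8 ∣ z ^ 2 - d * y ^ 2 - c then 4 else 0)) :=
    dyadicSum.add_of_periodic (f := fun y => dyadicSum 3 (fun z =>
      if 8 ∣ z ^ 2 - d * y ^ 2 - c then 4 else 0))
      (fun i t => by simp only [pery]) k
  have base : dyadicSum 3 (fun y => dyadicSum 3 (fun z =>
      if 8 ∣ z ^ 2 - d * y ^ 2 - c then 4 else 0)) = 32 := by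
    have red : ∀ y z : ℤ, (if 8 ∣ z ^ 2 - d * y ^ 2 - c then 4 else 0 : ℕ) =
        if 8 ∣ z ^ 2 - (d % 8) * y ^ 2 - c % 8 then 4 else 0 := by
      intro y z
      have : 8 ∣ z ^ 2 - d * y ^ 2 - c ↔ 8 ∣ z ^ 2 - (d % 8) * y ^ 2 - c % 8 := by
        rw [show z ^ 2 - d * y ^ 2 - c = z ^ 2 - (d % 8) * y ^ 2 - c % 8 +
          8 * (- (d / 8) * y ^ 2 - c / 8) by
            linear_combination y ^ 2 * Int.emod_add_mul_ediv d 8 + Int.emod_add_mul_ediv c 8]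
        exact dvd_add_left (dvd_mul_right _ _)
      simp only [this]
    simp only [red]
    have hd' : d % 8 = 1 ∨ d % 8 = 5 := by omega
    have hc' : c % 8 = 1 ∨ c % 8 = 3 ∨ c % 8 = 5 ∨ c % 8 = 7 := by omega
    rcases hd' with h | h <;> rcases hc' with h' | h' | h' | h' <;> rw [h, h'] <;> decide
  rw [oddSolutions, dyadicSum.comm]
  have : ∀ y : ℤ, dyadicSum (k + 3) (fun x => dyadicSum (k + 3) fun z =>
      if ¬ 2 ∣ x ∧ 2 ^ (k + 3) ∣ 2 ^ 0 * c * x ^ 2 + d * y ^ 2 - z ^ 2 then 1 else 0) =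
      2 ^ k * dyadicSum 3 (fun z => if 8 ∣ z ^ 2 - d * y ^ 2 - c then 4 else 0) := by
    intro y
    rw [dyadicSum.comm]
    simp only [inner]
    rw [← sumz, add_comm]
  simp only [this]
  rw [dyadicSum.mul_left, add_comm k 3, sumy, base, pow_add,
    ← Nat.two_pow_mul_two_pow_self k]
  ring

theorem oddSolutions_one {d : ℤ} (hd : 4 ∣ d - 1) (k : ℕ) (c : ℤ) (hc : ¬ 2 ∣ c) :
    oddSolutions (k + 2) 1 c d = 0 := by
  have h : ∀ x y z : ℤ,
      ¬ (¬ 2 ∣ x ∧ 2 ^ (k + 2) ∣ 2 ^ 1 * c * x ^ 2 + d * y ^ 2 - z ^ 2) := by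
    rintro x y z ⟨hx, h⟩
    have h4 := (show (4 : ℤ) ∣ 2 ^ (k + 2) from ⟨2 ^ k, by ring⟩).trans h
    obtain ⟨u, hu⟩ := Int.exists_sq_eq_eight_mul_add_one hx
    obtain ⟨e, he⟩ := hd
    rw [show 2 ^ 1 * c * x ^ 2 + d * y ^ 2 - z ^ 2 =
      4 * (4 * c * u + e * y ^ 2) + (2 * c + y ^ 2 - z ^ 2) by
        linear_combination 2 * c * hu + y ^ 2 * he, dvd_add_right (dvd_mul_right _ _)] at h4
    by_cases hy : 2 ∣ y <;> by_cases hz : 2 ∣ z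
    · obtain ⟨v, hv⟩ := Int.exists_sq_eq_four_mul hy
      obtain ⟨w, hw⟩ := Int.exists_sq_eq_four_mul hz
      omega
    · obtain ⟨v, hv⟩ := Int.exists_sq_eq_four_mul hy
      obtain ⟨w, hw⟩ := Int.exists_sq_eq_eight_mul_add_one hz
      omega
    · obtain ⟨v, hv⟩ := Int.exists_sq_eq_eight_mul_add_one hy
      obtain ⟨w, hw⟩ := Int.exists_sq_eq_four_mul hz
      omega
    · obtain ⟨v, hv⟩ := Int.exists_sq_eq_eight_mul_add_one hy
      obtain ⟨w, hw⟩ := Int.exists_sq_eq_eight_mul_add_one hz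
      omega
  simp only [oddSolutions, h, if_false, dyadicSum.const, mul_zero]

theorem oddSolutions_add_two {d : ℤ} (hd : ¬ 2 ∣ d) (k m : ℕ) (c : ℤ) :
    oddSolutions (k + 3) (m + 2) c d =
      (if 8 ∣ 2 ^ (m + 2) * c + d - 1 then 4 ^ (k + 3) else 0) + 16 * oddSolutions (k + 1) m c d := by
  have y_odd : ∀ x y : ℤ, dyadicSum (k + 3) (fun z => if ¬ 2 ∣ x ∧
      2 ^ (k + 3) ∣ 2 ^ (m + 2) * c * x ^ 2 + d * (2 * y + 1) ^ 2 - z ^ 2 then 1 else 0) =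
      if 2 ∣ x then 0 else if 8 ∣ 2 ^ (m + 2) * c + d - 1 then 4 else 0 := by
    intro x y
    by_cases hx : 2 ∣ x
    · simp only [hx, not_true_eq_false, false_and, if_false, if_true, dyadicSum.const, mul_zero]
    simp only [hx, not_false_eq_true, true_and, if_false]
    obtain ⟨u, hu⟩ := Int.exists_sq_eq_eight_mul_add_one hx
    obtain ⟨v, hv⟩ := Int.exists_sq_eq_eight_mul_add_one (x := 2 * y + 1) (by omega)
    have e : 2 ^ (m + 2) * c * x ^ 2 + d * (2 * y + 1) ^ 2 =
        2 ^ (m + 2) * c + d + 8 * (2 ^ (m + 2) * c * u + d * v) := by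
      rw [hu, hv]
      ring
    have e2 : (2 : ℤ) ^ (m + 2) * c = 2 * (2 ^ (m + 1) * c) := by ring
    rw [dyadicSum_sqrt_odd k (by rw [e]; omega)]
    have : 8 ∣ 2 ^ (m + 2) * c * x ^ 2 + d * (2 * y + 1) ^ 2 - 1 ↔
        8 ∣ 2 ^ (m + 2) * c + d - 1 := by
      rw [e]
      omega
    simp only [this]
  have y_even : ∀ x y : ℤ, dyadicSum (k + 3) (fun z => if ¬ 2 ∣ x ∧
      2 ^ (k + 3) ∣ 2 ^ (m + 2) * c * x ^ 2 + d * (2 * y) ^ 2 - z ^ 2 then 1 else 0) =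
      dyadicSum (k + 2) (fun z => if ¬ 2 ∣ x ∧
        2 ^ (k + 1) ∣ 2 ^ m * c * x ^ 2 + d * y ^ 2 - z ^ 2 then 1 else 0) := by
    intro x y
    rw [dyadicSum.succ_eq_even_add_odd]
    have h1 : ∀ z : ℤ, ¬ (¬ 2 ∣ x ∧ 2 ^ (k + 3) ∣
        2 ^ (m + 2) * c * x ^ 2 + d * (2 * y) ^ 2 - (2 * z + 1) ^ 2) := by
      rintro z ⟨-, h⟩
      have h8 := Int.eight_dvd_of_two_pow_dvd h
      rw [show 2 ^ (m + 2) * c * x ^ 2 + d * (2 * y) ^ 2 - (2 * z + 1) ^ 2 =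
        4 * (2 ^ m * c * x ^ 2 + d * y ^ 2 - z ^ 2 - z) - 1 by ring] at h8
      omega
    have h2 : ∀ z : ℤ, 2 ^ (k + 3) ∣
        2 ^ (m + 2) * c * x ^ 2 + d * (2 * y) ^ 2 - (2 * z) ^ 2 ↔
        2 ^ (k + 1) ∣ 2 ^ m * c * x ^ 2 + d * y ^ 2 - z ^ 2 := by
      intro z
      rw [show 2 ^ (m + 2) * c * x ^ 2 + d * (2 * y) ^ 2 - (2 * z) ^ 2 =
        4 * (2 ^ m * c * x ^ 2 + d * y ^ 2 - z ^ 2) by ring,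
        show (2 : ℤ) ^ (k + 3) = 4 * 2 ^ (k + 1) by ring]
      exact mul_dvd_mul_iff_left (by norm_num)
    simp only [h1, h2, if_false, dyadicSum.const, mul_zero, add_zero]
  have two_dvd : ∀ x t : ℤ, 2 ∣ x + 2 ^ (k + 1) * t ↔ 2 ∣ x := fun x t =>
    dvd_add_left ⟨2 ^ k * t, by ring⟩
  have perx : ∀ y z x t : ℤ, (if ¬ 2 ∣ x + 2 ^ (k + 1) * t ∧ 2 ^ (k + 1) ∣
      2 ^ m * c * (x + 2 ^ (k + 1) * t) ^ 2 + d * y ^ 2 - z ^ 2 then 1 else 0 : ℕ) =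
      if ¬ 2 ∣ x ∧ 2 ^ (k + 1) ∣ 2 ^ m * c * x ^ 2 + d * y ^ 2 - z ^ 2 then 1 else 0 := by
    intro y z x t
    simp only [two_dvd, add_sub_assoc, Int.dvd_mul_sq_shift]
  have pery : ∀ x z y t : ℤ, (if ¬ 2 ∣ x ∧ 2 ^ (k + 1) ∣
      2 ^ m * c * x ^ 2 + d * (y + 2 ^ (k + 1) * t) ^ 2 - z ^ 2 then 1 else 0 : ℕ) =
      if ¬ 2 ∣ x ∧ 2 ^ (k + 1) ∣ 2 ^ m * c * x ^ 2 + d * y ^ 2 - z ^ 2 then 1 else 0 := by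
    intro x z y t
    have := Int.dvd_mul_sq_shift (2 ^ (k + 1)) d (2 ^ m * c * x ^ 2 - z ^ 2) y t
    refine ite_one_zero_congr (and_congr_right fun _ => ?_)
    convert this using 2 <;> ring
  have perz : ∀ x y z t : ℤ, (if ¬ 2 ∣ x ∧ 2 ^ (k + 1) ∣
      2 ^ m * c * x ^ 2 + d * y ^ 2 - (z + 2 ^ (k + 1) * t) ^ 2 then 1 else 0 : ℕ) =
      if ¬ 2 ∣ x ∧ 2 ^ (k + 1) ∣ 2 ^ m * c * x ^ 2 + d * y ^ 2 - z ^ 2 then 1 else 0 := by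
    intro x y z t
    have := Int.dvd_mul_sq_shift (2 ^ (k + 1)) (-1) (2 ^ m * c * x ^ 2 + d * y ^ 2) z t
    refine ite_one_zero_congr (and_congr_right fun _ => ?_)
    convert this using 2 <;> ring
  have sumz : ∀ x y : ℤ, dyadicSum (k + 2) (fun z => if ¬ 2 ∣ x ∧ 2 ^ (k + 1) ∣
      2 ^ m * c * x ^ 2 + d * y ^ 2 - z ^ 2 then 1 else 0) =
      2 * dyadicSum (k + 1) (fun z => if ¬ 2 ∣ x ∧ 2 ^ (k + 1) ∣
        2 ^ m * c * x ^ 2 + d * y ^ 2 - z ^ 2 then 1 else 0) := fun x y =>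
    dyadicSum.add_of_periodic (j := k + 1) (f := fun z => if ¬ 2 ∣ x ∧ 2 ^ (k + 1) ∣
      2 ^ m * c * x ^ 2 + d * y ^ 2 - z ^ 2 then 1 else 0) (perz x y) 1
  have sumy : ∀ x : ℤ, dyadicSum (k + 2) (fun y => dyadicSum (k + 1) (fun z =>
      if ¬ 2 ∣ x ∧ 2 ^ (k + 1) ∣ 2 ^ m * c * x ^ 2 + d * y ^ 2 - z ^ 2 then 1 else 0)) =
      2 * dyadicSum (k + 1) (fun y => dyadicSum (k + 1) (fun z => if ¬ 2 ∣ x ∧ 2 ^ (k + 1) ∣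
        2 ^ m * c * x ^ 2 + d * y ^ 2 - z ^ 2 then 1 else 0)) := fun x =>
    dyadicSum.add_of_periodic (j := k + 1) (f := fun y => dyadicSum (k + 1) (fun z =>
      if ¬ 2 ∣ x ∧ 2 ^ (k + 1) ∣ 2 ^ m * c * x ^ 2 + d * y ^ 2 - z ^ 2 then 1 else 0))
      (fun i t => by simp only [pery]) 1
  have sumx : dyadicSum (k + 3) (fun x => dyadicSum (k + 1) (fun y => dyadicSum (k + 1) (fun z =>
      if ¬ 2 ∣ x ∧ 2 ^ (k + 1) ∣ 2 ^ m * c * x ^ 2 + d * y ^ 2 - z ^ 2 then 1 else 0))) =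
      4 * oddSolutions (k + 1) m c d :=
    dyadicSum.add_of_periodic (j := k + 1) (f := fun x => dyadicSum (k + 1) (fun y =>
      dyadicSum (k + 1) (fun z =>
      if ¬ 2 ∣ x ∧ 2 ^ (k + 1) ∣ 2 ^ m * c * x ^ 2 + d * y ^ 2 - z ^ 2 then 1 else 0)))
      (fun i t => by simp only [perx]) 2
  have sum_yz : ∀ x : ℤ, dyadicSum (k + 3) (fun y => dyadicSum (k + 3) (fun z =>
      if ¬ 2 ∣ x ∧ 2 ^ (k + 3) ∣ 2 ^ (m + 2) * c * x ^ 2 + d * y ^ 2 - z ^ 2 then 1 else 0)) =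
      4 * dyadicSum (k + 1) (fun y => dyadicSum (k + 1) (fun z =>
        if ¬ 2 ∣ x ∧ 2 ^ (k + 1) ∣ 2 ^ m * c * x ^ 2 + d * y ^ 2 - z ^ 2 then 1 else 0)) +
      2 ^ (k + 2) * if 2 ∣ x then 0 else if 8 ∣ 2 ^ (m + 2) * c + d - 1 then 4 else 0 := by
    intro x
    rw [dyadicSum.succ_eq_even_add_odd]
    simp only [y_odd, y_even, sumz, dyadicSum.const, dyadicSum.mul_left, sumy]
    ring
  rw [oddSolutions]
  simp only [sum_yz]
  rw [dyadicSum.add, dyadicSum.mul_left, dyadicSum.mul_left, sumx, dyadicSum.odd_indicator]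
  split_ifs
  · rw [pow_add 4 k 3, ← Nat.two_pow_mul_two_pow_self k]
    ring
  · ring

theorem two_mul_oddSolutions {c d : ℤ} (hc : ¬ 2 ∣ c) (hd : 8 ∣ d - 1) (m : ℕ) :
    ∀ k, 2 * oddSolutions (m + k + 4) (m + 1) c d = m * 4 ^ (m + k + 4) := by
  induction m using Nat.twoStepInduction with
  | zero =>
    intro k
    rw [zero_add, zero_add, oddSolutions_one (by omega) (k + 2) c hc]
    simp
  | one =>
    intro k
    have h := oddSolutions_add_two (d := d) (by omega) (k + 2) 0 c
    rw [if_neg (by omega), zero_add] at h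
    rw [show 1 + k + 4 = k + 2 + 3 by ring, show 1 + 1 = 0 + 2 by rfl, h]
    have := oddSolutions_zero hc (d := d) (by omega) k
    rw [show k + 2 + 1 = k + 3 by ring]
    rw [show k + 2 + 3 = k + 3 + 2 by ring, pow_add 4 (k + 3) 2]
    omega
  | more m ih _ =>
    intro k
    have h := oddSolutions_add_two (d := d) (by omega) (m + k + 3) (m + 1) c
    have e : (2 : ℤ) ^ (m + 1 + 2) * c = 8 * (2 ^ m * c) := by ring
    rw [if_pos (by omega)] at h
    rw [show m + 2 + k + 4 = m + k + 3 + 3 by ring, show m + 2 + 1 = m + 1 + 2 by ring, h,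
      mul_add, mul_left_comm, show m + k + 3 + 1 = m + k + 4 by ring, ih k]
    ring

/-- The number of solutions of `2 ^ m * c * x ^ 2 + d * y ^ 2 ≡ z ^ 2` modulo `2 ^ (k + 3)` with
`x` even and `y` odd. -/
theorem dyadicSum_even_odd {d : ℤ} (hd : ¬ 2 ∣ d) {m : ℕ} (hm : m ≠ 0) (k : ℕ) (c : ℤ) :
    (dyadicSum (k + 3) fun x => dyadicSum (k + 3) fun y => dyadicSum (k + 3) fun z =>
      if (2 ∣ x ∧ ¬ 2 ∣ y) ∧ 2 ^ (k + 3) ∣ 2 ^ m * c * x ^ 2 + d * y ^ 2 - z ^ 2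
        then 1 else 0) = if 8 ∣ d - 1 then 4 ^ (k + 3) else 0 := by
  obtain ⟨m, rfl⟩ := Nat.exists_eq_succ_of_ne_zero hm
  have inner : ∀ x y : ℤ, dyadicSum (k + 3) (fun z => if (2 ∣ x ∧ ¬ 2 ∣ y) ∧
      2 ^ (k + 3) ∣ 2 ^ (m + 1) * c * x ^ 2 + d * y ^ 2 - z ^ 2 then 1 else 0) =
      if 2 ∣ x then if 2 ∣ y then 0 else if 8 ∣ d - 1 then 4 else 0 else 0 := by
    intro x y
    by_cases hx : 2 ∣ x
    swap
    · simp only [hx, false_and, if_false, dyadicSum.const, mul_zero]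
    by_cases hy : 2 ∣ y
    · simp only [hy, not_true_eq_false, and_false, false_and, if_false, if_true, dyadicSum.const,
        mul_zero, ite_self]
    simp only [hx, hy, not_false_eq_true, true_and, if_false, if_true]
    obtain ⟨u, hu⟩ := Int.exists_sq_eq_four_mul hx
    obtain ⟨v, hv⟩ := Int.exists_sq_eq_eight_mul_add_one hy
    have e : 2 ^ (m + 1) * c * x ^ 2 + d * y ^ 2 = d + 8 * (2 ^ m * c * u + d * v) := by
      rw [hu, hv]
      ring
    rw [dyadicSum_sqrt_odd k (by omega)]
    have : 8 ∣ 2 ^ (m + 1) * c * x ^ 2 + d * y ^ 2 - 1 ↔ 8 ∣ d - 1 := by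
      rw [e]
      omega
    simp only [this]
  have sum_y : ∀ x : ℤ, dyadicSum (k + 3) (fun y =>
      if 2 ∣ x then if 2 ∣ y then 0 else if 8 ∣ d - 1 then 4 else 0 else 0) =
      if 2 ∣ x then 2 ^ (k + 2) * (if 8 ∣ d - 1 then 4 else 0) else 0 := by
    intro x
    by_cases hx : 2 ∣ x
    · simp only [hx, if_true, dyadicSum.odd_indicator]
    · simp only [hx, if_false, dyadicSum.const, mul_zero]
  simp only [inner, sum_y, dyadicSum.even_indicator]
  split_ifs
  · rw [pow_add 4 k 3, ← Nat.two_pow_mul_two_pow_self k]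
    ring
  · ring

theorem two_mul_dyadicSum_not_both_even {c d : ℤ} (hc : ¬ 2 ∣ c) (hd : ¬ 2 ∣ d) {m : ℕ}
    (hm : 2 ≤ m) (h : 8 ∣ 2 ^ m * c + d - 1) {K : ℕ} (hK : m + 3 ≤ K) :
    2 * (dyadicSum K fun x => dyadicSum K fun y => dyadicSum K fun z =>
      if ¬ (2 ∣ x ∧ 2 ∣ y) ∧ 2 ^ K ∣ 2 ^ m * c * x ^ 2 + d * y ^ 2 - z ^ 2 then 1 else 0) =
      (m + 1) * 4 ^ K := by
  have split : ∀ x y z : ℤ,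
      (if ¬ (2 ∣ x ∧ 2 ∣ y) ∧ 2 ^ K ∣ 2 ^ m * c * x ^ 2 + d * y ^ 2 - z ^ 2 then 1 else 0 : ℕ) =
      (if ¬ 2 ∣ x ∧ 2 ^ K ∣ 2 ^ m * c * x ^ 2 + d * y ^ 2 - z ^ 2 then 1 else 0) +
      if (2 ∣ x ∧ ¬ 2 ∣ y) ∧ 2 ^ K ∣ 2 ^ m * c * x ^ 2 + d * y ^ 2 - z ^ 2 then 1 else 0 := by
    intro x y z
    by_cases hx : 2 ∣ x <;> simp only [hx, true_and, false_and, not_true_eq_false,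
      not_false_eq_true, if_false, zero_add, add_zero]
  simp only [split, dyadicSum.add]
  obtain ⟨k, rfl⟩ := Nat.exists_eq_add_of_le hK
  have even_odd := dyadicSum_even_odd hd (by omega : m ≠ 0) (m + k) c
  rw [show m + k + 3 = m + 3 + k by ring] at even_odd
  rw [even_odd]
  change 2 * (oddSolutions (m + 3 + k) m c d + _) = _
  rcases hm.eq_or_lt with rfl | hm
  · have rec2 := oddSolutions_add_two hd (k + 2) 0 c
    rw [zero_add, if_pos h, show k + 2 + 1 = k + 3 by ring] at rec2
    rw [if_neg (by omega), show 2 + 3 + k = k + 2 + 3 by ring, rec2, add_zero, mul_add,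
      mul_left_comm, oddSolutions_zero hc (by omega) k]
    ring
  · obtain ⟨m, rfl⟩ := Nat.exists_eq_add_of_lt hm
    have e : (2 : ℤ) ^ (2 + m + 1) * c = 8 * (2 ^ m * c) := by ring
    have h8 : 8 ∣ d - 1 := by omega
    have := two_mul_oddSolutions hc h8 (2 + m) k
    rw [if_pos h8, show 2 + m + 1 + 3 + k = 2 + m + k + 4 by ring, mul_add, this]
    ring

theorem dyadicSum_two_mul_sq {c d ε : ℤ} (hc : ¬ 2 ∣ c) (hd : ¬ 2 ∣ d) (hε : ε = 0 ∨ ε = 1)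
    (h : 8 ∣ c + d - 2 * ε) (k : ℕ) :
    (dyadicSum (k + 3) fun x => dyadicSum (k + 3) fun y => dyadicSum (k + 3) fun z =>
      if ¬ (2 ∣ x ∧ 2 ∣ y) ∧ 2 ^ (k + 3) ∣ c * x ^ 2 + d * y ^ 2 - 2 * z ^ 2 then 1 else 0) =
      4 ^ (k + 3) := by
  have inner : ∀ y z : ℤ, dyadicSum (k + 3) (fun x => if ¬ (2 ∣ x ∧ 2 ∣ y) ∧
      2 ^ (k + 3) ∣ c * x ^ 2 + d * y ^ 2 - 2 * z ^ 2 then 1 else 0) =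
      if 2 ∣ y then 0 else if 2 ∣ z - ε then 4 else 0 := by
    intro y z
    have parity : ∀ x : ℤ, 8 ∣ c * x ^ 2 + d * y ^ 2 - 2 * z ^ 2 → (2 ∣ x ↔ 2 ∣ y) := by
      intro x h8
      have h2 : (2 : ℤ) ∣ c * x ^ 2 + d * y ^ 2 := by omega
      have hx : 2 ∣ c * x ^ 2 ↔ 2 ∣ x := by
        rw [Int.prime_two.dvd_mul, Int.prime_two.dvd_pow_iff_dvd two_ne_zero]
        tauto
      have hy : 2 ∣ d * y ^ 2 ↔ 2 ∣ y := by
        rw [Int.prime_two.dvd_mul, Int.prime_two.dvd_pow_iff_dvd two_ne_zero]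
        tauto
      rw [← hx, ← hy]
      omega
    by_cases hy : 2 ∣ y
    · have : ∀ x : ℤ, ¬ (¬ (2 ∣ x ∧ 2 ∣ y) ∧
          2 ^ (k + 3) ∣ c * x ^ 2 + d * y ^ 2 - 2 * z ^ 2) := by
        rintro x ⟨h1, h2⟩
        have := parity x (Int.eight_dvd_of_two_pow_dvd h2)
        tauto
      simp only [this, if_false, dyadicSum.const, mul_zero, if_pos hy]
    obtain ⟨v, hv⟩ := Int.exists_sq_eq_eight_mul_add_one hy
    have e : d * y ^ 2 = d + 8 * (d * v) := by
      rw [hv]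
      ring
    have hz : 8 ∣ 2 * z ^ 2 - d * y ^ 2 - c ↔ 2 ∣ z - ε := by
      rw [e]
      by_cases hz : 2 ∣ z
      · obtain ⟨w, hw⟩ := Int.exists_sq_eq_four_mul hz
        omega
      · obtain ⟨w, hw⟩ := Int.exists_sq_eq_eight_mul_add_one hz
        omega
    have := dyadicSum_odd_sq hc k (2 * z ^ 2 - d * y ^ 2)
    simp only [hz] at this
    rw [if_neg hy, ← this]
    congr 1
    funext x
    refine ite_one_zero_congr ?_
    rw [show c * x ^ 2 - (2 * z ^ 2 - d * y ^ 2) = c * x ^ 2 + d * y ^ 2 - 2 * z ^ 2 by ring]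
    refine and_congr_left fun h => ?_
    have := parity x (Int.eight_dvd_of_two_pow_dvd h)
    tauto
  have sum_xz : ∀ y : ℤ, dyadicSum (k + 3) (fun x => dyadicSum (k + 3) fun z =>
      if ¬ (2 ∣ x ∧ 2 ∣ y) ∧ 2 ^ (k + 3) ∣ c * x ^ 2 + d * y ^ 2 - 2 * z ^ 2 then 1 else 0) =
      if 2 ∣ y then 0 else 2 ^ (k + 2) * 4 := by
    intro y
    rw [dyadicSum.comm]
    simp only [inner]
    by_cases hy : 2 ∣ y
    · simp only [hy, if_true, dyadicSum.const, mul_zero]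
    simp only [hy, if_false]
    rcases hε with rfl | rfl
    · simp only [sub_zero, dyadicSum.even_indicator]
    · rw [← dyadicSum.odd_indicator]
      congr 1
      funext z
      split_ifs <;> omega
  rw [dyadicSum.comm]
  simp only [sum_xz, dyadicSum.odd_indicator]
  rw [pow_add 4 k 3, ← Nat.two_pow_mul_two_pow_self k]
  ring

/-- Doubling an equation modulo `2 ^ (K + 1)` multiplies the number of solutions by `8`. -/
theorem dyadicSum_two_mul {A d : ℤ} {K : ℕ} (hK : K ≠ 0) :
    (dyadicSum (K + 1) fun x => dyadicSum (K + 1) fun y => dyadicSum (K + 1) fun z =>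
      if ¬ (2 ∣ x ∧ 2 ∣ y) ∧ 2 ^ (K + 1) ∣ 2 * (A * x ^ 2 + d * y ^ 2 - z ^ 2) then 1 else 0) =
    8 * dyadicSum K fun x => dyadicSum K fun y => dyadicSum K fun z =>
      if ¬ (2 ∣ x ∧ 2 ∣ y) ∧ 2 ^ K ∣ A * x ^ 2 + d * y ^ 2 - z ^ 2 then 1 else 0 := by
  have two_dvd : ∀ x t : ℤ, 2 ∣ x + 2 ^ K * t ↔ 2 ∣ x := fun x t =>
    dvd_add_left ((dvd_pow_self 2 hK).mul_right t)
  simp only [pow_succ' (2 : ℤ), mul_dvd_mul_iff_left (two_ne_zero' ℤ)]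
  let f : ℤ → ℤ → ℤ → ℕ := fun x y z =>
    if ¬ (2 ∣ x ∧ 2 ∣ y) ∧ 2 ^ K ∣ A * x ^ 2 + d * y ^ 2 - z ^ 2 then 1 else 0
  have perx : ∀ y z x t, f (x + 2 ^ K * t) y z = f x y z := by
    intro y z x t
    simp only [f, two_dvd, add_sub_assoc, Int.dvd_mul_sq_shift]
  have pery : ∀ x z y t, f x (y + 2 ^ K * t) z = f x y z := by
    intro x z y t
    have := Int.dvd_mul_sq_shift (2 ^ K) d (A * x ^ 2 - z ^ 2) y t
    simp only [f, two_dvd]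
    refine ite_one_zero_congr (and_congr_right fun _ => ?_)
    convert this using 2 <;> ring
  have perz : ∀ x y z t, f x y (z + 2 ^ K * t) = f x y z := by
    intro x y z t
    have := Int.dvd_mul_sq_shift (2 ^ K) (-1) (A * x ^ 2 + d * y ^ 2) z t
    refine ite_one_zero_congr (and_congr_right fun _ => ?_)
    convert this using 2 <;> ring
  have sumz : ∀ x y, dyadicSum (K + 1) (f x y) = 2 * dyadicSum K (f x y) := fun x y =>
    dyadicSum.add_of_periodic (perz x y) 1
  have sumy : ∀ x, dyadicSum (K + 1) (fun y => dyadicSum K (f x y)) =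
      2 * dyadicSum K (fun y => dyadicSum K (f x y)) := fun x =>
    dyadicSum.add_of_periodic (f := fun y => dyadicSum K (f x y))
      (fun i t => by simp only [dyadicSum, pery]) 1
  have sumx : dyadicSum (K + 1) (fun x => dyadicSum K (fun y => dyadicSum K (f x y))) =
      2 * dyadicSum K (fun x => dyadicSum K (fun y => dyadicSum K (f x y))) :=
    dyadicSum.add_of_periodic (f := fun x => dyadicSum K (fun y => dyadicSum K (f x y)))
      (fun i t => by simp only [dyadicSum, perx]) 1
  change (dyadicSum (K + 1) fun x => dyadicSum (K + 1) fun y => dyadicSum (K + 1) (f x y)) =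
    8 * dyadicSum K fun x => dyadicSum K fun y => dyadicSum K (f x y)
  simp only [sumz, sumy, sumx, dyadicSum.mul_left]
  ring

theorem ncard_not_both_even (n : ℕ) (a b : ℤ) :
    Set.ncard {t : ZMod (2 ^ n) × ZMod (2 ^ n) × ZMod (2 ^ n) |
      ¬(2 ∣ t.1.val ∧ 2 ∣ t.2.1.val) ∧
      (a : ZMod (2 ^ n)) * t.1 ^ 2 + (b : ZMod (2 ^ n)) * t.2.1 ^ 2 = 2 * t.2.2 ^ 2} =
    dyadicSum n fun x => dyadicSum n fun y => dyadicSum n fun z =>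
      if ¬ (2 ∣ x ∧ 2 ∣ y) ∧ 2 ^ n ∣ a * x ^ 2 + b * y ^ 2 - 2 * z ^ 2 then 1 else 0 := by
  refine ncard_zmod_two_pow n _ _ fun x y z hx hy _ => ?_
  simp only [ZMod.val_cast_of_lt hx, ZMod.val_cast_of_lt hy]
  have h2 : ∀ x : ℕ, 2 ∣ x ↔ (2 : ℤ) ∣ x := fun x => by omega
  rw [h2, h2]
  refine and_congr_right fun _ => ?_
  have := ZMod.intCast_zmod_eq_zero_iff_dvd (a * x ^ 2 + b * y ^ 2 - 2 * z ^ 2) (2 ^ n)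
  push_cast at this
  rw [← this, sub_eq_zero]

theorem tendsto_div_two_pow {u : ℕ → ℕ} {a N : ℕ} (h : ∀ n, N ≤ n → u n = a * 4 ^ n) :
    Filter.Tendsto (fun n : ℕ => (u n : ℝ) / 2 ^ (2 * n)) Filter.atTop (nhds a) := by
  refine tendsto_const_nhds.congr' ?_
  filter_upwards [Filter.eventually_ge_atTop N] with n hn
  rw [h n hn, pow_mul]
  push_cast
  norm_num

theorem dyadic_density_limits (c d : ℤ) (hc : Odd c) (hd : Odd d) :
    ((c + d ≡ 0 [ZMOD (8 : ℤ)] ∨ c + d ≡ 2 [ZMOD (8 : ℤ)]) →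
      Filter.Tendsto (fun n : ℕ =>
        (Set.ncard {t : ZMod (2 ^ n) × ZMod (2 ^ n) × ZMod (2 ^ n) |
          ¬(2 ∣ t.1.val ∧ 2 ∣ t.2.1.val) ∧
          (c : ZMod (2 ^ n)) * t.1 ^ 2 + (d : ZMod (2 ^ n)) * t.2.1 ^ 2 =
            2 * t.2.2 ^ 2} : ℝ) / 2 ^ (2 * n))
        Filter.atTop (nhds 1)) ∧
    (∀ μ : ℕ, 3 ≤ μ → (2 ^ (μ - 1) * c + d ≡ 1 [ZMOD (8 : ℤ)]) →
      Filter.Tendsto (fun n : ℕ =>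
        (Set.ncard {t : ZMod (2 ^ n) × ZMod (2 ^ n) × ZMod (2 ^ n) |
          ¬(2 ∣ t.1.val ∧ 2 ∣ t.2.1.val) ∧
          ((2 ^ μ * c : ℤ) : ZMod (2 ^ n)) * t.1 ^ 2 +
            ((2 * d : ℤ) : ZMod (2 ^ n)) * t.2.1 ^ 2 = 2 * t.2.2 ^ 2} : ℝ) / 2 ^ (2 * n))
        Filter.atTop (nhds (μ : ℝ))) := by
  have hc2 : ¬ 2 ∣ c := by rwa [← even_iff_two_dvd, Int.not_even_iff_odd]
  have hd2 : ¬ 2 ∣ d := by rwa [← even_iff_two_dvd, Int.not_even_iff_odd]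
  refine ⟨fun h => ?_, fun μ hμ h => ?_⟩
  · obtain ⟨ε, hε, h8⟩ : ∃ ε : ℤ, (ε = 0 ∨ ε = 1) ∧ 8 ∣ c + d - 2 * ε := by
      rcases h with h | h
      · exact ⟨0, .inl rfl, h.symm.dvd⟩
      · exact ⟨1, .inr rfl, h.symm.dvd⟩
    rw [show nhds (1 : ℝ) = nhds ((1 : ℕ) : ℝ) by rw [Nat.cast_one]]
    refine tendsto_div_two_pow (N := 3) fun n hn => ?_
    obtain ⟨k, rfl⟩ := Nat.exists_eq_add_of_le' hn
    rw [ncard_not_both_even, dyadicSum_two_mul_sq hc2 hd2 hε h8, one_mul]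
  · obtain ⟨m, rfl⟩ : ∃ m, μ = m + 1 := ⟨μ - 1, by omega⟩
    refine tendsto_div_two_pow (N := m + 4) fun n hn => ?_
    obtain ⟨K, rfl⟩ : ∃ K, n = K + 1 := ⟨n - 1, by omega⟩
    have count := two_mul_dyadicSum_not_both_even hc2 hd2 (by omega : 2 ≤ m) h.symm.dvd
      (by omega : m + 3 ≤ K)
    have double := dyadicSum_two_mul (A := 2 ^ m * c) (d := d) (by omega : K ≠ 0)
    rw [ncard_not_both_even]
    have e : ∀ x y z : ℤ, 2 ^ (m + 1) * c * x ^ 2 + 2 * d * y ^ 2 - 2 * z ^ 2 =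
        2 * (2 ^ m * c * x ^ 2 + d * y ^ 2 - z ^ 2) := fun x y z => by ring
    simp only [e]
    rw [double, pow_succ]
    linarith
end
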